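/- arXiv:2011.00683 — 6 statements merged into one kernel-verified Lean document; each statement's English description precedes it below -/
import Mathlib

section
/- There are exactly 5 isomorphism classes of tournaments on 24 vertices containing no transitive subtournament of size 6; that is, there exist 5 pairwise non-isomorphic TT_6-free tournaments on Fin 24 such that every TT_6-free tournament on Fin 24 is isomorphic to one of them. -/
/-- A tournament: an irreflexive relation such that for distinct vertices
exactly one direction of the edge is present. -/
def IsTournament {V : Type*} (r : V → V → Prop) : Prop :=
  (∀ v, ¬ r v v) ∧ ∀ u v : V, u ≠ v → Xor' (r u v) (r v u)

/-- The tournament `r` contains a transitive subtournament of size `k`. -/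
def HasTT {V : Type*} (r : V → V → Prop) (k : ℕ) : Prop :=
  ∃ f : Fin k → V, Function.Injective f ∧ ∀ i j : Fin k, i < j → r (f i) (f j)

/-- An isomorphism between tournaments: a bijection preserving the relation
in both directions. -/
def TournIso {V W : Type*} (r : V → V → Prop) (s : W → W → Prop) : Prop :=
  ∃ g : V → W, Function.Bijective g ∧ ∀ u v : V, r u v ↔ s (g u) (g v)

namespace Tourn

/-! ### Data manipulated by the kernel

The functions below are written with recursors and raw operations on `ℕ`, because the kernel is
going to evaluate them. Sets of natural numbers are coded by the binary digits of one number, and a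
tournament on `{0, …, N - 1}` with `N ≤ 32` by the number with binary digit `32 * i + j` equal to
one when there is an arc from `i` to `j`. -/

/-- `f x`, arranged so that the kernel evaluates `x` to a literal first. -/
noncomputable def force {α : Type} (x : ℕ) (f : ℕ → α) : α :=
  Nat.rec (motive := fun _ => α) (f 0) (fun y _ => f y) (Nat.add x 1)

/-- `if b then x else y`. -/
noncomputable def cnd {α : Type} (b : Bool) (x y : α) : α :=
  Bool.rec (motive := fun _ => α) y x b

/-- The binary digit of `x` at position `i`. -/
noncomputable def tb (x i : ℕ) : Bool :=
  Nat.beq (Nat.land (Nat.shiftRight x i) 1) 1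

/-- The arc relation of the tournament coded by `O`. -/
noncomputable def arc (O i j : ℕ) : Bool :=
  tb O (Nat.add (Nat.mul 32 i) j)

/-- Whether `f` holds at all numbers below `N`. -/
noncomputable def allBelow (f : ℕ → Bool) (N : ℕ) : Bool :=
  Nat.rec (motive := fun _ => Bool) true (fun y ih => cnd (f y) ih false) N

/-- The lists of `d` elements of `c` that are transitive in `O`. -/
noncomputable def chains (O : ℕ) : ℕ → List ℕ → List (List ℕ)
  | 0, _ => [[]]
  | d + 1, c => c.flatMap fun a => (chains O d (c.filter (arc O a))).map (a :: ·)

/-- The set `{0, …, 2 ^ n - 1}`. -/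
noncomputable def full (n : ℕ) : ℕ :=
  Nat.sub (Nat.shiftLeft 1 (Nat.shiftLeft 1 n)) 1

/-- The set of all `T < 2 ^ n` that contain `a`. -/
noncomputable def col (n a : ℕ) : ℕ :=
  Nat.rec (motive := fun _ => ℕ) 0
    (fun n ih => cnd (Nat.beq a n) (Nat.shiftLeft (full n) (Nat.shiftLeft 1 n))
      (force ih fun y => Nat.lor y (Nat.shiftLeft y (Nat.shiftLeft 1 n)))) n

/-- The set of members of a list. -/
noncomputable def mask : List ℕ → ℕ
  | [] => 0
  | a :: l => Nat.lor (Nat.shiftLeft 1 a) (mask l)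

/-- The set of all `T < 2 ^ n` that contain every member of a list. -/
noncomputable def allIn (n : ℕ) : List ℕ → ℕ
  | [] => full n
  | a :: l => Nat.land (col n a) (allIn n l)

/-- The set of all `T < 2 ^ n` that contain no member of a list. -/
noncomputable def allOut (n : ℕ) : List ℕ → ℕ
  | [] => full n
  | a :: l => Nat.land (Nat.xor (full n) (col n a)) (allOut n l)

/-- The set of all `T < 2 ^ n` that contain every member of `p` and no member of `s`. -/
noncomputable def split (n : ℕ) (p s : List ℕ) : ℕ :=
  Nat.land (allIn n p) (allOut n s)

/-- The union of the sets `split n (p ++ s₁) s₂` over all `s₁ ++ s₂ = s`. -/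
noncomputable def after (n : ℕ) : List ℕ → List ℕ → ℕ
  | p, [] => split n p []
  | p, a :: s => Nat.lor (split n p (a :: s)) (after n (p ++ [a]) s)

/-- A list of triples of numbers. -/
inductive Rules : Type
  | nil : Rules
  | cons (qm pm x : ℕ) (tl : Rules) : Rules

/-- One step of `Rules.force`. -/
noncomputable def Rules.forceStep (qm pm x : ℕ) (ih : (Rules → Bool) → Bool)
    (k : Rules → Bool) : Bool :=
  Tourn.force qm fun a => Tourn.force pm fun b => Tourn.force x fun c =>
    ih fun t => k (Rules.cons a b c t)

/-- `k q`, arranged so that the kernel evaluates all entries of `q` first. -/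
noncomputable def Rules.force (q : Rules) (k : Rules → Bool) : Bool :=
  Rules.rec (motive := fun _ => (Rules → Bool) → Bool) (fun k => k Rules.nil)
    (fun a b c _ ih => Rules.forceStep a b c ih) q k

/-- The rules that come from the splittings `(p ++ s₁) ++ s₂` of a chain `p ++ s`; the set `b` is
the union of the sets `split n p₁ p₂` for the splittings before `p`. -/
noncomputable def items (n qm : ℕ) : List ℕ → List ℕ → ℕ → Rules → Rules
  | p, [], b, q =>
    Rules.cons qm (mask p) (Nat.lor (after n p [])
      (Nat.shiftLeft (Nat.lor b (split n p [])) (Nat.shiftLeft 1 n))) q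
  | p, a :: s, b, q =>
    Rules.cons qm (mask p) (Nat.lor (after n p (a :: s))
      (Nat.shiftLeft (Nat.lor b (split n p (a :: s))) (Nat.shiftLeft 1 n)))
      (items n qm (p ++ [a]) s (Nat.lor b (split n p (a :: s))) q)

/-- The rules that come from a list of chains. -/
noncomputable def mkRules (n : ℕ) : List (List ℕ) → Rules
  | [] => Rules.nil
  | Q :: l => items n (mask Q) [] Q 0 (mkRules n l)

/-- One step of `entry`. -/
noncomputable def entryStep (qm pm x T ih : ℕ) : ℕ :=
  cnd (Nat.beq (Nat.land T qm) pm) (Nat.lor x ih) ih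

/-- The union of the sets `x` over all rules `(qm, pm, x)` with `T ∩ qm = pm`. -/
noncomputable def entry (q : Rules) (T : ℕ) : ℕ :=
  Rules.rec (motive := fun _ => ℕ) 0 (fun qm pm x _ ih => entryStep qm pm x T ih) q

/-- The set of `64 + T'` for the rows `T'` that cannot occur together with `T`. -/
noncomputable def clash (q : Rules) (P T : ℕ) : ℕ :=
  force (entry q T) fun E => Nat.shiftLeft
    (Nat.mod (Nat.land E (Nat.shiftRight E P)) (Nat.shiftLeft 1 P)) 64

/-- A number below `2 ^ 64` that is used to give different search states different hashes. -/
noncomputable def salt (K i : ℕ) : ℕ :=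
  Nat.mod (Nat.mul i K) 18446744073709551616

/-- The position of the leading binary digit of `x`, when it is below `2 ^ k`. -/
noncomputable def lead (x k : ℕ) : ℕ :=
  Nat.rec (motive := fun _ => ℕ → ℕ) (fun _ => 0)
    (fun k ih x => force (Nat.shiftRight x (Nat.shiftLeft 1 k)) fun h =>
      Nat.rec (motive := fun _ => ℕ) (ih x) (fun _ _ => Nat.add (Nat.shiftLeft 1 k) (ih h)) h) k x

/-- `64` less than the position of the leading digit. -/
noncomputable def leadRow (x : ℕ) : ℕ := Nat.sub (lead x 14) 64

/-- The lowest binary digit of `x` at a position that is at least `64`. -/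
noncomputable def lowBit (x : ℕ) : ℕ :=
  Nat.land x (Nat.xor x (Nat.sub x 18446744073709551616))

/-- The smallest row in the set `x` of rows shifted by `64`. -/
noncomputable def lowRow (x : ℕ) : ℕ :=
  force (Nat.mod (lowBit x) 18446744073709551557) fun r =>
    force (Nat.add (lowBit x) r) fun b => leadRow b

/-- The digit to be flipped in order to remove row `i`, with a salt. -/
noncomputable def toggle (i : ℕ) : ℕ :=
  Nat.lor (Nat.shiftLeft 1 (Nat.add i 64)) (salt 3935559000370003845 i)

/-- The rows, shifted by `64`, that avoid some chosen member of `d`. -/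
noncomputable def avoiders (n d : ℕ) : ℕ :=
  force (lead d 4) fun a => cnd (tb d a)
    (Nat.lor (Nat.shiftLeft (Nat.xor (full n) (col n a)) 64) 18446744073709551615)
    (Nat.lor (Nat.shiftLeft (full n) 64) 18446744073709551615)

/-- The rows that are not excluded by a list of chains. -/
noncomputable def rows (n : ℕ) : List (List ℕ) → ℕ
  | [] => full n
  | Q :: l => force (rows n l) fun c => Nat.xor c (Nat.land c (allOut n Q))

/-- The number with `J` digits `1` in base `2 ^ n`. -/
noncomputable def repunit (n : ℕ) : ℕ → ℕ
  | 0 => 0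
  | J + 1 => Nat.add 1 (Nat.mul (Nat.shiftLeft 1 n) (repunit n J))

/-- Update of the demands after row `T` has been chosen: digit `a + n * j` of the demands tells
that `j + 1` more rows avoiding `a` are needed. -/
noncomputable def meet (n P rep D T : ℕ) : ℕ :=
  force (Nat.mul (Nat.xor T (Nat.sub P 1)) rep) fun R =>
    Nat.lor (Nat.xor D (Nat.land D R)) (Nat.land (Nat.shiftRight D n) R)

/-- One step of `search`. -/
noncomputable def searchStep (n P rep : ℕ) (q : Rules)
    (ih : ℕ → ℕ → ℕ → List ℕ → List (List ℕ) → List (List ℕ))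
    (need c D : ℕ) (path : List ℕ) (acc : List (List ℕ)) : List (List ℕ) :=
  Nat.rec (motive := fun _ => List (List ℕ)) (path :: acc)
    (fun need' _ => force (Nat.land c (avoiders n (Nat.mod D P))) fun br =>
      Nat.rec (motive := fun _ => List (List ℕ)) acc
        (fun _ _ => force (lowRow br) fun i =>
          force (clash q P i) fun g =>
          force (Nat.xor (Nat.xor c (Nat.land c g)) (salt 2862933555777941757 i)) fun c1 =>
          force (meet n P rep D i) fun D1 =>
          force (Nat.xor c (toggle i)) fun c2 =>
          ih need' c1 D1 (i :: path) (ih need c2 D path acc)) (Nat.shiftRight br 64)) need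

/-- All ways to extend `path` by `need` rows from `c`, without clashes and meeting the demands `D`,
in front of `acc`. -/
noncomputable def search (n P rep : ℕ) (q : Rules) (fuel : ℕ) :
    ℕ → ℕ → ℕ → List ℕ → List (List ℕ) → List (List ℕ) :=
  Nat.rec (motive := fun _ => ℕ → ℕ → ℕ → List ℕ → List (List ℕ) → List (List ℕ))
    (fun _ _ _ _ acc => [] :: acc) (fun _ ih => searchStep n P rep q ih) fuel

/-- Entry `t` of a list, with default value `0`. -/
noncomputable def nth : List ℕ → ℕ → ℕ
  | [], _ => 0
  | a :: _, 0 => a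
  | _ :: l, t + 1 => nth l t

/-- The arcs that are known in the tournament with vertices `0, …, n - 1` from `O`, then a vertex
`n` dominating them, then one vertex dominating `n` for each row in `path`. -/
noncomputable def known (n P O : ℕ) (q : Rules) (path : List ℕ) (i j : ℕ) : Bool :=
  cnd (Nat.ble n i)
    (cnd (Nat.ble n j)
      (cnd (Nat.beq i n) false (cnd (Nat.beq j n) true (cnd (Nat.beq i j) false
        (force (nth path (Nat.sub (Nat.sub i n) 1)) fun S =>
          force (nth path (Nat.sub (Nat.sub j n) 1)) fun T =>
            cnd (tb (entry q S) (Nat.add P T)) true (tb (entry q T) S)))))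
      (cnd (Nat.beq i n) true (cnd (tb (nth path (Nat.sub (Nat.sub i n) 1)) j) false true)))
    (cnd (Nat.ble n j)
      (cnd (Nat.beq j n) false (tb (nth path (Nat.sub (Nat.sub j n) 1)) i))
      (arc O i j))

/-- Digit `i` of `x` in base `32`. -/
noncomputable def digit (x i : ℕ) : ℕ :=
  Nat.mod (Nat.shiftRight x (Nat.mul 5 i)) 32

/-- Certificates for partially known tournaments: a transitive list, an isomorphism with a known
tournament, or a case distinction on one arc. -/
inductive Cert : Type
  | tt (x : ℕ) : Cert
  | iso (t x : ℕ) : Cert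
  | br (a b : ℕ) (c d : Cert) : Cert

/-- The relation `K` with the arc `(a, b)` added. -/
noncomputable def addArc (a b : ℕ) (K : ℕ → ℕ → Bool) (i j : ℕ) : Bool :=
  cnd (Nat.beq i a) (cnd (Nat.beq j b) true (K i j)) (K i j)

/-- Validity of a certificate for a tournament on `N` vertices of which the arcs in `K` are known,
without transitive subtournaments on `k` vertices. -/
noncomputable def Cert.ok (k n N : ℕ) (Ts : List ℕ) : Cert → (ℕ → ℕ → Bool) → Bool
  | .tt x, K => allBelow (fun j => cnd (Nat.ble N (digit x j)) false
      (allBelow (fun i => K (digit x i) (digit x j)) j)) k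
  | .iso t x, K => cnd (Nat.ble Ts.length t) false (force (nth Ts t) fun T =>
      allBelow (fun j => cnd (Nat.ble N (digit x j)) false
        (allBelow (fun i => cnd (arc T i j) (K (digit x i) (digit x j))
          (cnd (arc T j i) (K (digit x j) (digit x i)) false)) j)) N)
  | .br a b c d, K => cnd (Nat.ble a n) false (cnd (Nat.ble b n) false
      (cnd (Nat.ble N a) false (cnd (Nat.ble N b) false (cnd (Nat.beq a b) false
        (cnd (c.ok k n N Ts (addArc a b K)) (d.ok k n N Ts (addArc b a K)) false)))))

/-- Validity of a list of certificates for a list of leaves of the search. -/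
noncomputable def certify (m : ℕ) (f : List ℕ → Cert → Bool) :
    List (List ℕ) → List Cert → Bool
  | [], _ => true
  | _ :: _, [] => false
  | p :: l, c :: cs => cnd (Nat.beq p.length m) (cnd (f p c) (certify m f l cs) false) false

/-- The number of `b < n` with an arc to `a`. -/
noncomputable def inDeg (O n a : ℕ) : ℕ :=
  Nat.rec (motive := fun _ => ℕ) 0 (fun b ih => cnd (arc O b a) (Nat.add ih 1) ih) n

/-- `O` has no arc in both directions, and demands `D` are justified for minimal in-degree `δ`. -/
noncomputable def inputOk (n J δ O D : ℕ) : Bool :=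
  cnd (allBelow (fun i => allBelow (fun j => cnd (arc O i j) (cnd (arc O j i) false true) true) n) n)
    (cnd (Nat.beq (Nat.shiftRight D (Nat.mul n J)) 0)
      (allBelow (fun a => allBelow (fun j => cnd (tb D (Nat.add (Nat.mul n j) a))
        (Nat.ble (Nat.add j (Nat.add 2 (inDeg O n a))) δ) true) J) n) false) false

/-- The computation for tournaments without transitive subtournaments on `k + 3` vertices in which
a vertex has out-neighbourhood `O` on `n` vertices and `m` in-neighbours, and in which all
in-degrees are at least `δ`: they are isomorphic to a member of `Ts`. -/
noncomputable def check (k n m J δ O D : ℕ) (Ts : List ℕ) (certs : List Cert) : Bool :=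
  cnd (inputOk n J δ O D)
    ((mkRules n (chains O (k + 1) (List.range n) ++
        (chains O k (List.range n)).map (n :: ·))).force fun q =>
      force (Nat.shiftLeft 1 n) fun P => force (repunit n J) fun rep =>
      force (Nat.shiftLeft (rows n (chains O (k + 1) (List.range n))) 64) fun c =>
      certify m (fun p cert => cert.ok (k + 3) n (n + 1 + m) Ts (known n P O q p))
        (search n P rep q (Nat.add P (m + 1)) m c D [] []) certs) false

theorem force_eq {α : Type} (x : ℕ) (f : ℕ → α) : force x f = f x := rfl

theorem cnd_eq {α : Type} (b : Bool) (x y : α) : cnd b x y = if b then x else y := by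
  cases b <;> rfl

theorem cnd_false_iff (a b : Bool) : cnd a b false = true ↔ a = true ∧ b = true := by
  cases a <;> simp [cnd]

theorem cnd_false_left_iff (a b : Bool) : cnd a false b = true ↔ a = false ∧ b = true := by
  cases a <;> simp [cnd]

theorem cnd_true_left_iff (a b : Bool) : cnd a true b = true ↔ a = true ∨ b = true := by
  cases a <;> simp [cnd]

theorem land_eq (x y : ℕ) : Nat.land x y = x &&& y := rfl
theorem lor_eq (x y : ℕ) : Nat.lor x y = x ||| y := rfl
theorem xor_eq (x y : ℕ) : Nat.xor x y = x ^^^ y := rfl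
theorem shiftLeft_eq (x y : ℕ) : Nat.shiftLeft x y = x <<< y := rfl
theorem shiftRight_eq (x y : ℕ) : Nat.shiftRight x y = x >>> y := rfl
theorem add_eq (x y : ℕ) : Nat.add x y = x + y := rfl
theorem mul_eq (x y : ℕ) : Nat.mul x y = x * y := rfl
theorem sub_eq (x y : ℕ) : Nat.sub x y = x - y := rfl
theorem mod_eq (x y : ℕ) : Nat.mod x y = x % y := rfl

theorem tb_eq (x i : ℕ) : tb x i = x.testBit i := by
  rw [Bool.eq_iff_iff, tb, Nat.beq_eq, land_eq, shiftRight_eq, Nat.testBit,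
    Nat.and_comm, Nat.one_and_eq_mod_two]
  rcases Nat.mod_two_eq_zero_or_one (x >>> i) with h | h <;> simp [h]

theorem allBelow_iff (f : ℕ → Bool) (N : ℕ) : allBelow f N = true ↔ ∀ i < N, f i = true := by
  induction N with
  | zero => simp [allBelow]
  | succ N ih =>
    have h : allBelow f (N + 1) = cnd (f N) (allBelow f N) false := rfl
    rw [h, cnd_false_iff, ih]
    constructor
    · rintro ⟨h1, h2⟩ i hi
      rcases Nat.lt_succ_iff_lt_or_eq.1 hi with h | rfl
      · exact h2 i h
      · exact h1
    · exact fun h => ⟨h N (by omega), fun i hi => h i (by omega)⟩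

theorem one_shiftLeft (n : ℕ) : Nat.shiftLeft 1 n = 2 ^ n := Nat.one_shiftLeft n

theorem testBit_full (n T : ℕ) : (full n).testBit T = decide (T < 2 ^ n) := by
  rw [full, one_shiftLeft, one_shiftLeft, sub_eq, Nat.testBit_two_pow_sub_one]

theorem testBit_col (n a T : ℕ) : (col n a).testBit T = true ↔ T < 2 ^ n ∧ T.testBit a = true := by
  induction n generalizing T with
  | zero =>
    have h : col 0 a = 0 := rfl
    rw [h]
    simp only [Nat.zero_testBit, Bool.false_eq_true, pow_zero, Nat.lt_one_iff, false_iff, not_and]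
    rintro rfl
    simp
  | succ n ih =>
    have h : col (n + 1) a = cnd (Nat.beq a n) (Nat.shiftLeft (full n) (Nat.shiftLeft 1 n))
      (Nat.lor (col n a) (Nat.shiftLeft (col n a) (Nat.shiftLeft 1 n))) := rfl
    rw [h, one_shiftLeft, cnd_eq, shiftLeft_eq, shiftLeft_eq, lor_eq]
    have hp : 2 ^ (n + 1) = 2 ^ n + 2 ^ n := by ring
    split_ifs with hn
    · obtain rfl := Nat.eq_of_beq_eq_true hn
      simp only [Nat.testBit_shiftLeft, testBit_full, Bool.and_eq_true, decide_eq_true_eq]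
      constructor
      · rintro ⟨h1, h2⟩
        refine ⟨by omega, ?_⟩
        obtain ⟨x, rfl⟩ := Nat.exists_eq_add_of_le h1
        rw [Nat.testBit_two_pow_add_eq, Nat.testBit_lt_two_pow (by omega)]
        rfl
      · rintro ⟨h1, h2⟩
        have := Nat.ge_two_pow_of_testBit h2
        omega
    · have hn' : a ≠ n := fun h => hn (by simp [h])
      simp only [Nat.testBit_or, Nat.testBit_shiftLeft, Bool.or_eq_true, Bool.and_eq_true,
        decide_eq_true_eq, ih]
      by_cases hT : T < 2 ^ n
      · have : ¬ 2 ^ n ≤ T := by omega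
        simp [hT, this]
        omega
      · obtain ⟨x, rfl⟩ := Nat.exists_eq_add_of_le (Nat.le_of_not_lt hT)
        rcases Nat.lt_or_gt_of_ne hn' with h | h
        · rw [Nat.testBit_two_pow_add_gt h]
          simp
          omega
        · have key : ∀ y < 2 ^ (n + 1), y.testBit a = false := fun y hy =>
            Nat.testBit_lt_two_pow (lt_of_lt_of_le hy (Nat.pow_le_pow_right (by omega) h))
          constructor
          · rintro (⟨h1, -⟩ | ⟨-, h1, h2⟩)
            · omega
            · simp only [Nat.add_sub_cancel_left] at h1 h2
              rw [key _ (by omega)] at h2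
              exact absurd h2 (by simp)
          · rintro ⟨h1, h2⟩
            rw [key _ h1] at h2
            exact absurd h2 (by simp)

theorem testBit_mask (l : List ℕ) (a : ℕ) : (mask l).testBit a = true ↔ a ∈ l := by
  induction l with
  | nil => simp [mask]
  | cons b l ih =>
    rw [mask, lor_eq, one_shiftLeft, Nat.testBit_or, Bool.or_eq_true, ih, Nat.testBit_two_pow]
    simp [eq_comm]

theorem testBit_allIn (n : ℕ) (l : List ℕ) (T : ℕ) :
    (allIn n l).testBit T = true ↔ T < 2 ^ n ∧ ∀ a ∈ l, T.testBit a = true := by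
  induction l with
  | nil => simp [allIn, testBit_full]
  | cons b l ih =>
    rw [allIn, land_eq, Nat.testBit_and, Bool.and_eq_true, ih, testBit_col]
    simp only [List.mem_cons, forall_eq_or_imp]
    tauto

theorem testBit_allOut (n : ℕ) (l : List ℕ) (T : ℕ) :
    (allOut n l).testBit T = true ↔ T < 2 ^ n ∧ ∀ a ∈ l, T.testBit a = false := by
  induction l with
  | nil => simp [allOut, testBit_full]
  | cons b l ih =>
    rw [allOut, land_eq, xor_eq, Nat.testBit_and, Nat.testBit_xor, testBit_full,
      Bool.and_eq_true, ih]
    simp only [List.mem_cons, forall_eq_or_imp]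
    have := testBit_col n b T
    by_cases hT : T < 2 ^ n
    · simp only [hT, decide_true, Bool.true_xor, Bool.not_eq_true', true_and] at this ⊢
      rw [← Bool.not_eq_true, this, Bool.not_eq_true]
    · simp [hT]

theorem testBit_split (n : ℕ) (p s : List ℕ) (T : ℕ) : (split n p s).testBit T = true ↔
    T < 2 ^ n ∧ (∀ a ∈ p, T.testBit a = true) ∧ ∀ a ∈ s, T.testBit a = false := by
  rw [split, land_eq, Nat.testBit_and, Bool.and_eq_true, testBit_allIn, testBit_allOut]
  tauto

theorem testBit_after (n : ℕ) (p s : List ℕ) (T : ℕ) (h : (after n p s).testBit T = true) :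
    ∃ s₁ s₂, s = s₁ ++ s₂ ∧ (split n (p ++ s₁) s₂).testBit T = true := by
  induction s generalizing p with
  | nil => exact ⟨[], [], rfl, by simpa [after] using h⟩
  | cons a s ih =>
    rw [after, lor_eq, Nat.testBit_or, Bool.or_eq_true] at h
    rcases h with h | h
    · exact ⟨[], a :: s, rfl, by simpa using h⟩
    · obtain ⟨s₁, s₂, rfl, h'⟩ := ih _ h
      exact ⟨a :: s₁, s₂, rfl, by simpa using h'⟩

theorem after_lt (n : ℕ) (p s : List ℕ) : after n p s < 2 ^ 2 ^ n := by
  refine Nat.lt_pow_two_of_testBit _ fun i hi => ?_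
  by_contra h
  obtain ⟨s₁, s₂, -, h'⟩ := testBit_after n p s i (by simpa using h)
  exact absurd ((testBit_split n _ _ i).1 h').1 (by omega)

theorem mem_chains (O d : ℕ) (c : List ℕ) (Q : List ℕ) : Q ∈ chains O d c ↔
    Q.length = d ∧ (∀ a ∈ Q, a ∈ c) ∧ Q.Pairwise fun i j => arc O i j = true := by
  induction d generalizing c Q with
  | zero =>
    rw [chains, List.mem_singleton, List.length_eq_zero_iff]
    constructor
    · rintro rfl
      simp
    · exact fun h => h.1
  | succ d ih =>
    simp only [chains, List.mem_flatMap, List.mem_map, ih, List.mem_filter]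
    constructor
    · rintro ⟨a, ha, Q, ⟨h1, h2, h3⟩, rfl⟩
      refine ⟨by simp [h1], ?_, List.pairwise_cons.2 ⟨fun b hb => (h2 b hb).2, h3⟩⟩
      simpa [ha] using fun b hb => (h2 b hb).1
    · rintro ⟨h1, h2, h3⟩
      match Q, h1, h2, h3 with
      | a :: Q, h1, h2, h3 =>
        rw [List.pairwise_cons] at h3
        refine ⟨a, h2 a (by simp), Q, ⟨by simpa using h1, ?_, h3.2⟩, rfl⟩
        exact fun b hb => ⟨h2 b (by simp [hb]), h3.1 b hb⟩

/-! ### Rows -/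

/-- There is no transitive list of `k` vertices in `s`. -/
def NoChain {V : Type} (r : V → V → Prop) (k : ℕ) (s : Finset V) : Prop :=
  ∀ l : List V, l.length = k → (∀ x ∈ l, x ∈ s) → ¬ l.Pairwise r

/-- Enumeration `e 0, …, e (n - 1)` of a part of the out-neighbourhood of the vertex `e n`
according to `O`, in a tournament without transitive subtournaments on `k + 3` vertices. -/
structure Frame {V : Type} (r : V → V → Prop) (k n O : ℕ) (s : Finset V) (e : ℕ → V) : Prop where
  asymm : ∀ x y, r x y → ¬ r y x
  total : ∀ x y, x ≠ y → r x y ∨ r y x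
  noChain : NoChain r (k + 3) s
  mem : ∀ i ≤ n, e i ∈ s
  arc : ∀ i < n, ∀ j < n, (arc O i j = true ↔ r (e i) (e j))
  dom : ∀ i < n, r (e n) (e i)

open Classical in
/-- The set of all `i < n` such that there is an arc from `e i` to `w`. -/
noncomputable def row {V : Type} (r : V → V → Prop) (n : ℕ) (e : ℕ → V) (w : V) : ℕ :=
  Nat.ofBits fun i : Fin n => decide (r (e i) w)

theorem row_lt {V : Type} (r : V → V → Prop) (n : ℕ) (e : ℕ → V) (w : V) :
    row r n e w < 2 ^ n := Nat.ofBits_lt_two_pow _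

theorem testBit_row {V : Type} (r : V → V → Prop) (n : ℕ) (e : ℕ → V) (w : V) (i : ℕ) :
    (row r n e w).testBit i = true ↔ i < n ∧ r (e i) w := by
  by_cases h : i < n
  · simp [row, Nat.testBit_ofBits_lt _ _ h, h]
  · simp [row, Nat.testBit_ofBits_ge _ _ (Nat.le_of_not_lt h), h]

/-- All rules in a list satisfy `φ`. -/
def Rules.All (φ : ℕ → ℕ → ℕ → Prop) : Rules → Prop
  | .nil => True
  | .cons a b c t => φ a b c ∧ t.All φ

theorem Rules.force_apply (q : Rules) (k : Rules → Bool) : q.force k = k q := by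
  induction q generalizing k with
  | nil => rfl
  | cons a b c t ih => exact ih fun t => k (Rules.cons a b c t)

theorem pairwise_insert_two {V : Type} {r : V → V → Prop} {A B C : List V} {u w : V}
    (h : (A ++ (B ++ C)).Pairwise r) (h1 : ∀ x ∈ A, r x u) (h2 : ∀ x ∈ B ++ C, r u x)
    (h3 : ∀ x ∈ A ++ B, r x w) (h4 : ∀ x ∈ C, r w x) (huw : r u w) :
    (A ++ u :: (B ++ w :: C)).Pairwise r := by
  simp only [List.pairwise_append, List.pairwise_cons, List.mem_append, List.mem_cons] at *
  grind

namespace Frame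

variable {V : Type} {r : V → V → Prop} {k n O : ℕ} {s : Finset V} {e : ℕ → V}

theorem arrow_of_testBit (_ : Frame r k n O s e) {w : V} {i : ℕ}
    (h : (row r n e w).testBit i = true) : r (e i) w :=
  ((testBit_row r n e w i).1 h).2

theorem arrow_of_not_testBit (F : Frame r k n O s e) {w : V} (hw : r w (e n)) {i : ℕ} (hi : i ≤ n)
    (h : (row r n e w).testBit i = false) : r w (e i) := by
  rcases Nat.lt_or_eq_of_le hi with hi | rfl
  · have hne : w ≠ e i := by
      rintro rfl
      exact F.asymm _ _ hw (F.dom i hi)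
    refine (F.total _ _ hne).resolve_right fun h' => ?_
    rw [(testBit_row r n e w i).2 ⟨hi, h'⟩] at h
    cases h
  · exact hw

theorem arrows_of_split (F : Frame r k n O s e) {w : V} (hw : r w (e n)) {p t : List ℕ}
    (ht : ∀ i ∈ t, i ≤ n) (h : (split n p t).testBit (row r n e w) = true) :
    (∀ x ∈ p.map e, r x w) ∧ ∀ x ∈ t.map e, r w x := by
  rw [testBit_split] at h
  simp only [List.mem_map, forall_exists_index, and_imp, forall_apply_eq_imp_iff₂]
  exact ⟨fun a ha => F.arrow_of_testBit (h.2.1 a ha),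
    fun a ha => F.arrow_of_not_testBit hw (ht a ha) (h.2.2 a ha)⟩

/-- A list of indices of `k + 1` vertices that form a chain. -/
def IsChain (_ : Frame r k n O s e) (Q : List ℕ) : Prop :=
  Q.length = k + 1 ∧ (∀ i ∈ Q, i ≤ n) ∧ (Q.map e).Pairwise r

/-- A rule that is correct for all pairs of in-neighbours of `e n`. -/
def Good (_ : Frame r k n O s e) (qm pm x : ℕ) : Prop :=
  ∀ w ∈ s, r w (e n) → ∀ w' ∈ s, r w' (e n) → Nat.land (row r n e w) qm = pm →
    (x.testBit (row r n e w') = true → ¬ r w w') ∧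
    (x.testBit (2 ^ n + row r n e w') = true → ¬ r w' w)

theorem not_arrow (F : Frame r k n O s e) {A B C : List ℕ} (hQ : F.IsChain (A ++ (B ++ C)))
    {u w : V} (hu : u ∈ s) (hun : r u (e n)) (hw : w ∈ s) (hwn : r w (e n))
    (h1 : (split n A (B ++ C)).testBit (row r n e u) = true)
    (h2 : (split n (A ++ B) C).testBit (row r n e w) = true) : ¬ r u w := by
  intro h
  obtain ⟨hl, hle, hp⟩ := hQ
  simp only [List.mem_append] at hle
  have a1 := F.arrows_of_split hun (fun i hi => hle i (Or.inr (List.mem_append.1 hi))) h1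
  have a2 := F.arrows_of_split hwn (fun i hi => hle i (Or.inr (Or.inr hi))) h2
  simp only [List.map_append] at a1 a2 hp
  refine F.noChain _ ?_ ?_ (pairwise_insert_two hp a1.1 a1.2 a2.1 a2.2 h)
  · simp only [List.length_append, List.length_cons, List.length_map] at hl ⊢
    omega
  · have hm := F.mem
    simp only [List.mem_append, List.mem_cons, List.mem_map]
    grind

theorem good_item (F : Frame r k n O s e) (p t : List ℕ) (b : ℕ)
    (hQ : F.IsChain (p ++ t)) (hb : ∀ T, b.testBit T = true →
      ∃ p₁ p₂, p = p₁ ++ p₂ ∧ (split n p₁ (p₂ ++ t)).testBit T = true) :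
    F.Good (mask (p ++ t)) (mask p) (Nat.lor (after n p t)
      (Nat.shiftLeft (Nat.lor b (split n p t)) (Nat.shiftLeft 1 n))) := by
  intro w hw hwn w' hw' hwn' hm
  have hsplit : (split n p t).testBit (row r n e w) = true := by
    have hm' : ∀ i, (row r n e w).testBit i = true ∧ i ∈ p ++ t ↔ i ∈ p := fun i => by
      rw [← testBit_mask p, ← testBit_mask (p ++ t), ← Bool.and_eq_true, ← Nat.testBit_and,
        ← land_eq, hm]
    refine (testBit_split n p t _).2 ⟨row_lt .., fun a ha => ((hm' a).2 ha).1, fun a ha => ?_⟩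
    by_contra hc
    have hap := (hm' a).1 ⟨by simpa using hc, by simp [ha]⟩
    have := hQ.2.2
    rw [List.map_append, List.pairwise_append] at this
    have := this.2.2 (e a) (List.mem_map_of_mem hap) (e a) (List.mem_map_of_mem ha)
    exact F.asymm _ _ this this
  rw [lor_eq, lor_eq, shiftLeft_eq, one_shiftLeft, Nat.testBit_or, Nat.testBit_or,
    Nat.testBit_shiftLeft, Nat.testBit_shiftLeft]
  constructor
  · intro h
    have : ¬ 2 ^ n ≤ row r n e w' := Nat.not_le.2 (row_lt ..)
    simp only [this, decide_false, Bool.false_and, Bool.or_false] at h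
    obtain ⟨s₁, s₂, rfl, h'⟩ := testBit_after _ _ _ _ h
    exact F.not_arrow hQ hw hwn hw' hwn' hsplit h'
  · intro h
    rw [Nat.testBit_lt_two_pow (lt_of_lt_of_le (after_lt n p t)
      (Nat.pow_le_pow_right (by omega) (Nat.le_add_right _ _)))] at h
    simp only [ge_iff_le, Nat.le_add_right, decide_true, Nat.add_sub_cancel_left, Bool.true_and,
      Bool.false_or, Nat.testBit_or, Bool.or_eq_true] at h
    have : ∃ p₁ p₂, p = p₁ ++ p₂ ∧ (split n p₁ (p₂ ++ t)).testBit (row r n e w') = true :=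
      h.elim (hb _) fun h => ⟨p, [], by simp, h⟩
    obtain ⟨p₁, p₂, rfl, h'⟩ := this
    exact F.not_arrow (by simpa using hQ) hw' hwn' hw hwn h' hsplit

theorem items_good (F : Frame r k n O s e) (p t : List ℕ) (b : ℕ) (q : Rules)
    (hQ : F.IsChain (p ++ t)) (hb : ∀ T, b.testBit T = true →
      ∃ p₁ p₂, p = p₁ ++ p₂ ∧ (split n p₁ (p₂ ++ t)).testBit T = true) (hq : q.All F.Good) :
    (items n (mask (p ++ t)) p t b q).All F.Good := by
  induction t generalizing p b with
  | nil => exact ⟨F.good_item p [] b hQ hb, hq⟩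
  | cons a t ih =>
    have e1 : p ++ a :: t = (p ++ [a]) ++ t := by simp
    have hb' : ∀ T, (Nat.lor b (split n p (a :: t))).testBit T = true →
        ∃ p₁ p₂, p ++ [a] = p₁ ++ p₂ ∧ (split n p₁ (p₂ ++ t)).testBit T = true := by
      intro T hT
      rw [lor_eq, Nat.testBit_or, Bool.or_eq_true] at hT
      rcases hT with hT | hT
      · obtain ⟨p₁, p₂, rfl, h⟩ := hb T hT
        exact ⟨p₁, p₂ ++ [a], by simp, by simpa using h⟩
      · exact ⟨p, [a], rfl, by simpa using hT⟩
    refine ⟨F.good_item p _ b hQ hb, ?_⟩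
    rw [e1] at hQ ⊢
    exact ih (p ++ [a]) _ hQ hb'

theorem mkRules_good (F : Frame r k n O s e) (l : List (List ℕ)) (hl : ∀ Q ∈ l, F.IsChain Q) :
    (mkRules n l).All F.Good := by
  induction l with
  | nil => trivial
  | cons Q l ih =>
    refine F.items_good [] Q 0 _ (hl Q (by simp)) (fun T hT => ?_) (ih fun Q hQ => hl Q (by simp [hQ]))
    simp at hT

theorem entry_good (F : Frame r k n O s e) (q : Rules) (hq : q.All F.Good) {w w' : V}
    (hw : w ∈ s) (hwn : r w (e n)) (hw' : w' ∈ s) (hwn' : r w' (e n)) :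
    ((entry q (row r n e w)).testBit (row r n e w') = true → ¬ r w w') ∧
      ((entry q (row r n e w)).testBit (2 ^ n + row r n e w') = true → ¬ r w' w) := by
  induction q with
  | nil => simp [entry]
  | cons qm pm x t ih =>
    have h : entry (.cons qm pm x t) (row r n e w) = cnd (Nat.beq (Nat.land (row r n e w) qm) pm)
      (Nat.lor x (entry t (row r n e w))) (entry t (row r n e w)) := rfl
    rw [h, cnd_eq]
    have ih := ih hq.2
    split_ifs with hb
    · have hx := hq.1 w hw hwn w' hw' hwn' (Nat.eq_of_beq_eq_true hb)
      rw [lor_eq, Nat.testBit_or, Nat.testBit_or, Bool.or_eq_true, Bool.or_eq_true]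
      exact ⟨fun h => h.elim hx.1 ih.1, fun h => h.elim hx.2 ih.2⟩
    · exact ih

theorem clash_good (F : Frame r k n O s e) (q : Rules) (hq : q.All F.Good) {w w' : V}
    (hw : w ∈ s) (hwn : r w (e n)) (hw' : w' ∈ s) (hwn' : r w' (e n)) (hne : w ≠ w') :
    (clash q (2 ^ n) (row r n e w)).testBit (64 + row r n e w') = false := by
  rw [clash, force_eq, shiftLeft_eq, one_shiftLeft, Nat.testBit_shiftLeft, mod_eq,
    Nat.testBit_mod_two_pow, land_eq, shiftRight_eq, Nat.testBit_and, Nat.testBit_shiftRight,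
    Nat.add_sub_cancel_left]
  have h := F.entry_good q hq hw hwn hw' hwn'
  rcases F.total w w' hne with h' | h'
  · have : (entry q (row r n e w)).testBit (row r n e w') = false :=
      Bool.eq_false_iff.2 fun hc => h.1 hc h'
    simp [this]
  · have : (entry q (row r n e w)).testBit (2 ^ n + row r n e w') = false :=
      Bool.eq_false_iff.2 fun hc => h.2 hc h'
    simp [this]

theorem isChain_of_mem (F : Frame r k n O s e) {Q : List ℕ}
    (hQ : Q ∈ chains O (k + 1) (List.range n) ++ (chains O k (List.range n)).map (n :: ·)) :
    F.IsChain Q := by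
  have key : ∀ Q : List ℕ, (∀ i ∈ Q, i < n) → Q.Pairwise (fun i j => Tourn.arc O i j = true) →
      (Q.map e).Pairwise r := fun Q h1 h2 => List.pairwise_map.2
    (h2.imp_of_mem fun {i j} hi hj h => (F.arc i (h1 i hi) j (h1 j hj)).1 h)
  simp only [List.mem_append, List.mem_map, mem_chains, List.mem_range] at hQ
  rcases hQ with ⟨h1, h2, h3⟩ | ⟨Q, ⟨h1, h2, h3⟩, rfl⟩
  · exact ⟨h1, fun i hi => (h2 i hi).le, key Q h2 h3⟩
  · refine ⟨by simp [h1], ?_, ?_⟩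
    · simpa using fun i hi => (h2 i hi).le
    · rw [List.map_cons, List.pairwise_cons]
      refine ⟨?_, key Q h2 h3⟩
      simpa using fun i hi => F.dom i (h2 i hi)

theorem mem_rows (F : Frame r k n O s e) {w : V} (hw : w ∈ s) (hwn : r w (e n))
    (l : List (List ℕ)) (hl : ∀ Q ∈ l, Q ∈ chains O (k + 1) (List.range n)) :
    (rows n l).testBit (row r n e w) = true := by
  induction l with
  | nil => simp [rows, testBit_full, row_lt]
  | cons Q l ih =>
    have h : (allOut n Q).testBit (row r n e w) = false := by
      rw [Bool.eq_false_iff]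
      intro h
      have hQ := F.isChain_of_mem (List.mem_append_left _ (hl Q (by simp)))
      have hlt := ((mem_chains _ _ _ _).1 (hl Q (by simp))).2.1
      have hout := (F.arrows_of_split (p := []) (t := Q) hwn hQ.2.1 (by
        rw [testBit_split]
        simpa using (testBit_allOut n Q _).1 h)).2
      refine F.noChain (w :: e n :: Q.map e) (by simp [hQ.1]) ?_ ?_
      · have hm := F.mem
        have := hQ.2.1
        simp only [List.mem_cons, List.mem_map]
        grind
      · rw [List.pairwise_cons, List.pairwise_cons]
        refine ⟨?_, ?_, hQ.2.2⟩
        · intro x hx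
          rcases List.mem_cons.1 hx with rfl | hx
          · exact hwn
          · exact hout x hx
        · simpa using fun i hi => F.dom i (List.mem_range.1 (hlt i hi))
    have ih := ih fun Q hQ => hl Q (by simp [hQ])
    rw [rows, force_eq, xor_eq, land_eq, Nat.testBit_xor, Nat.testBit_and, ih, h]
    rfl

end Frame

/-! ### The search -/

theorem testBit_mul_repunit (n J S a j : ℕ) (hS : S < 2 ^ n) (ha : a < n) (hj : j < J) :
    (Nat.mul S (repunit n J)).testBit (n * j + a) = S.testBit a := by
  induction J generalizing j with
  | zero => omega
  | succ J ih =>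
    have h : Nat.mul S (repunit n (J + 1)) = 2 ^ n * Nat.mul S (repunit n J) + S := by
      rw [repunit, one_shiftLeft]
      simp only [add_eq, mul_eq]
      ring
    rw [h, Nat.testBit_two_pow_mul_add _ hS]
    cases j with
    | zero => simp [ha]
    | succ j =>
      have h1 : ¬ n * (j + 1) + a < n := by
        rw [mul_add]
        omega
      have h2 : n * (j + 1) + a - n = n * j + a := by
        rw [mul_add]
        omega
      rw [if_neg h1, h2, ih j (by omega)]

theorem salt_lt (K i : ℕ) : salt K i < 2 ^ 64 := Nat.mod_lt _ (by norm_num)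

theorem testBit_salt (K i t : ℕ) : (salt K i).testBit (64 + t) = false :=
  Nat.testBit_lt_two_pow (lt_of_lt_of_le (salt_lt K i)
    (Nat.pow_le_pow_right (by omega) (Nat.le_add_right _ _)))

theorem testBit_xor_toggle (c i t : ℕ) (h : t ≠ i) :
    (Nat.xor c (toggle i)).testBit (64 + t) = c.testBit (64 + t) := by
  have : ¬ i + 64 = 64 + t := by omega
  rw [xor_eq, toggle, lor_eq, one_shiftLeft, Nat.testBit_xor, Nat.testBit_or, testBit_salt,
    Nat.testBit_two_pow]
  simp [this]

/-- One step of `search` for a positive number of rows. -/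
noncomputable def branch (n P rep : ℕ) (q : Rules)
    (ih : ℕ → ℕ → ℕ → List ℕ → List (List ℕ) → List (List ℕ))
    (need c D : ℕ) (path : List ℕ) (acc : List (List ℕ)) (i : ℕ) : List (List ℕ) :=
  ih need (Nat.xor (Nat.xor c (Nat.land c (clash q P i))) (salt 2862933555777941757 i))
    (meet n P rep D i) (i :: path) (ih (need + 1) (Nat.xor c (toggle i)) D path acc)

theorem searchStep_succ (n P rep : ℕ) (q : Rules)
    (ih : ℕ → ℕ → ℕ → List ℕ → List (List ℕ) → List (List ℕ)) (need c D : ℕ) (path : List ℕ)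
    (acc : List (List ℕ)) :
    Nat.shiftRight (Nat.land c (avoiders n (Nat.mod D P))) 64 = 0 ∧
        searchStep n P rep q ih (need + 1) c D path acc = acc ∨
      ∃ i, searchStep n P rep q ih (need + 1) c D path acc =
        branch n P rep q ih need c D path acc i := by
  have h : searchStep n P rep q ih (need + 1) c D path acc =
      Nat.rec (motive := fun _ => List (List ℕ)) acc
        (fun _ _ => branch n P rep q ih need c D path acc
          (lowRow (Nat.land c (avoiders n (Nat.mod D P)))))
        (Nat.shiftRight (Nat.land c (avoiders n (Nat.mod D P))) 64) := rfl
  rw [h]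
  cases Nat.shiftRight (Nat.land c (avoiders n (Nat.mod D P))) 64 with
  | zero => exact Or.inl ⟨rfl, rfl⟩
  | succ _ => exact Or.inr ⟨_, rfl⟩

theorem mem_search_of_mem (n P rep : ℕ) (q : Rules) (fuel need c D : ℕ) (path : List ℕ)
    (acc : List (List ℕ)) {p : List ℕ} (hp : p ∈ acc) :
    p ∈ search n P rep q fuel need c D path acc := by
  induction fuel generalizing need c D path acc with
  | zero => exact List.mem_cons_of_mem _ hp
  | succ fuel ih =>
    change p ∈ searchStep n P rep q (search n P rep q fuel) need c D path acc
    cases need with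
    | zero => exact List.mem_cons_of_mem _ hp
    | succ need =>
      rcases searchStep_succ n P rep q (search n P rep q fuel) need c D path acc with
        ⟨-, h⟩ | ⟨i, h⟩
      · rwa [h]
      · rw [h]
        exact ih _ _ _ _ _ (ih _ _ _ _ _ hp)

namespace Frame

variable {V : Type} {r : V → V → Prop} {k n O : ℕ} {s : Finset V} {e : ℕ → V}

open Classical in
/-- The in-neighbours of `e n` in a list satisfy the demands `D`. -/
def Meets (_ : Frame r k n O s e) (J D : ℕ) (R : List V) : Prop :=
  ∀ a < n, ∀ j, D.testBit (n * j + a) = true → j < J ∧ j + 1 ≤ R.countP fun w => r w (e a)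

theorem testBit_row_eq_false (F : Frame r k n O s e) {w : V} (hw : r w (e n)) {a : ℕ} (ha : a < n) :
    (row r n e w).testBit a = false ↔ r w (e a) := by
  refine ⟨F.arrow_of_not_testBit hw ha.le, fun h => Bool.eq_false_iff.2 fun h' => ?_⟩
  exact F.asymm _ _ h (F.arrow_of_testBit h')

open Classical in
theorem meets_meet (F : Frame r k n O s e) {J D : ℕ} {R : List V} (hR : F.Meets J D R) {w : V}
    (hw : w ∈ R) (hwn : r w (e n)) :
    F.Meets J (meet n (2 ^ n) (repunit n J) D (row r n e w)) (R.erase w) := by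
  intro a ha j h
  have hS : (row r n e w) ^^^ (2 ^ n - 1) < 2 ^ n :=
    Nat.xor_lt_two_pow (row_lt ..) (Nat.sub_lt (by positivity) (by omega))
  have hbit : j < J → (Nat.mul (Nat.xor (row r n e w) (2 ^ n - 1)) (repunit n J)).testBit
      (n * j + a) = !(row r n e w).testBit a := fun hj => by
    rw [xor_eq, testBit_mul_repunit _ _ _ _ _ hS ha hj, Nat.testBit_xor,
      Nat.testBit_two_pow_sub_one]
    simp [ha]
  have hcount := (List.perm_cons_erase hw).countP_eq fun w => decide (r w (e a))
  rw [List.countP_cons] at hcount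
  rw [meet, force_eq] at h
  simp only [lor_eq, xor_eq, land_eq, shiftRight_eq, sub_eq, Nat.testBit_or, Nat.testBit_xor,
    Nat.testBit_and, Nat.testBit_shiftRight, Bool.or_eq_true, Bool.and_eq_true] at h hbit
  rcases h with h | ⟨h, h'⟩
  · have hD : D.testBit (n * j + a) = true := by
      by_contra hc
      simp [hc] at h
    obtain ⟨hj, hle⟩ := hR a ha j hD
    rw [hD, hbit hj] at h
    have : ¬ r w (e a) := fun hr => by
      rw [(F.testBit_row_eq_false hwn ha).2 hr] at h
      simp at h
    simp only [this, decide_false] at hcount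
    refine ⟨hj, ?_⟩
    simp at hcount
    omega
  · have e1 : n + (n * j + a) = n * (j + 1) + a := by ring
    rw [e1] at h
    obtain ⟨hj, hle⟩ := hR a ha (j + 1) h
    refine ⟨by omega, ?_⟩
    have hr := (F.testBit_row_eq_false hwn ha).1 (by
      rw [hbit (by omega)] at h'
      simpa using h')
    simp only [hr, decide_true, if_true] at hcount
    omega

theorem exists_avoider (F : Frame r k n O s e) {J D : ℕ} {R : List V} (hR : F.Meets J D R)
    (hR0 : R ≠ []) (hW : ∀ w ∈ R, r w (e n)) :
    ∃ w ∈ R, (avoiders n (Nat.mod D (2 ^ n))).testBit (64 + row r n e w) = true := by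
  rw [avoiders, force_eq, cnd_eq]
  generalize lead (Nat.mod D (2 ^ n)) 4 = a
  generalize 18446744073709551615 = x
  rw [tb_eq, mod_eq, lor_eq, lor_eq, shiftLeft_eq, shiftLeft_eq, xor_eq]
  split_ifs with h
  · rw [Nat.testBit_mod_two_pow, Bool.and_eq_true, decide_eq_true_eq] at h
    obtain ⟨-, h1⟩ := hR a h.1 0 (by simpa using h.2)
    obtain ⟨w, hw, hr⟩ := List.countP_pos_iff.1 h1
    refine ⟨w, hw, ?_⟩
    have := (F.testBit_row_eq_false (hW w hw) h.1).2 (by simpa using hr)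
    have hc : (col n a).testBit (row r n e w) = false := by
      rw [Bool.eq_false_iff, ne_eq, testBit_col, this]
      simp
    simp [Nat.testBit_shiftLeft, testBit_full, hc, row_lt]
  · obtain ⟨w, hw⟩ := List.exists_mem_of_ne_nil _ hR0
    exact ⟨w, hw, by simp [Nat.testBit_shiftLeft, testBit_full, row_lt]⟩

open Classical in
theorem search_complete (F : Frame r k n O s e) (q : Rules) (hq : q.All F.Good) (J fuel need c D : ℕ)
    (path : List ℕ) (acc : List (List ℕ)) (R : List V) (hlen : R.length = need) (hnd : R.Nodup)
    (hW : ∀ w ∈ R, w ∈ s ∧ r w (e n)) (hc : ∀ w ∈ R, c.testBit (64 + row r n e w) = true)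
    (hD : F.Meets J D R) :
    [] ∈ search n (2 ^ n) (repunit n J) q fuel need c D path acc ∨
      ∃ L : List V, L.Perm R ∧
        L.map (row r n e) ++ path ∈ search n (2 ^ n) (repunit n J) q fuel need c D path acc := by
  induction fuel generalizing need c D path acc R with
  | zero => exact Or.inl (List.mem_cons_self ..)
  | succ fuel ih =>
    have h : search n (2 ^ n) (repunit n J) q (fuel + 1) need c D path acc =
      searchStep n (2 ^ n) (repunit n J) q (search n (2 ^ n) (repunit n J) q fuel) need c D path
        acc := rfl
    rw [h]
    cases need with
    | zero =>
      obtain rfl := List.length_eq_zero_iff.1 hlen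
      exact Or.inr ⟨[], List.Perm.refl _, List.mem_cons_self ..⟩
    | succ need =>
      rcases searchStep_succ n (2 ^ n) (repunit n J) q (search n (2 ^ n) (repunit n J) q fuel) need
        c D path acc with ⟨h0, -⟩ | ⟨i, h⟩
      · obtain ⟨w, hw, h1⟩ := F.exists_avoider hD (by rintro rfl; simp at hlen)
          fun w hw => (hW w hw).2
        have : (Nat.shiftRight (Nat.land c (avoiders n (Nat.mod D (2 ^ n)))) 64).testBit
            (row r n e w) = true := by
          rw [shiftRight_eq, land_eq, Nat.testBit_shiftRight, Nat.testBit_and, h1, hc w hw]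
          rfl
        rw [h0] at this
        simp at this
      · rw [h]
        by_cases hi : ∃ w ∈ R, row r n e w = i
        · obtain ⟨w, hw, rfl⟩ := hi
          have hsub : ∀ w' ∈ R.erase w, w' ∈ R := fun w' => List.mem_of_mem_erase
          rcases ih need (Nat.xor (Nat.xor c (Nat.land c (clash q (2 ^ n) (row r n e w))))
              (salt 2862933555777941757 (row r n e w)))
            (meet n (2 ^ n) (repunit n J) D (row r n e w)) (row r n e w :: path)
            (search n (2 ^ n) (repunit n J) q fuel (need + 1)
              (Nat.xor c (toggle (row r n e w))) D path acc) (R.erase w)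
            (by rw [List.length_erase_of_mem hw, hlen]; rfl) (hnd.erase w)
            (fun w' hw' => hW w' (hsub w' hw')) (fun w' hw' => by
              have hne : w ≠ w' := fun h => by
                rw [← h] at hw'
                exact hnd.not_mem_erase hw'
              rw [xor_eq, xor_eq, land_eq, Nat.testBit_xor, Nat.testBit_xor, Nat.testBit_and,
                testBit_salt, hc w' (hsub w' hw'), F.clash_good q hq (hW w hw).1 (hW w hw).2
                  (hW w' (hsub w' hw')).1 (hW w' (hsub w' hw')).2 hne]
              rfl) (F.meets_meet hD hw (hW w hw).2) with h | ⟨L, hL, h⟩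
          · exact Or.inl h
          · refine Or.inr ⟨L ++ [w], ?_, by simpa [branch] using h⟩
            exact (List.perm_append_singleton w L).trans
              ((hL.cons w).trans (List.perm_cons_erase hw).symm)
        · rcases ih (need + 1) (Nat.xor c (toggle i)) D path acc R hlen hnd hW (fun w hw => by
            rw [testBit_xor_toggle _ _ _ fun h => hi ⟨w, hw, h⟩]
            exact hc w hw) hD with h | ⟨L, hL, h⟩
          · exact Or.inl (mem_search_of_mem _ _ _ _ _ _ _ _ _ _ h)
          · exact Or.inr ⟨L, hL, mem_search_of_mem _ _ _ _ _ _ _ _ _ _ h⟩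

end Frame

/-! ### Certificates -/

/-- There is a copy in `s` of the tournament on `{0, …, N - 1}` coded by `T`. -/
def Emb {V : Type} (r : V → V → Prop) (s : Finset V) (T N : ℕ) : Prop :=
  ∃ e : ℕ → V, (∀ i, e i ∈ s) ∧ ∀ i j, i < j → j < N →
    (arc T i j = true ∧ r (e i) (e j)) ∨ (arc T j i = true ∧ r (e j) (e i))

theorem nth_eq_getElem (l : List ℕ) (t : ℕ) (h : t < l.length) : nth l t = l[t] := by
  induction l generalizing t with
  | nil => simp at h
  | cons a l ih =>
    cases t with
    | zero => rfl
    | succ t => simpa [nth] using ih t (by simpa using h)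

theorem Cert.emb_of_ok {V : Type} {r : V → V → Prop} {s : Finset V} {k n N : ℕ} {Ts : List ℕ}
    {E : ℕ → V} (hs : NoChain r k s) (hE : ∀ i, E i ∈ s)
    (htot : ∀ a b, n < a → n < b → a < N → b < N → a ≠ b → r (E a) (E b) ∨ r (E b) (E a))
    (c : Cert) (K : ℕ → ℕ → Bool) (hK : ∀ i < N, ∀ j < N, K i j = true → r (E i) (E j))
    (h : c.ok k n N Ts K = true) : ∃ T ∈ Ts, Emb r s T N := by
  induction c generalizing K with
  | tt x =>
    simp only [Cert.ok, allBelow_iff, cnd_false_left_iff, ← Bool.not_eq_true, Nat.ble_eq,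
      not_le] at h
    refine absurd ?_ (hs ((List.range k).map fun i => E (digit x i)) (by simp) (by simp [hE]))
    rw [List.pairwise_map]
    refine List.pairwise_lt_range.imp_of_mem fun {i j} hi hj hij => ?_
    rw [List.mem_range] at hi hj
    exact hK _ (h i hi).1 _ (h j hj).1 ((h j hj).2 i hij)
  | iso t x =>
    simp only [Cert.ok, allBelow_iff, cnd_false_left_iff, ← Bool.not_eq_true, Nat.ble_eq,
      not_le, force_eq] at h
    obtain ⟨ht, h⟩ := h
    refine ⟨nth Ts t, ?_, fun i => E (digit x i), fun i => hE _, fun i j hij hj => ?_⟩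
    · rw [nth_eq_getElem _ _ ht]
      exact List.getElem_mem _
    · obtain ⟨h1, h2⟩ := h j hj
      have h3 := h2 i hij
      have h4 := (h i (hij.trans hj)).1
      rw [cnd_eq] at h3
      split_ifs at h3 with h5
      · exact Or.inl ⟨h5, hK _ h4 _ h1 h3⟩
      · rw [cnd_false_iff] at h3
        exact Or.inr ⟨h3.1, hK _ h1 _ h4 h3.2⟩
  | br a b c d ihc ihd =>
    simp only [Cert.ok, cnd_false_left_iff, cnd_false_iff, ← Bool.not_eq_true, Nat.ble_eq,
      not_le, Nat.beq_eq] at h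
    obtain ⟨ha, hb, haN, hbN, hab, hc, hd⟩ := h
    have key : ∀ a b, r (E a) (E b) → ∀ i < N, ∀ j < N, addArc a b K i j = true →
        r (E i) (E j) := by
      intro a b hr i hi j hj h
      rw [addArc, cnd_eq] at h
      split_ifs at h with h1
      · rw [Nat.beq_eq] at h1
        rw [cnd_true_left_iff, Nat.beq_eq] at h
        rcases h with rfl | h
        · rwa [h1]
        · exact hK i hi j hj h
      · exact hK i hi j hj h
    rcases htot a b ha hb haN hbN hab with hr | hr
    · exact ihc _ (key a b hr) hc
    · exact ihd _ (key b a hr) hd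

theorem length_eq_of_certify {m : ℕ} {f : List ℕ → Cert → Bool} {l : List (List ℕ)}
    {certs : List Cert} (h : certify m f l certs = true) {p : List ℕ} (hp : p ∈ l) :
    p.length = m ∧ ∃ c, f p c = true := by
  induction l generalizing certs with
  | nil => simp at hp
  | cons p' l ih =>
    cases certs with
    | nil => simp [certify] at h
    | cons c cs =>
      simp only [certify, cnd_false_iff, Nat.beq_eq] at h
      rcases List.mem_cons.1 hp with rfl | hp
      · exact ⟨h.1, c, h.2.1⟩
      · exact ih h.2.2 hp

theorem inDeg_eq (O n a : ℕ) :
    inDeg O n a = ((Finset.range n).filter fun b => arc O b a = true).card := by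
  induction n with
  | zero => rfl
  | succ n ih =>
    have h : inDeg O (n + 1) a = cnd (arc O n a) (inDeg O n a + 1) (inDeg O n a) := rfl
    rw [h, cnd_eq, Finset.range_add_one, Finset.filter_insert, ih]
    split_ifs
    · rw [Finset.card_insert_of_notMem (by simp)]
    · rfl

namespace Frame

variable {V : Type} {r : V → V → Prop} {k n O : ℕ} {s : Finset V} {e : ℕ → V}

/-- The enumeration `e 0, …, e n`, continued by a list. -/
def extend (_ : Frame r k n O s e) (L : List V) (i : ℕ) : V :=
  if i ≤ n then e i else L.getD (i - n - 1) (e n)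

theorem extend_of_le (F : Frame r k n O s e) (L : List V) {i : ℕ} (hi : i ≤ n) :
    F.extend L i = e i := if_pos hi

theorem extend_of_gt (F : Frame r k n O s e) (L : List V) {i : ℕ} (hi : n < i)
    (h : i - n - 1 < L.length) : F.extend L i = L[i - n - 1] := by
  rw [extend, if_neg (by omega), List.getD_eq_getElem _ _ h]

theorem extend_mem (F : Frame r k n O s e) {L : List V} (hL : ∀ w ∈ L, w ∈ s) (i : ℕ) :
    F.extend L i ∈ s := by
  by_cases h : i ≤ n
  · rw [F.extend_of_le L h]
    exact F.mem i h
  · by_cases h' : i - n - 1 < L.length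
    · rw [F.extend_of_gt L (by omega) h']
      exact hL _ (List.getElem_mem _)
    · rw [extend, if_neg h, List.getD_eq_default _ _ (by omega)]
      exact F.mem n le_rfl

theorem extend_ne (F : Frame r k n O s e) {L : List V} (hnd : L.Nodup) {i j : ℕ} (hi : n < i)
    (hj : n < j) (hi' : i < n + 1 + L.length) (hj' : j < n + 1 + L.length) (hij : i ≠ j) :
    F.extend L i ≠ F.extend L j := by
  rw [F.extend_of_gt L hi (by omega), F.extend_of_gt L hj (by omega), ne_eq, hnd.getElem_inj_iff]
  omega

theorem arrow_of_known (F : Frame r k n O s e) (q : Rules) (hq : q.All F.Good) {L : List V}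
    (hL : ∀ w ∈ L, w ∈ s ∧ r w (e n)) (hnd : L.Nodup) {i j : ℕ} (hi : i < n + 1 + L.length)
    (hj : j < n + 1 + L.length) (h : known n (2 ^ n) O q (L.map (row r n e)) i j = true) :
    r (F.extend L i) (F.extend L j) := by
  have key : ∀ i, n < i → i < n + 1 + L.length → ∃ w, F.extend L i = w ∧ w ∈ L ∧
      nth (L.map (row r n e)) (Nat.sub (Nat.sub i n) 1) = row r n e w := by
    intro i hi hi'
    have h : i - n - 1 < L.length := by omega
    refine ⟨_, F.extend_of_gt L hi h, List.getElem_mem _, ?_⟩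
    rw [sub_eq, sub_eq, nth_eq_getElem _ _ (by simpa using h), List.getElem_map]
  simp only [known, force_eq, cnd_eq, Nat.ble_eq, Nat.beq_eq, tb_eq] at h
  split_ifs at h with h1 h2 h3 h4 h5 h6 h7 h8 h9 h10
  · subst h4
    obtain ⟨w, hw, hwL, -⟩ := key i (by omega) hi
    rw [hw, F.extend_of_le L le_rfl]
    exact (hL w hwL).2
  · obtain ⟨w, hw, hwL, hw'⟩ := key i (by omega) hi
    obtain ⟨u, hu, huL, hu'⟩ := key j (by omega) hj
    have hne := F.extend_ne hnd (by omega) (by omega) hi hj h5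
    rw [hw', hu'] at h6
    rw [hw, hu] at hne ⊢
    exact (F.total _ _ hne).resolve_right
      ((F.entry_good q hq (hL w hwL).1 (hL w hwL).2 (hL u huL).1 (hL u huL).2).2 h6)
  · obtain ⟨w, hw, hwL, hw'⟩ := key i (by omega) hi
    obtain ⟨u, hu, huL, hu'⟩ := key j (by omega) hj
    have hne := F.extend_ne hnd (by omega) (by omega) hi hj h5
    rw [hw', hu'] at h
    rw [hw, hu] at hne ⊢
    exact (F.total _ _ hne).resolve_right
      ((F.entry_good q hq (hL u huL).1 (hL u huL).2 (hL w hwL).1 (hL w hwL).2).1 h)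
  · rw [h7, F.extend_of_le L le_rfl, F.extend_of_le L (by omega)]
    exact F.dom j (by omega)
  · obtain ⟨w, hw, hwL, hw'⟩ := key i (by omega) hi
    rw [hw'] at h8
    rw [hw, F.extend_of_le L (by omega)]
    exact F.arrow_of_not_testBit (hL w hwL).2 (by omega) (by simpa using h8)
  · obtain ⟨w, hw, hwL, hw'⟩ := key j (by omega) hj
    rw [hw'] at h
    rw [hw, F.extend_of_le L (by omega)]
    exact F.arrow_of_testBit h
  · rw [F.extend_of_le L (by omega), F.extend_of_le L (by omega)]
    exact (F.arc i (by omega) j (by omega)).1 h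

open Classical in
/-- The in-neighbours of `e n`. -/
noncomputable def ins (_ : Frame r k n O s e) : Finset V := s.filter fun w => r w (e n)

open Classical in
theorem emb_of_certify (F : Frame r k n O s e) {m J D : ℕ} (hm : 0 < m) (hcard : F.ins.card = m)
    (hD : F.Meets J D F.ins.toList) (fuel : ℕ) (Ts : List ℕ) (certs : List Cert) (q : Rules)
    (hq : q.All F.Good)
    (h : certify m (fun p cert => cert.ok (k + 3) n (n + 1 + m) Ts (known n (2 ^ n) O q p))
      (search n (2 ^ n) (repunit n J) q fuel m
        (Nat.shiftLeft (rows n (chains O (k + 1) (List.range n))) 64) D [] []) certs = true) :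
    ∃ T ∈ Ts, Emb r s T (n + 1 + m) := by
  have hW : ∀ w ∈ F.ins.toList, w ∈ s ∧ r w (e n) := fun w hw => by
    simpa [ins] using hw
  rcases F.search_complete q hq J fuel m
    (Nat.shiftLeft (rows n (chains O (k + 1) (List.range n))) 64) D [] [] F.ins.toList
    (by simpa using hcard) (Finset.nodup_toList _) hW (fun w hw => by
      rw [shiftLeft_eq, Nat.testBit_shiftLeft, Nat.add_sub_cancel_left,
        F.mem_rows (hW w hw).1 (hW w hw).2 _ fun Q hQ => hQ]
      simp) hD with h' | ⟨L, hL, h'⟩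
  · have := (length_eq_of_certify h h').1
    simp at this
    omega
  · obtain ⟨-, c, hc⟩ := length_eq_of_certify h h'
    have hLW : ∀ w ∈ L, w ∈ s ∧ r w (e n) := fun w hw => hW w (hL.mem_iff.1 hw)
    have hnd : L.Nodup := hL.nodup_iff.2 (Finset.nodup_toList _)
    have hlen : L.length = m := by rw [hL.length_eq, Finset.length_toList, hcard]
    subst hlen
    rw [List.append_nil] at hc
    exact Cert.emb_of_ok F.noChain (F.extend_mem fun w hw => (hLW w hw).1)
      (fun a b ha hb haN hbN hab => F.total _ _ (F.extend_ne hnd ha hb haN hbN hab)) c _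
      (fun i hi j hj hK => F.arrow_of_known q hq hLW hnd hi hj hK) hc

end Frame

open Classical in
/-- If all out-neighbourhoods of size `n` of vertices that have `m` in-neighbours in sets without
transitive subtournaments on `k + 3` vertices are known, then a successful computation determines
these sets. -/
theorem emb_of_check {V : Type} {r : V → V → Prop} (hasymm : ∀ x y, r x y → ¬ r y x)
    (htotal : ∀ x y, x ≠ y → r x y ∨ r y x) {k n m J δ O D : ℕ} {Ts : List ℕ} {certs : List Cert}
    (h : check k n m J δ O D Ts certs = true) (hm : 0 < m) {s : Finset V}
    (hs : NoChain r (k + 3) s) {v : V} (hv : v ∈ s) (hO : Emb r (s.filter (r v)) O n)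
    (hn : (s.filter (r v)).card = n) (hcard : (s.filter fun w => r w v).card = m)
    (hδ : ∀ a ∈ s, δ ≤ (s.filter fun w => r w a).card) : ∃ T ∈ Ts, Emb r s T (n + 1 + m) := by
  rw [check, cnd_false_iff, Rules.force_apply, force_eq, force_eq, force_eq, one_shiftLeft,
    inputOk, cnd_false_iff, cnd_false_iff, allBelow_iff, allBelow_iff, Nat.beq_eq] at h
  obtain ⟨⟨hO2, hD0, hD⟩, h⟩ := h
  have hO2' : ∀ i < n, ∀ j < n, arc O i j = true → arc O j i = false := fun i hi j hj hij => by
    have := (allBelow_iff _ _).1 (hO2 i hi) j hj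
    rw [hij] at this
    exact ((cnd_false_left_iff _ _).1 this).1
  obtain ⟨e₀, he₀, he₁⟩ := hO
  have he₀' : ∀ i, e₀ i ∈ s ∧ r v (e₀ i) := fun i => Finset.mem_filter.1 (he₀ i)
  have F : Frame r k n O s fun i => if i < n then e₀ i else v :=
    { asymm := hasymm
      total := htotal
      noChain := hs
      mem := fun i _ => by
        split_ifs
        · exact (he₀' i).1
        · exact hv
      arc := fun i hi j hj => by
        rw [if_pos hi, if_pos hj]
        rcases lt_trichotomy i j with hij | rfl | hij
        · rcases he₁ i j hij hj with h1 | h1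
          · simp [h1]
          · simp [hO2' j hj i hi h1.1, hasymm _ _ h1.2]
        · have h1 : arc O i i = false := Bool.eq_false_iff.2 fun h1 => by
            have := hO2' i hi i hi h1
            simp [h1] at this
          simp only [h1, Bool.false_eq_true, false_iff]
          exact fun h1 => hasymm _ _ h1 h1
        · rcases he₁ j i hij hi with h1 | h1
          · simp [hO2' j hj i hi h1.1, hasymm _ _ h1.2]
          · simp [h1]
      dom := fun i hi => by
        rw [if_pos hi, if_neg (lt_irrefl n)]
        exact (he₀' i).2 }
  refine F.emb_of_certify (J := J) (D := D) hm ?_ ?_ _ Ts certs _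
    (F.mkRules_good _ fun Q hQ => F.isChain_of_mem hQ) h
  · simpa [Frame.ins] using hcard
  · intro a ha j hj
    have hjJ : j < J := by
      by_contra hc
      have h1 : n * J ≤ n * j + a := (Nat.mul_le_mul_left n (not_lt.1 hc)).trans (by omega)
      have h2 : (D >>> (n * J)).testBit (n * j + a - n * J) = true := by
        rw [Nat.testBit_shiftRight, Nat.add_sub_cancel' h1, hj]
      rw [show D >>> (n * J) = 0 from hD0] at h2
      simp at h2
    refine ⟨hjJ, ?_⟩
    have hdem := (allBelow_iff _ _).1 (hD a ha) j hjJ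
    simp only [tb_eq, add_eq, mul_eq, hj, cnd_eq, if_true, Nat.ble_eq] at hdem
    have hsurj : (Finset.range n).image e₀ = s.filter (r v) := by
      refine Finset.eq_of_subset_of_card_le ?_ ?_
      · intro x hx
        obtain ⟨i, -, rfl⟩ := Finset.mem_image.1 hx
        exact he₀ i
      · rw [hn, Finset.card_image_of_injOn, Finset.card_range]
        intro i hi j hj hij
        simp only [Finset.coe_range, Set.mem_Iio] at hi hj
        by_contra hne
        have := fun x => hasymm (e₀ x) (e₀ x)
        rcases Nat.lt_or_gt_of_ne hne with h1 | h1
        · have := he₁ i j h1 hj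
          simp only [← hij] at this
          grind
        · have := he₁ j i h1 hi
          simp only [← hij] at this
          grind
    have hsub : (s.filter fun w => r w (e₀ a)) ⊆ insert v ((F.ins.filter fun w => r w (e₀ a)) ∪
        ((Finset.range n).filter fun b => arc O b a = true).image e₀) := by
      intro w hw
      rw [Finset.mem_filter] at hw
      rw [Finset.mem_insert, Finset.mem_union, or_iff_not_imp_left]
      intro hne
      rcases htotal w v hne with hr | hr
      · exact Or.inl (by simp [Frame.ins, hw, hr])
      · have hw' : w ∈ (Finset.range n).image e₀ := by simp [hsurj, hw, hr]
        obtain ⟨i, hi, rfl⟩ := Finset.mem_image.1 hw'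
        have hi' := Finset.mem_range.1 hi
        refine Or.inr (Finset.mem_image_of_mem _ (Finset.mem_filter.2 ⟨hi, ?_⟩))
        have := F.arc i hi' a ha
        rw [if_pos hi', if_pos ha] at this
        exact this.2 hw.2
    have h1 := (hδ _ (he₀' a).1).trans (Finset.card_le_card hsub)
    have h2 := Finset.card_insert_le v ((F.ins.filter fun w => r w (e₀ a)) ∪
        ((Finset.range n).filter fun b => arc O b a = true).image e₀)
    have h3 := Finset.card_union_le (F.ins.filter fun w => r w (e₀ a))
        (((Finset.range n).filter fun b => arc O b a = true).image e₀)
    have h4 := Finset.card_image_le (s := (Finset.range n).filter fun b => arc O b a = true) (f := e₀)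
    rw [← inDeg_eq] at h4
    have h5 : F.ins.toList.countP (fun w => decide (r w (if a < n then e₀ a else v))) =
        (F.ins.filter fun w => r w (e₀ a)).card := by
      rw [if_pos ha, ← (Finset.nodup_toList _).card_eq_countP, Finset.toList_toFinset]
    rw [h5]
    omega

/-- The cyclic triangle. -/
noncomputable def codeC3 : ℕ :=
  36893488151714070532

/-- The tournament on 6 vertices without transitive subtournament of size 4. -/
noncomputable def codeQ6 : ℕ :=
  17538019662262694429678230595989021504628768899124

/-- The tournament on 7 vertices without transitive subtournament of size 4. -/
noncomputable def codeQ7 : ℕ :=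
  175758848698978182563840496841200411412391442371422648795236

/-- The tournament on 12 vertices without transitive subtournament of size 5. -/
noncomputable def codeT12 : ℕ :=
  2284324626866078817090375155345485113701872878939339236120702461321697905042404707324738001512742868387628588

/-- The tournament on 13 vertices without transitive subtournament of size 5. -/
noncomputable def codeT13 : ℕ :=
  8156215329074069198575795757840721922135979316222498613253503797227417090235073405416004903904605400716466925632228946

/-- The five tournaments on 24 vertices without transitive subtournament of size 6. -/
noncomputable def codes24 : List ℕ :=
  [1095494025936940491834557907950305560267003362071780142506377119291375775486948616916598636633004452792073823864219369399063402231853663791138037955667311958608586694447221838883373261283546556618857860575847884385766863635818028,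
   1092532832676174063964476999196944624887030993933947638055556862182619102122490413312634232273206923453413100563514626505171981526284339863443285603518508551124113471133856258949789809442739595564849593900890186412683941572060716,
   1095494025936251035301670159537927093727543638988972329802092041928603254274573937375157084966822023268400934413665949737399561577817480965823159289645712687886628609388904817476441946095983360675305748472421435049780567134512684,
   1101416412457783891041510923828001724893557965270475648413603655736282944126343889025138097349482303455624096212424885297362438849799031654715056293789614573913641196961618037597695156685017402776347660156756500843720004212975148,
   1051076127036475378311795623764178667248039408421511231563659078162794811370715669653353061779049896075145975107301170813925374678866091688246969228454879662157413638823059431204603966289549127179997320480678998459298501390132780]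

/-- Certificates for `check_c3`. -/
noncomputable def certs_c3 : List Cert :=
  [.iso 0 2080]

theorem check_c3 :
    check 0 1 1 0 0 0 0 [codeC3] certs_c3 = true := by
  decide +kernel

/-- Certificates for `check_q6`. -/
noncomputable def certs_q6 : List Cert :=
  [.iso 0 172066848, .iso 0 70291461, .iso 0 172065794]

theorem check_q6 :
    check 1 3 2 0 0 codeC3 0 [codeQ6] certs_q6 = true := by
  decide +kernel

/-- Certificates for `check_q7`. -/
noncomputable def certs_q7 : List Cert :=
  [.iso 0 6614517792]

theorem check_q7 :
    check 1 3 3 0 0 codeC3 0 [codeQ7] certs_q7 = true := by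
  decide +kernel

/-- Certificates for `check_t12_6`. -/
noncomputable def certs_t12_6 : List Cert :=
  [.tt 11574378, .tt 9514087, .tt 7513227, .tt 7637347, .tt 7513227, .tt 9514087,
   .tt 11575402, .tt 7513227, .tt 7513227, .tt 11575402, .tt 11575402, .tt 11575402,
   .tt 10559495, .br 7 9 (.tt 3351879) (.br 9 8 (.tt 6565162) (.tt 9478466)),
   .br 7 9 (.tt 3351879) (.br 9 8 (.tt 4399465) (.br 8 7 (.tt 7643205) (.br 10 8 (.tt 8750186) (.br
    11 7 (.tt 8620203) (.iso 0 256776994036127019))))),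
   .br 7 9 (.tt 9480263) (.br 9 8 (.tt 6529385) (.br 10 8 (.tt 8750186) (.iso 0
    118578316750917794))),
   .br 7 9 (.tt 9480263) (.br 8 9 (.tt 3351880) (.br 11 8 (.tt 8461483) (.iso 0 9260442643926053))),
   .tt 11576426, .tt 11576426, .tt 10559495,
   .br 9 8 (.tt 205033) (.br 10 9 (.tt 9798762) (.br 11 8 (.tt 8461483) (.iso 0
    154642163927515201))),
   .br 8 7 (.tt 4398440) (.br 10 7 (.tt 9444458) (.tt 10624075)), .tt 9670664,
   .br 9 7 (.tt 6626665) (.tt 10781767), .tt 8428681, .tt 10749156, .tt 9514087,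
   .br 8 7 (.tt 10719490) (.tt 10494055), .tt 10562663, .tt 7514251, .tt 7514251, .tt 7514251,
   .tt 7514251, .tt 7514251, .tt 8428681,
   .br 9 8 (.tt 205033) (.br 10 9 (.tt 4400490) (.br 8 10 (.tt 10788933) (.br 7 10 (.tt 8717383)
    (.br 11 8 (.tt 8461483) (.iso 0 360329034576693543))))),
   .tt 10559495, .tt 8563722, .tt 8621227, .tt 8563722, .tt 8563722, .tt 8563722,
   .tt 11608071, .tt 7670921, .tt 9612298, .tt 10786144,
   .br 9 8 (.tt 205033) (.br 10 8 (.tt 8464613) (.tt 3352936)), .tt 8428681,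
   .br 8 10 (.tt 3352936) (.br 10 9 (.tt 9545899) (.tt 7481353)),
   .br 9 8 (.tt 205033) (.br 7 10 (.tt 10529863) (.br 8 10 (.tt 3352936) (.br 10 9 (.tt 9544005)
    (.br 11 9 (.tt 10785835) (.iso 0 227756277942460769))))),
   .br 8 10 (.tt 3352936) (.br 10 9 (.tt 7638341) (.tt 7481353)), .tt 8428681, .tt 11865316,
   .tt 11829352, .br 9 8 (.tt 205033) (.br 10 8 (.tt 11640970) (.tt 10493991)), .tt 8428681,
   .br 9 8 (.tt 205033) (.br 10 7 (.tt 7703690) (.br 10 8 (.tt 11640970) (.tt 10748999))),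
   .tt 8428681]

theorem check_t12_6 :
    check 2 6 5 0 0 codeQ6 0 [codeT12] certs_t12_6 = true := by
  decide +kernel

/-- Certificates for `check_t12_7`. -/
noncomputable def certs_t12_7 : List Cert :=
  [.tt 11830594, .tt 9480264, .tt 10560520, .tt 9447464, .tt 8594442, .tt 10657867,
   .tt 8752420, .tt 11641992, .tt 8595627, .tt 10657867, .tt 11673641, .tt 8595627,
   .tt 10658891, .tt 10658891, .tt 10658891, .tt 9511115, .tt 10562664, .tt 8595627,
   .tt 8595627, .tt 8595627, .tt 8595627, .tt 9543882, .tt 11576426, .tt 11576426,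
   .tt 11576426, .tt 11576426, .tt 9645098, .tt 9645098, .tt 8685771, .tt 9511115,
   .tt 11643016, .tt 9798762, .tt 11643017, .tt 11673641, .tt 8563849, .tt 10781957,
   .tt 11673641, .tt 11673642, .tt 8719654, .tt 9511115, .tt 9478314, .tt 9511115,
   .tt 10559691, .tt 10559691, .tt 10559691, .tt 11643017, .tt 9644043, .tt 9644043,
   .tt 9644043, .tt 9644043, .tt 8529099, .tt 10494091, .tt 11641001, .tt 10494091,
   .tt 10494091, .tt 10628168, .tt 9765003, .tt 10494091, .tt 9448552, .tt 10849541,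
   .tt 11641001, .tt 11641001, .tt 8530123, .tt 11641001, .tt 8530123, .tt 8530123,
   .tt 8530123, .tt 8530123, .tt 11642026, .tt 9767174, .tt 11642026, .tt 9703750,
   .tt 10593483, .tt 10593483, .tt 10593483, .tt 10593483, .tt 9478314, .tt 10593483,
   .tt 10529864, .tt 9478314, .tt 9478314, .tt 8562697, .tt 11797674, .tt 9478315]

theorem check_t12_7 :
    check 2 7 4 0 0 codeQ7 0 [codeT12] certs_t12_7 = true := by
  decide +kernel

/-- Certificates for `check_t13_6`. -/
noncomputable def certs_t13_6 : List Cert :=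
  [.tt 12623979, .tt 7514252, .tt 7514252, .tt 7514252, .tt 12625003,
   .br 9 8 (.tt 205033) (.br 7 10 (.tt 10529863) (.br 8 10 (.tt 3352936) (.br 10 9 (.tt 6530442)
    (.br 11 9 (.tt 9831531) (.br 12 8 (.tt 8461484) (.iso 0 8226004226791375936)))))),
   .tt 7515276, .tt 9613323]

theorem check_t13_6 :
    check 2 6 6 0 0 codeQ6 0 [codeT13] certs_t13_6 = true := by
  decide +kernel

/-- Certificates for `check_t13_7`. -/
noncomputable def certs_t13_7 : List Cert :=
  [.tt 10529864, .tt 11706444, .tt 9644043, .tt 8596652, .tt 11707468, .tt 9511116,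
   .tt 12691592, .tt 8596652, .tt 11707468, .tt 9511116, .tt 8596652, .tt 10559692,
   .tt 10559692, .tt 10593483, .tt 10593483, .tt 9511116, .tt 12626027, .tt 10559692,
   .tt 9478314, .tt 10559692, .tt 8530124, .tt 10693644, .tt 8530124, .tt 8530124,
   .tt 11542668, .tt 12689577, .tt 8531148, .tt 11643084]

theorem check_t13_7 :
    check 2 7 5 0 0 codeQ7 0 [codeT13] certs_t13_7 = true := by
  decide +kernel

/-- Certificates for `check_t14_7`. -/
noncomputable def certs_t14_7 : List Cert :=
  [.tt 12756045, .tt 9511117, .tt 8597677, .tt 10559693, .tt 10559693, .tt 10559693, .tt 8531149]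

theorem check_t14_7 :
    check 2 7 6 0 0 codeQ7 0 [] certs_t14_7 = true := by
  decide +kernel

/-- Certificates for `check_t24_12`. -/
noncomputable def certs_t24_12 : List Cert :=
  [.tt 610451831, .iso 0 984818244535754528103549039458486304,
   .iso 1 984818244535754528103549039458486304, .iso 2 984818244535754528103549039458486304,
   .iso 2 975066949863188375342802251553508048, .iso 3 984818244535754528103549039458486304,
   .iso 1 483097229371321912457490344927776138, .iso 1 381247596108023272081392577758146766,
   .iso 1 592229386141386095074905107474864273, .iso 1 421131363587404503924073084070008099,
   .iso 0 398822537728808853987409613887838338, .iso 2 141655183079925948600262483331327232,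
   .iso 1 711686240991862208430393281575506163, .iso 2 317284751326895709036854154028420590,
   .iso 1 798505211899866071792226933024276751, .iso 2 523467881527444410487167526587422286,
   .iso 4 984818244535754528103549039458486304, .iso 1 259193986992462655050723230165249194,
   .iso 2 483097268985403132696206178652704138, .iso 2 353951631632837896771432983666174417,
   .iso 0 27472940281941282421007222574452966, .iso 2 982096434126040214175093642872815681,
   .iso 1 2206640629067982397331200734040755, .iso 2 269027325106587101603299967356742882,
   .iso 4 979303888799241913847253655777117186, .iso 0 979303888830675313322807321407194114,
   .iso 1 469360436834683749196762632058581331, .iso 2 2206641867007874109883686352065203,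
   .iso 1 431790141374678689344299658918812848, .iso 2 44961964055810009107169687807434350,
   .iso 2 195498909048397123834142676606786032, .iso 2 236624044817616834772142996323845507,
   .iso 1 135793319785067804474476551032481126, .iso 2 979344453687321538139845763163948034,
   .iso 2 397662643597054739226652057670303110, .iso 0 355197073601008263040326912310395494,
   .iso 1 980601963161365751338991756584879106, .iso 2 311146175585210097651831568802789034,
   .iso 2 520829666819549497706393389515191988, .iso 0 479181324231311396716449662600030465,
   .iso 0 236624084431698090751390288488973699, .iso 3 979303888870494307506364169849078786,
   .iso 0 311146175585209950185965370183269034, .iso 1 19858265452936679903828076529200257,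
   .iso 2 976526176873170244969486023771457134, .iso 1 236624005203535466959509791654302083,
   .iso 1 45002530112957314839909709689429614, .iso 1 222850689835553717549019879315681394,
   .iso 2 83701369952874236761904278992855474, .iso 2 356535712634849236427470380774606438,
   .iso 2 437735306345913743657729980860929153, .iso 0 983435073200909033745781196816973889,
   .iso 1 983435073200909033745781196816973889, .iso 1 83823064410495999210497571847414193,
   .iso 4 983436380356784723478328987488682049, .iso 1 141102413046382716718447345892089135,
   .br 21 13 (.br 21 14 (.tt 474133877) (.br 21 15 (.tt 181648757) (.br 21 16 (.tt 444083509) (.br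
    21 17 (.tt 454274357) (.tt 147248657))))) (.br 21 14 (.tt 491861312) (.tt 707999821)),
   .iso 1 265473035826890258355482543531908463, .iso 0 226219187275219044483164151992716512,
   .iso 0 192770387701727767619391453069032899, .iso 2 518110719423078851021834798324796882,
   .iso 1 62536623323117359527477343785821410, .iso 3 958476059194207219542676454575866375,
   .iso 1 396364451778117228727296316430433670, .iso 2 192851517340142226834095143549909411,
   .iso 0 66653328158778652730708752443022595, .iso 1 105609999307244977728967420615759104,
   .iso 2 974007070403178008859680828697248464, .tt 542678391, .tt 641281687, .tt 624012951,
   .tt 607661719, .tt 607661719, .tt 607661719, .tt 607661719, .tt 607661719, .tt 607661719,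
   .tt 607661719, .tt 607661719, .tt 607661719, .tt 607661719, .tt 607661719, .tt 607661719,
   .tt 656518807, .tt 656518807, .tt 656518807, .tt 656518807, .tt 656518807, .tt 607628951,
   .tt 607628951, .tt 607628951, .tt 656518807, .tt 607628951, .tt 607596183, .tt 624264855,
   .tt 624264855, .tt 624264855, .tt 624264855, .tt 624264855, .tt 624264855, .tt 507063959,
   .tt 624264855, .tt 680074583, .tt 641281687, .tt 607506711, .tt 641281687, .tt 641281687,
   .tt 641281687, .tt 641281687, .tt 641281687, .tt 641281687, .tt 641281687, .tt 680074583,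
   .tt 680074583, .tt 639245911, .tt 652254807, .tt 652254807, .tt 645467511, .tt 653303383,
   .tt 652254807, .tt 655400535, .tt 788535766, .tt 641281303, .tt 654351959, .tt 641281719,
   .tt 607694519, .tt 607694519, .tt 607694519, .tt 607694519, .tt 607694519, .tt 607694519,
   .tt 607694519, .tt 656518839, .tt 624264887, .tt 641281719, .tt 607694519, .tt 654351959,
   .tt 607694519, .tt 607694519, .tt 607694519, .tt 607694519, .tt 607694519, .tt 607694519,
   .tt 656518839, .tt 624264887, .tt 641281719, .tt 607661751, .tt 607596215, .tt 652254807,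
   .tt 607694551, .iso 2 750495609058629801266374760304224622,
   .iso 2 636953322698142747410177452976594176, .iso 2 714725152662263934177193690086790273,
   .iso 3 922098498360486288596022259182974224, .iso 2 835197515883469331799314010613467362,
   .iso 3 793516967992289414747550741805941901, .iso 2 594745442025796603253844923144879344,
   .iso 2 873979833428808783088307278870449326, .iso 3 553207106771596878174528314560102639,
   .iso 2 793516966754348194870549749563668623, .iso 2 955838323847250974285034834154887472,
   .tt 640696695, .iso 2 963635764034480264037652677414597904, .tt 610709175, .tt 610709175,
   .tt 492115479, .tt 610741943, .tt 610774711, .tt 610709175, .tt 610840247, .tt 492115479,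
   .tt 644361911, .tt 644361911, .tt 610807479, .tt 725947895, .tt 503912919, .tt 610709207,
   .tt 610774743, .tt 577351350]

theorem check_t24_12 :
    check 3 12 11 4 10 codeT12 205677393870847 codes24 certs_t24_12 = true := by
  decide +kernel

/-- Certificates for `check_t24_13`. -/
noncomputable def certs_t24_13 : List Cert :=
  [.tt 506673559, .tt 580360567, .tt 516466039, .tt 540229015, .tt 573783447, .tt 540229015,
   .tt 506676631, .tt 506676631, .tt 573783447, .tt 540229015, .tt 506676631, .tt 510133655,
   .tt 574042839, .tt 555060951, .tt 574075607, .tt 574075607, .tt 482881239, .tt 574075607,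
   .tt 574108375, .tt 482881239, .tt 506933975, .tt 552963799, .tt 516435671, .tt 540521175,
   .tt 507032279, .tt 607662807, .tt 516435671, .tt 641151703, .tt 582586071, .tt 641184471,
   .tt 641184471, .tt 641184471, .tt 641250007, .tt 641250007, .tt 482914007, .tt 689122839,
   .tt 585469655, .tt 482914007, .tt 689122839, .tt 516468439, .tt 586518231, .tt 506933975,
   .tt 586518231, .tt 516468439, .tt 516468439, .tt 689122839, .tt 516468439, .tt 585469655,
   .tt 482914007, .tt 420862295, .tt 506933975, .tt 586518231, .tt 516468439, .tt 506933975,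
   .tt 586518231, .tt 516468439, .tt 506933975, .tt 749345335, .tt 749345335, .tt 749345335,
   .tt 749345335, .tt 677850679, .tt 677850679, .tt 506933975, .tt 749345335, .tt 485895895,
   .tt 485602007, .tt 749345335, .tt 540488407, .tt 749345335, .tt 486944471, .tt 540488407,
   .tt 749345335, .tt 749345335, .tt 574042839, .tt 749344791, .tt 487993047, .tt 574042839,
   .tt 574042839, .tt 118905175, .tt 516435671, .tt 551915223, .tt 482881239, .tt 688074295,
   .tt 506933975, .tt 552963799, .tt 516435671, .tt 506933975, .tt 749345335, .tt 485895895,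
   .tt 749345335, .tt 540488407, .tt 574108375, .tt 574108375, .tt 574108375, .tt 521506519,
   .tt 482881239, .tt 552963799, .tt 506933975, .tt 552963799, .tt 482881239, .tt 482881239,
   .tt 516435671, .tt 506933975, .tt 506933975, .tt 506933975, .tt 574042839, .tt 574042839,
   .tt 574108375, .tt 607597271, .tt 607597271, .tt 607695575, .tt 516435671, .tt 516435671,
   .tt 551915223, .tt 482881239, .tt 688074359, .tt 506933975, .tt 552963799, .tt 516435671,
   .tt 506933975, .tt 749345399, .tt 485895895, .tt 485895895, .tt 749345399, .tt 540521175,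
   .tt 506933975, .tt 552963799, .tt 516435671, .tt 540488407, .tt 574075607, .tt 473445079,
   .tt 549957335, .tt 506999511, .tt 518360791, .tt 574108375, .tt 574042839, .tt 574108375,
   .tt 574108375, .tt 473477847, .tt 583544535, .tt 507032279, .tt 507032279, .tt 551915223,
   .tt 574108375, .tt 641250007, .tt 521506519, .tt 536983959, .tt 392511511, .tt 536984983,
   .tt 117856599, .tt 536984983, .tt 536984983, .tt 637648279, .tt 117856599, .tt 392511511,
   .tt 540521175, .tt 674738903, .tt 516435671, .tt 551915223, .tt 482881239, .tt 549137015,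
   .tt 506933975, .tt 552963799, .tt 516435671, .tt 540488407, .tt 638061975, .tt 486944471,
   .tt 540521175, .tt 637649303, .tt 506933975, .tt 552963799, .tt 516435671, .tt 540488407,
   .tt 507032279, .tt 540488407, .tt 520457943, .tt 540521175, .tt 482848471, .tt 540586711,
   .tt 506933975, .tt 540586711, .tt 574042839, .tt 555060951, .tt 574075607, .tt 574108375,
   .tt 516435671, .tt 574042839, .tt 574042839, .tt 641184471, .tt 574075607, .tt 674738903,
   .tt 506933975, .tt 586518231, .tt 516468439, .tt 506933975, .tt 574042839, .tt 574108375,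
   .tt 641184471, .tt 641250007, .tt 574042839, .tt 540521175, .tt 674738903, .tt 516435671,
   .tt 551915223, .tt 482881239, .tt 721628727, .tt 506933975, .tt 552963799, .tt 516435671,
   .tt 516435671, .tt 506933975, .tt 749378103, .tt 485895895, .tt 749378103, .tt 540521175,
   .tt 574042839, .tt 555060951, .tt 574075607, .tt 574075607, .tt 482881239, .tt 506933975,
   .tt 552963799, .tt 516435671, .tt 540521175, .tt 574075607, .tt 507065047, .tt 506933975,
   .tt 552963799, .tt 516435671, .tt 540521175, .tt 574108375, .tt 507065047, .tt 507065047,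
   .tt 520457943, .tt 507032279, .tt 540488407, .tt 520457943, .tt 540521175, .tt 482848471,
   .tt 574042839, .tt 540619479, .tt 506933975, .tt 540619479, .tt 506933975, .tt 586518231,
   .tt 516468439, .tt 540521175, .tt 540521175, .tt 540521175, .tt 507032279, .tt 574108375,
   .tt 574075607, .tt 574108375, .tt 536984983, .tt 540488407, .tt 520457943, .tt 540521175,
   .tt 482848471, .tt 540586711, .tt 540586711, .tt 574042839, .tt 574075607, .tt 540586711,
   .tt 574042839, .tt 540586711, .tt 506999511, .tt 749345335, .tt 749345335, .tt 749345335,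
   .tt 749345335, .tt 591501815, .tt 749345335, .tt 749345399, .tt 638062039, .tt 749378103,
   .tt 749345399, .tt 591501783, .tt 470266583, .tt 756357751, .tt 756357751, .tt 756357751,
   .tt 756357751, .tt 574298615, .tt 756357751, .tt 607853047, .tt 756357783, .tt 760552055,
   .tt 638062039, .tt 705203703, .tt 720580151, .tt 721628727, .tt 693112311, .tt 722677271,
   .tt 722677271, .tt 722677271, .tt 722677271, .tt 722677271, .tt 722677271, .tt 722677271,
   .tt 722677271, .tt 558995927, .tt 550153974, .tt 558995959, .tt 550022487, .tt 558995927,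
   .tt 570953111, .tt 711405111, .tt 558995959, .tt 722472471, .tt 592550423, .tt 615160375,
   .tt 722677271, .tt 722677271, .tt 722677271, .tt 558995959, .tt 558995927, .tt 626104855,
   .tt 721628727, .tt 721628727, .tt 721628727, .tt 558995959, .tt 592550423, .tt 720580151,
   .tt 721628727, .tt 721628727, .tt 721628823, .tt 721628823, .tt 721628823, .tt 558995927,
   .tt 721628823, .tt 721628823, .tt 720580247, .tt 525441591, .tt 570540439, .tt 570540439,
   .tt 638062039, .tt 638061975, .tt 638062071, .tt 637649303, .tt 638094871, .tt 638062039,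
   .tt 607338903, .tt 671616471, .tt 638062071, .tt 540744183, .tt 756231799, .tt 756231799,
   .tt 756231799, .tt 756231799, .tt 593598967, .tt 756231799, .tt 627153399, .tt 756231831,
   .tt 756231799, .tt 760426103, .tt 570897079, .tt 638062071, .tt 760426103, .tt 540229015,
   .tt 674869975, .tt 686928599, .tt 674869975, .tt 674869975, .tt 425903415, .tt 674771671,
   .tt 674771671, .tt 674771671, .tt 674771671, .tt 674771671, .tt 674771671, .tt 490844887,
   .tt 555003543, .tt 524399319, .tt 490844887, .tt 674804439, .tt 674804439, .tt 674804439,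
   .tt 674804439, .tt 674804439, .tt 674804439, .tt 591508183, .tt 674738903, .tt 674738903,
   .tt 524399319, .tt 674771671, .tt 674738903, .tt 674837207, .tt 674837207, .tt 674738903,
   .tt 674738903, .tt 524399319, .tt 674738903, .tt 674738903, .tt 674738903, .tt 490844887,
   .tt 674738903, .tt 674869975, .tt 674869975, .tt 674869975, .tt 674869975, .tt 674869975,
   .tt 674869975, .tt 674869975, .tt 658617047, .tt 652619479, .tt 590393879, .tt 653668055,
   .tt 653668055, .tt 652619479, .tt 652619479, .tt 743998999, .tt 652619479, .tt 652619479,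
   .tt 656813783, .tt 674771671, .tt 674738903, .tt 674837207, .tt 674837207, .tt 674837207,
   .tt 674837207, .tt 674837207, .tt 625062615, .tt 674837207, .tt 674869975, .tt 656813783,
   .tt 674837207, .tt 580333207, .tt 739813015, .tt 580365975, .tt 580333207, .tt 515573399,
   .tt 513322647, .tt 546877079, .tt 758285879, .tt 546877079, .tt 580333207, .tt 689025623,
   .tt 580333207, .tt 580333207, .tt 580333207, .tt 521449111, .tt 580333207, .tt 580398743,
   .tt 552961687, .tt 580365975, .tt 580365975, .tt 513322647, .tt 589345303, .tt 546811543,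
   .tt 521188023, .tt 522236599, .tt 539526551, .tt 684397879,
   .iso 2 9837138685393382651852795298678956, .iso 1 966303522808151357720327190612381226,
   .iso 3 145715267519609076004760158346457316, .iso 4 266862180144842720694775874743582067,
   .iso 2 966303522808151357720327190612381226, .iso 1 977660327828852089019946285134450293,
   .iso 1 839092569470863748775477427372589644, .iso 4 100664548102148760919607692142039319,
   .iso 0 839092569470863748775477427372589644, .iso 2 839092569470863711882024464325575244,
   .iso 0 258942297731457680926489567077903984, .iso 1 311013349723306850900280251396602444,
   .iso 2 804039335309080959565448661718697540, .iso 1 920863234059286011787789357038182057,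
   .tt 707207540, .iso 1 804039335309080959565448661718697540,
   .iso 0 804039335309080922671961613811222084, .iso 2 251236073870568930778038676849557868,
   .iso 1 63240778860474424436800705642183212, .iso 2 418572052583553569861154451920328993,
   .iso 3 311754605280402208349294973311627306, .iso 1 860672735101697212740203295546055152,
   .iso 3 560791128598842897243651886059411183, .iso 1 592460756143760351519840237782245099,
   .iso 1 359007622600878070576368400520859113, .iso 2 220125470752694391026445215391715362,
   .iso 3 311863782925377813712371552275663148, .iso 1 107011637461077752902207827375840904,
   .iso 1 791054753113543529881944502164530723, .tt 18329878, .iso 0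
    427692024895469804143794027268643477,
   .iso 1 395431262968748129776502603664145986, .iso 2 16377028519672750517723376312292456,
   .iso 3 28607529693016056320891835522553218, .iso 3 441629532778578976441276238465701957,
   .iso 2 961115136910401350559889843944497830, .iso 1 731099939061416973174634230500004374,
   .iso 2 99570157042884864034270714085810219, .iso 1 651757804468332165644610931314533911,
   .iso 1 277148133260283338645386773655539275, .iso 2 801444523961177101144601598909165088,
   .iso 1 481143379928405795135125460489755146, .iso 1 436894965288945876158052609421365926,
   .iso 3 113220437992357501801259845987475846, .iso 1 772642157696945137714370429778854415,
   .iso 1 923460976987625109834163600999426529, .iso 3 144541702829695296404558247468538188,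
   .iso 1 632704908098838788767952213425556171, .iso 2 835204596872996069091971365073132261,
   .iso 2 169545945843193414222050844123832326, .iso 1 689566749884140014933445631586012750,
   .iso 4 59209690717102709805250287631947057, .iso 0 801444523961290327259726028136984096,
   .iso 3 310494683139004410641968595142322530, .iso 1 801444523961290290366237881791622688,
   .iso 2 872835992284811607282913872728954504, .iso 3 184700556787057243307178853105279050,
   .iso 1 898641725349145672177822775760164431, .iso 1 526419943682158224900269665483475659,
   .iso 1 792360221502963795754775118234395147, .iso 2 624912528713907510259187844009538052,
   .iso 1 765951537549780263127192283130637039, .iso 3 560871109388860252565107339541102038,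
   .iso 2 639186482560000561219968284729060804, .iso 3 276577653748721863764475226045415463,
   .iso 0 422824482765098032889469296452249199, .iso 1 113589125857423819736181261314800097,
   .iso 1 684339993926185641856708765598425774, .iso 2 762498654000179004754122002354284992,
   .iso 1 937535845199246335299690135713060494, .iso 1 731032951502253917356598581188369142,
   .iso 2 292942886423067080124198269395349577, .iso 3 237963828227916526677444557036163367,
   .iso 2 719668347534378440937074801431848640, .iso 0 344858788846526959332400311431663247,
   .iso 2 340844790435212487157614410785561707, .iso 1 487642748580835843370878797016681089,
   .iso 3 565013587604770241119409171608975856, .iso 2 305880608750721516719450077936691585,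
   .iso 2 218665933442554165157615148294937737, .iso 2 303407298763820846705708903052052811,
   .iso 1 810414381157986477336355852925842070, .iso 3 562492516518896438994111404027566574,
   .iso 0 304578034866774555533970780417853971, .iso 1 401918827354890486776169614790639339,
   .iso 1 68448520096905711844505343908561577, .tt 286890358, .iso 1
    147582877821014500861662425061020332,
   .iso 2 174538098782182410930353667807281479, .iso 1 812919062995152473534835477351990992,
   .iso 1 626200748928357179548159304169265676, .iso 2 374686231446969238739964885769652355,
   .iso 3 567439838318839241144561166538950163, .iso 3 63692142206740239091477310566900992,
   .iso 1 109657152277094651669882752599378534, .iso 2 756006624091891375790782238755794373,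
   .iso 1 767325760015333936197403446732303889, .iso 0 920863233981914759332454191482543785,
   .iso 2 709277498664914310924182803213031948, .iso 3 61466101942453106954191293179474025,
   .iso 1 961115136910363571628026886848848550, .iso 2 665145309031800811883413432473717420,
   .iso 3 189643524971109507818048654698119368, .iso 3 565055660304793617343948230557221614,
   .iso 0 179962717099657043575739847899972176, .iso 2 596356442110085933472309947999981157,
   .iso 2 346161628967409057476789395359540454, .iso 1 269526750617713917174685608517654208,
   .iso 4 142079930964263124140992970819884436, .iso 1 486333378116233137989895590980673059,
   .iso 2 417317203174275394370990833995916448, .iso 3 360958464526348803431404057643883721,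
   .iso 1 762498654154921288303865652202056192, .iso 1 973649830425013646184227946772304531,
   .iso 1 667747915444684786574629735381698147, .iso 2 920863234214028406017997449174720169,
   .iso 2 87840949793615592956010741735332108, .iso 1 831298808504915185315852308205243052,
   .iso 1 596356442110161417549060666995773029, .tt 82325879, .iso 4
    17750018030713527468430139013612726,
   .iso 0 637894816939754375456150555642039909, .iso 3 440496401807050043017237392318014502,
   .iso 1 941552802294724569850401865591267057, .tt 216674485, .iso 3
    276613110898510704152527586278550912,
   .iso 2 792360221503001574686638075394007595, .iso 0 927364184757718108348159868566246978,
   .iso 3 67706905539560259336487663988572300, .iso 2 927364184757718108348159868566246978,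
   .iso 1 927364184757718071454671721148192322, .iso 1 651756229705729871485733369062820372,
   .iso 2 265768109465424853481880119261342949, .iso 3 145397055029106865501407627055501478,
   .iso 1 229233086007464642436455489925963236, .iso 1 671637187580871044008368652296455880,
   .iso 2 462910989100537057495422893357082720, .iso 3 395961032286810640651978129865410571,
   .iso 3 566227922247913708990532143480425168, .iso 1 22641573434105704713422878343843554,
   .iso 4 225486345407753116668088219756677361, .iso 1 835204596872958216373099129871866597,
   .iso 1 693305172748363548824316061021865518, .iso 2 749531823741534346543321235403702952,
   .iso 3 396322382038478441690071498874039492, .iso 2 671637187619594301593947153374447304,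
   .iso 2 591166533307931309514615251081136843, .iso 2 592460756182445756386650955116125931,
   .iso 4 350143063681987832292053510311622772, .iso 1 611446402509635780166660952945237651,
   .iso 2 416338740516039395698254209156322498, .iso 0 715781657912767025025394574379748043,
   .iso 1 707993448911941314849222066571444904, .iso 1 959812244484550232334549080159195623,
   .iso 1 811706009427334658548869131643986576, .iso 1 694518320709938269709949701046446581,
   .iso 1 184988475406780793012213113724126816, .iso 0 423757321458677124495436683538863765,
   .iso 2 382549394802455789914057626669984832, .iso 3 441508897997512498590103998558508041,
   .iso 1 25235299128731566930479204439120453, .tt 427364693, .iso 0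
    678129972627527419796288228060866240,
   .iso 4 17584034839496928230484096278223957, .iso 1 791066028264392988573047778493706788,
   .iso 2 510862208974334832772138747124231428, .iso 1 61953988346139516021220790454571520,
   .iso 1 636591597875305529877097168067667648, .iso 1 853256065415552234317938460541521586,
   .iso 2 959812244484549974080306871650128359, .iso 3 525773400370130658974905117092031781,
   .iso 1 938761317905517124663058828123116212, .iso 0 133272720604496144950115142895940214,
   .iso 3 19725061094939051698034998912518371, .iso 1 684262794661182248045780252473656918,
   .iso 0 756006624091853523071978173241896421, .iso 1 311104537587139807433490895120548450,
   .iso 3 189729761078265007965723988888758496, .iso 2 176029897798459355306364577350461698,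
   .iso 2 874131502888823955737033551231854179, .iso 4 59206046013911449871891449426656656,
   .iso 2 134373500517077452179980478000345290, .iso 2 920871311528515534769388132881437282,
   .iso 1 920871311528515534769388132881437282, .iso 2 512157582084948344478152501570934121,
   .iso 1 854463850402312454086138290148672183, .iso 1 315001258273978831965951717694260746,
   .iso 2 347378176363176058312710350033358122, .iso 3 566109119847779056341600427690712528,
   .iso 3 527307418607303148871196080037958984, .iso 0 513486578765890978317771530601895639,
   .iso 1 756020599148897608450619087223168641, .iso 3 559736594516728016257680462215991767,
   .iso 1 521271934202462245188758870491781861, .iso 1 641261588256084732017620322573037108,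
   .iso 2 138475935710079931362497405601323141, .iso 1 591164027642447084562649134100689417,
   .iso 1 984395819883824257535130163647881839, .iso 1 238246552069218252208841269033916001,
   .iso 2 846882005146810749913602489379526089, .iso 1 631391499603074391096298072470597157,
   .iso 1 645319208816706308509752105451991671, .iso 4 266821818068832643008682763810781423,
   .iso 1 277301203511149108241320292522244647, .iso 3 359742984317278580408839470361650499,
   .iso 3 487026388676653518494343496700529674, .iso 2 591164027603799163479902847205683753,
   .iso 1 805343630278645428787634065122858441, .iso 3 358762925872202986674764495733132647,
   .iso 2 884530228771275166928159047564659235, .tt 570886551,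
   .iso 1 761205341141019340083330239615277601, .iso 1 441960230584558838892263966603728425,
   .iso 1 894867795809039518240904749905316558, .iso 2 256475001497763939741692595265903617,
   .iso 0 919574397540316279349532778364600903, .iso 2 667747915444835828515105268117636643,
   .iso 1 237106857746525068611425146742258215, .iso 2 131813291694537953095326647506932103,
   .iso 2 670333766931626277517030663433464546, .iso 3 565169628543007902338713325509066484,
   .iso 1 938756523364807366160432178388411890, .iso 1 443381374802910671991303938977943237,
   .iso 0 470771946999924427026770834084038260, .iso 2 457596880384418325964708450802306085,
   .iso 1 711872141799866935146006127436868322, .iso 3 267824335895928825699561465334471851,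
   .tt 674831767, .tt 611824311, .tt 544682711, .tt 688108247, .tt 544682711, .tt 491135703,
   .tt 544781015, .tt 611824343, .tt 511193815, .tt 611824343, .tt 611824343, .tt 578269911,
   .tt 691277399, .tt 674831767, .tt 637996439, .iso 3 564726109568582355312494648968267246,
   .iso 1 360301026104200072973019380155833863, .iso 3 402728024774635312048471754013839458,
   .iso 0 213631717783934958683978414547410417, .iso 1 362904467394152764824022859470950883,
   .iso 1 973567242640869357874919822427990518, .iso 1 891984095955826356625746564220661267,
   .iso 2 46190740863148335346786126173679620, .iso 3 568782557757909344372013912625794511,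
   .iso 1 633991846922192097618705362193819142, .iso 2 585963892344565145731757034387518090,
   .iso 2 597655472163276708357681956487570026, .iso 3 487149588469431488344475277797337217,
   .iso 2 211117476143069254902828285655876840, .iso 3 234963102232731588233789044100006980,
   .iso 1 585963892344565145731757034387518090, .iso 1 732494476033633613038731967513403088,
   .iso 2 504493289961833587626974538146193578, .tt 427272502,
   .iso 1 676826597715490478385330321588589222, .iso 2 964999351778645667628707586328865217,
   .iso 4 17715830922677298387113811687197809, .iso 1 522481505769840974655699349677328040,
   .iso 1 724339408503551889924323677628409587, .iso 4 515926446042443075510468237770347793,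
   .iso 2 717068596697434855222396994796725702, .iso 2 718364972622454688747719094021755558,
   .iso 0 676826597754138251894195487062987430, .iso 1 914374367114404417616015988404655752,
   .iso 1 849026749814419455426540768849303123, .iso 0 389074513809977507473998526557065939,
   .iso 2 378330367715962995271362618471256422, .iso 2 52551933965641111397202014014973315,
   .iso 1 818243475415869193370742032183036661, .iso 1 151514693919563775672076704420219398,
   .iso 1 30426410080565388097319316812250755, .iso 3 105158138086415460126602825537230945, .tt
    543785367,
   .iso 3 227652445126744595750924226808454401, .iso 2 98030239870271420179956518521177283,
   .iso 0 761205341141019340083331339191917057, .iso 1 395440226690795438810738014650685988,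
   .iso 1 884530228771275166928194233010489827, .iso 3 108120880168059111367832610152809832,
   .iso 1 597648107730482866028739812982566372, .iso 2 919574397540429616145154635165008423,
   .iso 1 936400869822719305896956697322652339, .iso 2 47690726699800156468851350834807080,
   .iso 1 146332857697957599588380318059839044, .iso 0 53887452007080695810735666849448591,
   .iso 1 831301221101315100570530561004932647, .iso 1 690946952799220974309418348205027894,
   .iso 3 525853183129674133333828367040979083, .iso 2 464000924976963983164026598284002628,
   .iso 3 564732214623269560990096568108538354, .iso 1 194102797765835506151384283670035176,
   .iso 2 831301221101352695034952781074271815, .tt 637996439, .iso 2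
    11052699208266451903668737441139783,
   .iso 1 597655472201999929049737131172438634, .iso 2 719666966311426308389266255252625921,
   .iso 1 190178397465753824175983834671728266, .iso 2 714482224280656581886832521031884417,
   .iso 0 884530228732627282738865723716667971, .iso 3 482072609479538976922176440592565411,
   .tt 573151638, .iso 1 961112772408670421348013416357495367, .iso 3
    19648968629601121961756260063087877,
   .iso 4 391430525128176956503528260149921943, .tt 625193687, .iso 1
    892263885493344640318990032746158800]

theorem check_t24_13 :
    check 3 13 10 3 10 codeT13 549755813887 codes24 certs_t24_13 = true := by
  decide +kernel

/-! ### Tournaments without transitive subtournaments -/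

section Induction

variable {V : Type} {r : V → V → Prop}

theorem asymm_of_isTournament (hr : IsTournament r) (x y : V) (h : r x y) : ¬ r y x := by
  have hne : x ≠ y := by
    rintro rfl
    exact hr.1 x h
  rcases hr.2 x y hne with h' | h'
  · exact h'.2
  · exact absurd h h'.2

theorem total_of_isTournament (hr : IsTournament r) (x y : V) (h : x ≠ y) : r x y ∨ r y x :=
  (hr.2 x y h).imp And.left And.left

theorem NoChain.mono {k : ℕ} {s t : Finset V} (hs : NoChain r k s) (hts : t ⊆ s) :
    NoChain r k t := fun l hl hlt => hs l hl fun x hx => hts (hlt x hx)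

open Classical in
theorem NoChain.out {k : ℕ} {s : Finset V} (hs : NoChain r (k + 1) s) {v : V} (hv : v ∈ s) :
    NoChain r k (s.filter (r v)) := by
  intro l hl hls hp
  refine hs (v :: l) (by simp [hl]) ?_ (List.pairwise_cons.2 ⟨?_, hp⟩)
  · intro x hx
    rcases List.mem_cons.1 hx with rfl | hx
    · exact hv
    · exact (Finset.mem_filter.1 (hls x hx)).1
  · exact fun x hx => (Finset.mem_filter.1 (hls x hx)).2

open Classical in
theorem card_out_add_card_in (hr : IsTournament r) {s : Finset V} {v : V} (hv : v ∈ s) :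
    (s.filter (r v)).card + (s.filter fun w => r w v).card + 1 = s.card := by
  rw [← Finset.card_union_of_disjoint, ← Finset.card_erase_add_one hv]
  · congr 2
    ext w
    have h0 := hr.1 v
    simp only [Finset.mem_union, Finset.mem_filter, Finset.mem_erase]
    by_cases hw : w = v
    · subst hw
      simp [h0]
    · have := total_of_isTournament hr v w (Ne.symm hw)
      tauto
  · rw [Finset.disjoint_filter]
    exact fun w _ h => asymm_of_isTournament hr _ _ h

open Classical in
theorem exists_card_le_out (hr : IsTournament r) {s : Finset V} (hs : s.Nonempty) :
    ∃ v ∈ s, s.card ≤ 2 * (s.filter (r v)).card + 1 := by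
  by_contra! h
  have h1 : ∑ v ∈ s, (s.filter (r v)).card = ∑ v ∈ s, (s.filter fun w => r w v).card :=
    Finset.sum_card_bipartiteAbove_eq_sum_card_bipartiteBelow r
  refine absurd h1 (ne_of_lt (Finset.sum_lt_sum_of_nonempty hs fun v hv => ?_))
  have := card_out_add_card_in hr hv
  have := h v hv
  omega

open Classical in
/-- A vertex to which `emb_of_check` is going to be applied. -/
theorem exists_pivot (hr : IsTournament r) {k b : ℕ}
    (hb : ∀ s : Finset V, NoChain r k s → s.card ≤ b) {s : Finset V} (hs : NoChain r (k + 1) s)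
    (hne : s.card ≠ 0) : ∃ v ∈ s, s.card ≤ 2 * (s.filter (r v)).card + 1 ∧
      (s.filter (r v)).card ≤ b ∧ NoChain r k (s.filter (r v)) ∧
      (s.filter (r v)).card + (s.filter fun w => r w v).card + 1 = s.card := by
  obtain ⟨v, hv, h⟩ := exists_card_le_out hr (Finset.card_ne_zero.1 hne)
  exact ⟨v, hv, h, hb _ (hs.out hv), hs.out hv, card_out_add_card_in hr hv⟩

theorem card_le_of_noChain_succ (hr : IsTournament r) {k b : ℕ}
    (hb : ∀ s : Finset V, NoChain r k s → s.card ≤ b) (s : Finset V) (hs : NoChain r (k + 1) s) :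
    s.card ≤ 2 * b + 1 := by
  by_cases h : s.card = 0
  · omega
  · obtain ⟨v, -, h1, h2, -⟩ := exists_pivot hr hb hs h
    omega

theorem card_le_one (hr : IsTournament r) (s : Finset V) (hs : NoChain r 2 s) : s.card ≤ 1 := by
  refine Finset.card_le_one.2 fun a ha b hb => ?_
  by_contra hne
  rcases total_of_isTournament hr a b hne with h | h
  · exact hs [a, b] rfl (by simp [ha, hb]) (by simp [h])
  · exact hs [b, a] rfl (by simp [ha, hb]) (by simp [h])

theorem card_le_three (hr : IsTournament r) (s : Finset V) (hs : NoChain r 3 s) : s.card ≤ 3 :=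
  card_le_of_noChain_succ hr (card_le_one hr) s hs

theorem card_le_seven (hr : IsTournament r) (s : Finset V) (hs : NoChain r 4 s) : s.card ≤ 7 :=
  card_le_of_noChain_succ hr (card_le_three hr) s hs

theorem emb_of_card_one (s : Finset V) (hc : s.card = 1) : Emb r s 0 1 := by
  obtain ⟨a, rfl⟩ := Finset.card_eq_one.1 hc
  exact ⟨fun _ => a, by simp, fun i j hij hj => by omega⟩

theorem emb_codeC3 (hr : IsTournament r) (s : Finset V) (hs : NoChain r 3 s) (hc : s.card = 3) :
    Emb r s codeC3 3 := by
  obtain ⟨v, hv, h1, h2, h3, h4⟩ := exists_pivot hr (card_le_one hr) hs (by omega)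
  simpa using emb_of_check (asymm_of_isTournament hr) (total_of_isTournament hr) check_c3
    (by omega) hs hv (emb_of_card_one _ (by omega)) (by omega) (by omega) (by omega)

theorem emb_codeQ6 (hr : IsTournament r) (s : Finset V) (hs : NoChain r 4 s) (hc : s.card = 6) :
    Emb r s codeQ6 6 := by
  obtain ⟨v, hv, h1, h2, h3, h4⟩ := exists_pivot hr (card_le_three hr) hs (by omega)
  simpa using emb_of_check (asymm_of_isTournament hr) (total_of_isTournament hr) check_q6
    (by omega) hs hv (emb_codeC3 hr _ h3 (by omega)) (by omega) (by omega) (by omega)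

theorem emb_codeQ7 (hr : IsTournament r) (s : Finset V) (hs : NoChain r 4 s) (hc : s.card = 7) :
    Emb r s codeQ7 7 := by
  obtain ⟨v, hv, h1, h2, h3, h4⟩ := exists_pivot hr (card_le_three hr) hs (by omega)
  simpa using emb_of_check (asymm_of_isTournament hr) (total_of_isTournament hr) check_q7
    (by omega) hs hv (emb_codeC3 hr _ h3 (by omega)) (by omega) (by omega) (by omega)

open Classical in
theorem card_le_thirteen (hr : IsTournament r) (s : Finset V) (hs : NoChain r 5 s) :
    s.card ≤ 13 := by
  by_contra hc
  obtain ⟨t, hts, ht⟩ := Finset.exists_subset_card_eq (show 14 ≤ s.card by omega)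
  have hs' := hs.mono hts
  obtain ⟨v, hv, h1, h2, h3, h4⟩ := exists_pivot hr (card_le_seven hr) hs' (by omega)
  simpa using emb_of_check (asymm_of_isTournament hr) (total_of_isTournament hr) check_t14_7
    (by omega) hs' hv (emb_codeQ7 hr _ h3 (by omega)) (by omega) (by omega) (by omega)

open Classical in
theorem emb_codeT12 (hr : IsTournament r) (s : Finset V) (hs : NoChain r 5 s) (hc : s.card = 12) :
    Emb r s codeT12 12 := by
  obtain ⟨v, hv, h1, h2, h3, h4⟩ := exists_pivot hr (card_le_seven hr) hs (by omega)
  rcases (show (s.filter (r v)).card = 6 ∨ (s.filter (r v)).card = 7 by omega) with h | h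
  · simpa using emb_of_check (asymm_of_isTournament hr) (total_of_isTournament hr) check_t12_6
      (by omega) hs hv (emb_codeQ6 hr _ h3 h) h (by omega) (by omega)
  · simpa using emb_of_check (asymm_of_isTournament hr) (total_of_isTournament hr) check_t12_7
      (by omega) hs hv (emb_codeQ7 hr _ h3 h) h (by omega) (by omega)

open Classical in
theorem emb_codeT13 (hr : IsTournament r) (s : Finset V) (hs : NoChain r 5 s) (hc : s.card = 13) :
    Emb r s codeT13 13 := by
  obtain ⟨v, hv, h1, h2, h3, h4⟩ := exists_pivot hr (card_le_seven hr) hs (by omega)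
  rcases (show (s.filter (r v)).card = 6 ∨ (s.filter (r v)).card = 7 by omega) with h | h
  · simpa using emb_of_check (asymm_of_isTournament hr) (total_of_isTournament hr) check_t13_6
      (by omega) hs hv (emb_codeQ6 hr _ h3 h) h (by omega) (by omega)
  · simpa using emb_of_check (asymm_of_isTournament hr) (total_of_isTournament hr) check_t13_7
      (by omega) hs hv (emb_codeQ7 hr _ h3 h) h (by omega) (by omega)

open Classical in
theorem emb_codes24 (hr : IsTournament r) (s : Finset V) (hs : NoChain r 6 s) (hc : s.card = 24) :
    ∃ T ∈ codes24, Emb r s T 24 := by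
  obtain ⟨v, hv, h1, h2, h3, h4⟩ := exists_pivot hr (card_le_thirteen hr) hs (by omega)
  have hδ : ∀ a ∈ s, 10 ≤ (s.filter fun w => r w a).card := fun a ha => by
    have := card_le_thirteen hr _ (hs.out ha)
    have := card_out_add_card_in hr ha
    omega
  rcases (show (s.filter (r v)).card = 12 ∨ (s.filter (r v)).card = 13 by omega) with h | h
  · exact emb_of_check (asymm_of_isTournament hr) (total_of_isTournament hr) check_t24_12
      (by omega) hs hv (emb_codeT12 hr _ h3 h) h (by omega) hδ
  · exact emb_of_check (asymm_of_isTournament hr) (total_of_isTournament hr) check_t24_13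
      (by omega) hs hv (emb_codeT13 hr _ h3 h) h (by omega) hδ

end Induction

/-! ### Tournaments on 24 vertices -/

/-- The tournament on 24 vertices coded by `T`. -/
def tour (T : ℕ) (a b : Fin 24) : Prop := arc T a b = true

/-- The number of vertices of in-degree 11. -/
def score (f : Fin 24 → Fin 24 → Bool) : ℕ :=
  (Finset.univ.filter fun a => (Finset.univ.filter fun b => f b a = true).card = 11).card

theorem score_eq_of_iso {f f' : Fin 24 → Fin 24 → Bool} (g : Fin 24 ≃ Fin 24)
    (h : ∀ a b, f a b = true ↔ f' (g a) (g b) = true) : score f = score f' := by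
  have h1 : ∀ a, (Finset.univ.filter fun b => f b a = true).card =
      (Finset.univ.filter fun b => f' b (g a) = true).card := fun a =>
    Finset.card_equiv g fun b => by simp [h]
  exact Finset.card_equiv g fun a => by simp [h1]

theorem arcs_codes24 : ∀ T ∈ codes24, ∀ a b : Fin 24,
    arc T a b = (if a = b then false else !arc T b a) := by
  decide +kernel

theorem chains_codes24 : ∀ T ∈ codes24, (chains T 6 (List.range 24)).isEmpty = true := by
  decide +kernel

theorem score_codes24 : ∀ i j : Fin 5, i ≠ j →
    score (fun a b => arc (nth codes24 i) a b) ≠ score (fun a b => arc (nth codes24 j) a b) := by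
  decide +kernel

theorem nth_codes24_mem (i : Fin 5) : nth codes24 i ∈ codes24 := by
  rw [nth_eq_getElem codes24 i i.2]
  exact List.getElem_mem _

theorem isTournament_tour {T : ℕ} (hT : T ∈ codes24) : IsTournament (tour T) := by
  refine ⟨fun a => ?_, fun a b hab => ?_⟩
  · rw [tour, arcs_codes24 T hT a a]
    simp
  · have h := arcs_codes24 T hT a b
    rw [if_neg hab] at h
    rw [tour, tour, h]
    cases arc T b a
    · exact Or.inl (by simp)
    · exact Or.inr (by simp)

theorem not_hasTT_tour {T : ℕ} (hT : T ∈ codes24) : ¬ HasTT (tour T) 6 := by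
  rintro ⟨f, -, hf⟩
  have h : List.ofFn (fun i => (f i : ℕ)) ∈ chains T 6 (List.range 24) := by
    rw [mem_chains]
    refine ⟨by simp, ?_, List.pairwise_ofFn.2 fun i j hij => hf i j hij⟩
    intro a ha
    obtain ⟨i, rfl⟩ := List.mem_ofFn.1 ha
    exact List.mem_range.2 (f i).2
  rw [List.isEmpty_iff.1 (chains_codes24 T hT)] at h
  simp at h

theorem not_tournIso_tour {i j : Fin 5} (hij : i ≠ j) :
    ¬ TournIso (tour (nth codes24 i)) (tour (nth codes24 j)) := by
  rintro ⟨g, hg, h⟩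
  exact score_codes24 i j hij (score_eq_of_iso (Equiv.ofBijective g hg) h)

theorem tournIso_of_emb {r : Fin 24 → Fin 24 → Prop} (hr : IsTournament r) {T : ℕ}
    (hT : T ∈ codes24) (h : Emb r Finset.univ T 24) : TournIso r (tour T) := by
  obtain ⟨e, -, he⟩ := h
  have hT' := isTournament_tour hT
  have key : ∀ i j : Fin 24, i < j →
      (tour T i j ∧ r (e i) (e j)) ∨ (tour T j i ∧ r (e j) (e i)) := fun i j hij => he i j hij j.2
  have hinj : Function.Injective fun i : Fin 24 => e i := by
    intro i j hij
    by_contra hne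
    rcases lt_or_gt_of_ne hne with h | h
    · have := key i j h
      simp only at hij
      rw [hij] at this
      exact hr.1 _ (this.elim And.right And.right)
    · have := key j i h
      simp only at hij
      rw [hij] at this
      exact hr.1 _ (this.elim And.right And.right)
  let E := Equiv.ofBijective _ (Finite.injective_iff_bijective.1 hinj)
  refine ⟨E.symm, E.symm.bijective, fun u v => ?_⟩
  obtain ⟨i, rfl⟩ := E.surjective u
  obtain ⟨j, rfl⟩ := E.surjective v
  rw [E.symm_apply_apply, E.symm_apply_apply]
  change r (e i) (e j) ↔ tour T i j
  rcases lt_trichotomy i j with h | rfl | h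
  · rcases key i j h with h1 | h1
    · simp [h1]
    · simp [asymm_of_isTournament hr _ _ h1.2, asymm_of_isTournament hT' _ _ h1.1]
  · simp [hr.1, hT'.1]
  · rcases key j i h with h1 | h1
    · simp [asymm_of_isTournament hr _ _ h1.2, asymm_of_isTournament hT' _ _ h1.1]
    · simp [h1]

theorem noChain_univ {r : Fin 24 → Fin 24 → Prop} (hr : IsTournament r) (h : ¬ HasTT r 6) :
    NoChain r 6 Finset.univ := by
  rintro l hl - hp
  rw [← hl] at h
  have hget := List.pairwise_iff_get.1 hp
  refine h ⟨l.get, fun i j hij => ?_, hget⟩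
  by_contra hne
  rcases lt_or_gt_of_ne hne with h1 | h1
  · have := hget i j h1
    rw [hij] at this
    exact hr.1 _ this
  · have := hget j i h1
    rw [hij] at this
    exact hr.1 _ this

end Tourn

theorem TT6_free_24_five_classes :
    ∃ T : Fin 5 → (Fin 24 → Fin 24 → Prop),
      (∀ i, IsTournament (T i)) ∧ (∀ i, ¬ HasTT (T i) 6) ∧
      (∀ i j, i ≠ j → ¬ TournIso (T i) (T j)) ∧
      (∀ r : Fin 24 → Fin 24 → Prop, IsTournament r → ¬ HasTT r 6 →
        ∃ i, TournIso r (T i)) := by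
  refine ⟨fun i => Tourn.tour (Tourn.nth Tourn.codes24 i),
    fun i => Tourn.isTournament_tour (Tourn.nth_codes24_mem i),
    fun i => Tourn.not_hasTT_tour (Tourn.nth_codes24_mem i),
    fun i j hij => Tourn.not_tournIso_tour hij, fun r hr h => ?_⟩
  obtain ⟨T, hT, hE⟩ := Tourn.emb_codes24 hr Finset.univ (Tourn.noChain_univ hr h) (by simp)
  obtain ⟨i, hi, rfl⟩ := List.getElem_of_mem hT
  rw [← Tourn.nth_eq_getElem _ _ hi] at hT hE
  exact ⟨⟨i, hi⟩, Tourn.tournIso_of_emb hr hT hE⟩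
end

section
/- The circulant tournament on ZMod 23 induced by the quadratic residues mod 23 contains no transitive subtournament of size 6; that is, the relation r on ZMod 23 defined by r u v ↔ (v - u) ∈ {1, 2, 3, 4, 6, 8, 9, 12, 13, 16, 18} is a tournament that is TT_6-free. -/
/-- The nonzero quadratic residues mod 23. -/
def quadraticResidues23 : List (ZMod 23) := [1, 2, 3, 4, 6, 8, 9, 12, 13, 16, 18]

theorem mem_quadraticResidues23_iff (x : ZMod 23) :
    x ∈ ({1, 2, 3, 4, 6, 8, 9, 12, 13, 16, 18} : Set (ZMod 23)) ↔ x ∈ quadraticResidues23 := by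
  simp [quadraticResidues23]

theorem xor_neg_mem_quadraticResidues23 :
    ∀ x : ZMod 23, x ≠ 0 → Xor (x ∈ quadraticResidues23) (-x ∈ quadraticResidues23) := by
  unfold Xor
  decide

set_option synthInstance.maxSize 1000 in
/-- The out-neighbourhood of `0` contains no transitive subtournament of size 5. -/
theorem not_transitive_quadraticResidues23 :
    ∀ a ∈ quadraticResidues23, ∀ b ∈ quadraticResidues23, b - a ∈ quadraticResidues23 →
    ∀ c ∈ quadraticResidues23, c - a ∈ quadraticResidues23 → c - b ∈ quadraticResidues23 →
    ∀ d ∈ quadraticResidues23, d - a ∈ quadraticResidues23 → d - b ∈ quadraticResidues23 →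
      d - c ∈ quadraticResidues23 →
    ∀ e ∈ quadraticResidues23, e - a ∈ quadraticResidues23 → e - b ∈ quadraticResidues23 →
      e - c ∈ quadraticResidues23 → e - d ∉ quadraticResidues23 := by
  decide +kernel

theorem QR23_circulant_TT6_free :
    IsTournament (fun u v : ZMod 23 =>
      v - u ∈ ({1, 2, 3, 4, 6, 8, 9, 12, 13, 16, 18} : Set (ZMod 23))) ∧
    ¬ HasTT (fun u v : ZMod 23 =>
      v - u ∈ ({1, 2, 3, 4, 6, 8, 9, 12, 13, 16, 18} : Set (ZMod 23))) 6 := by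
  simp only [mem_quadraticResidues23_iff]
  refine ⟨⟨fun v => ?_, fun u v huv => ?_⟩, ?_⟩
  · beta_reduce
    rw [sub_self]
    decide
  · have h := xor_neg_mem_quadraticResidues23 (v - u) (sub_ne_zero.mpr huv.symm)
    rwa [neg_sub] at h
  · rintro ⟨f, -, hf⟩
    have hsub (i j : Fin 6) (hij : i < j) :
        (f j - f 0) - (f i - f 0) ∈ quadraticResidues23 := by
      rw [sub_sub_sub_cancel_right]
      exact hf i j hij
    exact not_transitive_quadraticResidues23
      _ (hf 0 1 (by decide)) _ (hf 0 2 (by decide)) (hsub 1 2 (by decide))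
      _ (hf 0 3 (by decide)) (hsub 1 3 (by decide)) (hsub 2 3 (by decide))
      _ (hf 0 4 (by decide)) (hsub 1 4 (by decide)) (hsub 2 4 (by decide)) (hsub 3 4 (by decide))
      _ (hf 0 5 (by decide)) (hsub 1 5 (by decide)) (hsub 2 5 (by decide)) (hsub 3 5 (by decide))
      (hsub 4 5 (by decide))
end

section
/- Every tournament on 24 vertices contains at most 572 directed 3-cycles, where a directed 3-cycle is a 3-element subset {u, v, w} of the vertices with r u v, r v w, and r w u. -/
namespace IsTournament

variable {V : Type*} {r : V → V → Prop}

theorem asymm (h : IsTournament r) {u v : V} (huv : r u v) : ¬ r v u := by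
  intro hvu
  have hne : u ≠ v := by
    rintro rfl
    exact h.1 u huv
  rcases h.2 u v hne with h' | h'
  · exact h'.2 hvu
  · exact h'.2 huv

open Classical in
theorem two_mul_sum_card_out [Fintype V] (h : IsTournament r) :
    2 * ∑ u, (Finset.univ.filter (r u)).card = Fintype.card V * (Fintype.card V - 1) := by
  have hpair (u v : V) :
      (if r u v then 1 else 0) + (if r v u then 1 else 0) = if v ≠ u then 1 else 0 := by
    by_cases huv : v = u
    · subst huv
      simp [h.1 v]
    · rcases h.2 u v (Ne.symm huv) with h' | h' <;> simp [h'.1, h'.2, huv]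
  calc
    2 * ∑ u, (Finset.univ.filter (r u)).card
        = ∑ u, ∑ v, (if r u v then 1 else 0) + ∑ u, ∑ v, (if r v u then 1 else 0) := by
      rw [Finset.sum_comm (f := fun u v => if r v u then 1 else 0), ← two_mul]
      simp only [Finset.card_filter]
    _ = ∑ u : V, ∑ v : V, if v ≠ u then 1 else 0 := by
      simp only [← Finset.sum_add_distrib, hpair]
    _ = Fintype.card V * (Fintype.card V - 1) := by
      simp only [← Finset.card_filter, Finset.filter_ne', Finset.mem_univ,
        Finset.card_erase_of_mem, Finset.card_univ, Finset.sum_const, smul_eq_mul]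

open Classical in
/-- Each pair of out-neighbours of a vertex spans with it a triple that is not a directed
3-cycle, and the triple determines the vertex and the pair. -/
theorem ncard_cycles_add_sum_choose_le [Fintype V] [DecidableEq V] (h : IsTournament r) :
    {S : Finset V | ∃ u v w : V, S = {u, v, w} ∧ r u v ∧ r v w ∧ r w u}.ncard +
      ∑ u, (Finset.univ.filter (r u)).card.choose 2 ≤ (Fintype.card V).choose 3 := by
  set C := {S : Finset V | ∃ u v w : V, S = {u, v, w} ∧ r u v ∧ r v w ∧ r w u}
  let P := Finset.univ.sigma fun u => (Finset.univ.filter (r u)).powersetCard 2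
  let f : (Σ _ : V, Finset V) → Finset V := fun p => insert p.1 p.2
  have hP (p) (hp : p ∈ P) : (∀ x ∈ p.2, r p.1 x) ∧ p.2.card = 2 := by
    simp only [P, Finset.mem_sigma, Finset.mem_powersetCard] at hp
    exact ⟨fun x hx => (Finset.mem_filter.1 (hp.2.1 hx)).2, hp.2.2⟩
  have hnot (p) (hp : p ∈ P) : p.1 ∉ p.2 := fun hx => h.1 _ ((hP p hp).1 _ hx)
  have hinj : Set.InjOn f P := by
    rintro ⟨u, s⟩ hp ⟨v, t⟩ hq (hpq : insert u s = insert v t)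
    have huv : u = v := by
      by_contra hne
      have hu : u ∈ insert v t := hpq ▸ Finset.mem_insert_self u s
      have hv : v ∈ insert u s := hpq ▸ Finset.mem_insert_self v t
      exact h.asymm ((hP _ hq).1 u ((Finset.mem_insert.1 hu).resolve_left hne))
        ((hP _ hp).1 v ((Finset.mem_insert.1 hv).resolve_left (Ne.symm hne)))
    subst huv
    have hst : s = t := by
      have hs : u ∉ s := hnot _ hp
      have ht : u ∉ t := hnot _ hq
      rw [← Finset.erase_insert hs, hpq, Finset.erase_insert ht]
    rw [hst]
  have hdisj : Disjoint C.toFinset (P.image f) := by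
    rw [Finset.disjoint_left]
    intro S hS hSP
    obtain ⟨u, v, w, hS, huv, hvw, hwu⟩ := Set.mem_toFinset.1 hS
    obtain ⟨p, hp, hpS⟩ := Finset.mem_image.1 hSP
    have hdom : ∀ y ∈ S, ¬ r y p.1 := by
      intro y hy
      rw [← hpS] at hy
      rcases Finset.mem_insert.1 hy with rfl | hy
      · exact h.1 _
      · exact h.asymm ((hP p hp).1 y hy)
    have hmem : p.1 ∈ S := hpS ▸ Finset.mem_insert_self _ _
    subst hS
    simp only [Finset.mem_insert, Finset.mem_singleton] at hmem hdom
    rcases hmem with hx | hx | hx <;> rw [hx] at hdom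
    · exact hdom w (by simp) hwu
    · exact hdom u (by simp) huv
    · exact hdom v (by simp) hvw
  have hsub : C.toFinset ∪ P.image f ⊆ Finset.univ.powersetCard 3 := by
    intro S hS
    rw [Finset.mem_powersetCard_univ]
    rcases Finset.mem_union.1 hS with hS | hS
    · obtain ⟨u, v, w, rfl, huv, hvw, hwu⟩ := Set.mem_toFinset.1 hS
      refine Finset.card_eq_three.2 ⟨u, v, w, ?_, ?_, ?_, rfl⟩ <;> rintro rfl
      · exact h.1 _ huv
      · exact h.1 _ hwu
      · exact h.1 _ hvw
    · obtain ⟨p, hp, rfl⟩ := Finset.mem_image.1 hS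
      rw [Finset.card_insert_of_notMem (hnot p hp), (hP p hp).2]
  have hcard := Finset.card_le_card hsub
  rw [Finset.card_union_of_disjoint hdisj, Finset.card_image_of_injOn hinj,
    Finset.card_powersetCard, Finset.card_univ, Finset.card_sigma] at hcard
  simpa only [Finset.card_powersetCard, Set.ncard_eq_toFinset_card'] using hcard

end IsTournament

theorem cycles_24_le_572 (r : Fin 24 → Fin 24 → Prop) (h : IsTournament r) :
    {S : Finset (Fin 24) |
      ∃ u v w : Fin 24, S = {u, v, w} ∧ r u v ∧ r v w ∧ r w u}.ncard ≤ 572 := by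
  classical
  have hcount := h.ncard_cycles_add_sum_choose_le
  have hsum := h.two_mul_sum_card_out
  have hchoose (u : Fin 24) : 11 * (Finset.univ.filter (r u)).card ≤
      (Finset.univ.filter (r u)).card.choose 2 + 66 := by
    have hle : (Finset.univ.filter (r u)).card ≤ 24 := by
      simpa using Finset.card_le_univ (Finset.univ.filter (r u))
    generalize (Finset.univ.filter (r u)).card = d at hle
    revert d
    decide
  have htotal := Finset.sum_le_sum fun u (_ : u ∈ Finset.univ) => hchoose u
  rw [← Finset.mul_sum, Finset.sum_add_distrib] at htotal
  have h3 : Nat.choose 24 3 = 2024 := by decide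
  simp only [Fintype.card_fin, Finset.sum_const, Finset.card_univ, smul_eq_mul, h3]
    at hcount hsum htotal
  omega
end

section
/- In every tournament on 24 vertices there exists an edge u → v (i.e., vertices u ≠ v with r u v) such that the number of vertices w satisfying r v w and r w u is at most 6. -/
open scoped Classical in
/-- The `0`-`1` adjacency function of a relation. -/
noncomputable def edgeInd {V : Type*} (r : V → V → Prop) (u v : V) : ℤ :=
  if r u v then 1 else 0

section Tournament

open Finset

variable {V : Type*} {r : V → V → Prop}

theorem edgeInd_mul_self (u v : V) : edgeInd r u v * edgeInd r u v = edgeInd r u v := by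
  unfold edgeInd; split_ifs <;> norm_num

theorem IsTournament.edgeInd_self (h : IsTournament r) (u : V) : edgeInd r u u = 0 := by
  simp [edgeInd, h.1 u]

theorem IsTournament.edgeInd_add_swap (h : IsTournament r) {u v : V} (huv : u ≠ v) :
    edgeInd r u v + edgeInd r v u = 1 := by
  unfold edgeInd
  rcases h.2 u v huv with ⟨h1, h2⟩ | ⟨h1, h2⟩ <;> simp [h1, h2]

variable [Fintype V]

/-- The number of out-neighbours of a vertex. -/
noncomputable def outDeg (r : V → V → Prop) (u : V) : ℤ := ∑ v, edgeInd r u v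

theorem IsTournament.sum_edgeInd_left (h : IsTournament r) (v : V) :
    ∑ u, edgeInd r u v = Fintype.card V - 1 - outDeg r v := by
  classical
  have key : ∀ u, edgeInd r u v + edgeInd r v u = 1 - if u = v then 1 else 0 := by
    intro u
    by_cases huv : u = v
    · simp [huv, h.edgeInd_self]
    · simp [huv, h.edgeInd_add_swap huv]
  have hsum := Finset.sum_congr (rfl : (univ : Finset V) = univ) fun u _ => key u
  simp only [sum_add_distrib, sum_sub_distrib, sum_ite_eq', mem_univ, if_true, sum_const,
    card_univ, nsmul_eq_mul, mul_one] at hsum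
  unfold outDeg
  linarith

theorem IsTournament.two_mul_sum_outDeg (h : IsTournament r) :
    2 * ∑ u, outDeg r u = Fintype.card V * (Fintype.card V - 1) := by
  have hin : ∑ v, ∑ u, edgeInd r u v = ∑ u, outDeg r u := sum_comm
  simp only [h.sum_edgeInd_left, sum_sub_distrib, sum_const, card_univ, nsmul_eq_mul] at hin
  linarith

theorem IsTournament.sum_outDeg_sq (h : IsTournament r) :
    ∑ u, outDeg r u ^ 2 =
      2 * (∑ u, ∑ v, ∑ w, edgeInd r u v * edgeInd r v w * edgeInd r u w) +
        ∑ u, outDeg r u := by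
  classical
  have key : ∀ u v w, edgeInd r u v * edgeInd r u w =
      edgeInd r u v * edgeInd r v w * edgeInd r u w +
      edgeInd r u w * edgeInd r w v * edgeInd r u v +
      if v = w then edgeInd r u v else 0 := by
    intro u v w
    by_cases hvw : v = w
    · subst hvw; simp [h.edgeInd_self, edgeInd_mul_self]
    · simp only [hvw, if_false]
      linear_combination (-edgeInd r u v * edgeInd r u w) * h.edgeInd_add_swap hvw
  have hswap : ∀ u, ∑ v, ∑ w, edgeInd r u w * edgeInd r w v * edgeInd r u v =
      ∑ v, ∑ w, edgeInd r u v * edgeInd r v w * edgeInd r u w := fun u => sum_comm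
  calc ∑ u, outDeg r u ^ 2
      = ∑ u, ∑ v, ∑ w, edgeInd r u v * edgeInd r u w := by
        simp only [outDeg, sq, sum_mul_sum]
    _ = _ := by
        simp only [key, sum_add_distrib, hswap, sum_ite_eq, mem_univ, if_true, outDeg]
        ring

theorem IsTournament.sum_inDeg_mul_outDeg (h : IsTournament r) :
    ∑ v, (Fintype.card V - 1 - outDeg r v) * outDeg r v =
      (∑ u, ∑ v, ∑ w, edgeInd r u v * edgeInd r v w * edgeInd r w u) +
        ∑ u, ∑ v, ∑ w, edgeInd r u v * edgeInd r v w * edgeInd r u w := by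
  have key : ∀ u v w, edgeInd r u v * edgeInd r v w =
      edgeInd r u v * edgeInd r v w * edgeInd r w u +
      edgeInd r u v * edgeInd r v w * edgeInd r u w := by
    intro u v w
    by_cases huw : u = w
    · subst huw
      by_cases huv : u = v
      · subst huv; simp [h.edgeInd_self]
      · have : edgeInd r u v * edgeInd r v u = 0 := by
          unfold edgeInd
          rcases h.2 u v huv with ⟨h1, h2⟩ | ⟨h1, h2⟩ <;> simp [h1, h2]
        simp [this]
    · linear_combination (-edgeInd r u v * edgeInd r v w) * h.edgeInd_add_swap huw
  calc ∑ v, (Fintype.card V - 1 - outDeg r v) * outDeg r v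
      = ∑ v, ∑ u, ∑ w, edgeInd r u v * edgeInd r v w := by
        simp only [← h.sum_edgeInd_left]
        simp only [outDeg, sum_mul_sum]
    _ = ∑ u, ∑ v, ∑ w, edgeInd r u v * edgeInd r v w := sum_comm
    _ = _ := by simp only [← sum_add_distrib, ← key]

/-- Twice the number of rooted directed 3-cycles, in terms of the score sequence. -/
theorem IsTournament.two_mul_sum_cyclic (h : IsTournament r) :
    2 * (∑ u, ∑ v, ∑ w, edgeInd r u v * edgeInd r v w * edgeInd r w u) =
      (2 * Fintype.card V - 1) * ∑ u, outDeg r u - 3 * ∑ u, outDeg r u ^ 2 := by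
  have hpath := h.sum_inDeg_mul_outDeg
  have hsq := h.sum_outDeg_sq
  have hexpand : ∑ v, (Fintype.card V - 1 - outDeg r v) * outDeg r v =
      (Fintype.card V - 1) * ∑ v, outDeg r v - ∑ v, outDeg r v ^ 2 := by
    rw [mul_sum, ← sum_sub_distrib]
    exact sum_congr rfl fun v _ => by ring
  linarith

theorem sum_edgeInd_mul_edgeInd (u v : V) :
    ∑ w, edgeInd r v w * edgeInd r w u = ({w | r v w ∧ r w u}.ncard : ℤ) := by
  classical
  rw [Set.ncard_eq_toFinset_card']
  simp [edgeInd, ← ite_and, and_comm]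

end Tournament

theorem edge_with_few_cycles_24 (r : Fin 24 → Fin 24 → Prop)
    (h : IsTournament r) :
    ∃ u v : Fin 24, u ≠ v ∧ r u v ∧ {w | r v w ∧ r w u}.ncard ≤ 6 := by
  by_contra! hmany
  have hlower : 7 * ∑ u, outDeg r u ≤
      ∑ u, ∑ v, ∑ w, edgeInd r u v * edgeInd r v w * edgeInd r w u := by
    simp only [outDeg, Finset.mul_sum]
    refine Finset.sum_le_sum fun u _ => Finset.sum_le_sum fun v _ => ?_
    simp only [mul_assoc, ← Finset.mul_sum, sum_edgeInd_mul_edgeInd]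
    by_cases huv : r u v
    · have hcard := hmany u v (fun e => h.1 v (e ▸ huv)) huv
      simp only [edgeInd, huv, if_true]
      lia
    · simp [edgeInd, huv]
  have hsum := h.two_mul_sum_outDeg
  have hcyc := h.two_mul_sum_cyclic
  have hsq : ∑ u, (23 * outDeg r u - 132) ≤ ∑ u, outDeg r u ^ 2 := by
    refine Finset.sum_le_sum fun u _ => ?_
    rcases le_or_gt (outDeg r u) 11 with hd | hd <;> nlinarith
  rw [Finset.sum_sub_distrib, ← Finset.mul_sum] at hsq
  simp only [Fintype.card_fin, Finset.sum_const, Finset.card_univ, nsmul_eq_mul] at hsum hcyc hsq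
  norm_num at hsum hcyc hsq
  linarith
end

section
/- In every tournament on 23 vertices that is not doubly regular, there exists an edge u → v (i.e., vertices u ≠ v with r u v) such that the number of vertices w satisfying r v w and r w u is at most 5. -/
/-- A tournament is doubly regular if every vertex has the same number `d` of
out-neighbors and every pair of distinct vertices has the same number `t` of
common out-neighbors. -/
def DoublyRegular {V : Type*} (r : V → V → Prop) : Prop :=
  ∃ d t : ℕ, (∀ v : V, {w | r v w}.ncard = d) ∧
    ∀ u v : V, u ≠ v → {w | r u w ∧ r v w}.ncard = t

section Tournament

open Finset

variable {V : Type*} [Fintype V]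

/-- The number of directed triangles through the edges of a tournament, counted edge by edge and
expressed through the out-degrees. -/
theorem two_mul_sum_directed_triangles [DecidableEq V] (a : V → V → ℤ) (hd : ∀ v, a v v = 0)
    (hz : ∀ u v, a u v * a v u = 0) (hs : ∀ u v, u ≠ v → a u v + a v u = 1)
    (hi : ∀ u v, a u v * a u v = a u v) :
    2 * ∑ u, ∑ v, a u v * ∑ w, a v w * a w u =
      ∑ v, ((2 * Fintype.card V - 1) * (∑ w, a v w) - 3 * (∑ w, a v w) ^ 2) := by
  have hs' : ∀ u v, a v u = 1 - (if u = v then 1 else 0) - a u v := by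
    intro u v
    split_ifs with huv
    · subst huv; simp [hd]
    · linarith [hs u v huv]
  have hin : ∀ v, ∑ u, a u v = (Fintype.card V - 1) - ∑ u, a v u := by
    intro v
    rw [sum_congr rfl fun u _ => hs' v u]
    simp [sum_sub_distrib]
  have hcyc : ∑ u, ∑ v, a u v * ∑ w, a v w * a w u =
      ∑ u, ∑ v, ∑ w, a u v * a v w - ∑ u, ∑ v, ∑ w, a u v * a u w * a v w := by
    simp only [mul_sum, ← sum_sub_distrib]
    refine sum_congr rfl fun u _ => sum_congr rfl fun v _ => sum_congr rfl fun w _ => ?_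
    rw [hs' u w]
    split_ifs with huw
    · subst huw
      linear_combination (-1 : ℤ) * hz u v
    · ring
  have hpath : ∑ u, ∑ v, ∑ w, a u v * a v w =
      ∑ v, ((Fintype.card V - 1) - ∑ w, a v w) * ∑ w, a v w := by
    rw [sum_comm]
    refine sum_congr rfl fun v _ => ?_
    rw [← hin v, sum_mul_sum]
  have htrans : 2 * ∑ u, ∑ v, ∑ w, a u v * a u w * a v w =
      ∑ u, ((∑ w, a u w) ^ 2 - ∑ w, a u w) := by
    rw [mul_sum]
    refine sum_congr rfl fun u _ => ?_
    have hswap : ∑ v, ∑ w, a u v * a u w * a v w = ∑ v, ∑ w, a u v * a u w * a w v := by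
      rw [sum_comm]
      refine sum_congr rfl fun v _ => sum_congr rfl fun w _ => by ring
    calc 2 * ∑ v, ∑ w, a u v * a u w * a v w
        = ∑ v, ∑ w, a u v * a u w * a v w + ∑ v, ∑ w, a u v * a u w * a w v := by
          rw [← hswap]; ring
      _ = ∑ v, ∑ w, (a u v * a u w - if v = w then a u v * a u w else 0) := by
          simp only [← sum_add_distrib]
          refine sum_congr rfl fun v _ => sum_congr rfl fun w _ => ?_
          rw [hs' v w]
          split_ifs <;> ring
      _ = (∑ w, a u w) ^ 2 - ∑ w, a u w := by
          simp [sum_sub_distrib, hi, sq, sum_mul_sum]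
  rw [hcyc, mul_sub, htrans, hpath, mul_sum, ← sum_sub_distrib]
  exact sum_congr rfl fun v _ => by ring

/-- A tournament on `4 * k + 3` vertices in which every edge lies in at least `k + 1` directed
triangles is doubly regular. -/
theorem IsTournament.doublyRegular_of_le_ncard {r : V → V → Prop} (h : IsTournament r) {k : ℕ}
    (hV : Fintype.card V = 4 * k + 3)
    (hk : ∀ u v, r u v → k + 1 ≤ {w | r v w ∧ r w u}.ncard) : DoublyRegular r := by
  classical
  obtain ⟨hirr, hx⟩ := h
  set a : V → V → ℤ := fun u v => if r u v then 1 else 0 with ha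
  have hasymm : ∀ u v, r u v → ¬ r v u := by
    intro u v huv hvu
    rcases hx u v (by rintro rfl; exact hirr u huv) with h | h
    · exact h.2 hvu
    · exact h.2 huv
  have hd : ∀ v, a v v = 0 := fun v => by simp [ha, hirr]
  have hi : ∀ u v, a u v * a u v = a u v := fun u v => by simp [ha]
  have hz : ∀ u v, a u v * a v u = 0 := by
    intro u v
    by_cases huv : r u v
    · simp [ha, hasymm u v huv]
    · simp [ha, huv]
  have hs : ∀ u v, u ≠ v → a u v + a v u = 1 := by
    intro u v huv
    rcases hx u v huv with h | h <;> simp [ha, h.1, h.2]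
  have hout : ∀ v, ({w | r v w}.ncard : ℤ) = ∑ w, a v w := by
    intro v
    simp [ha, Set.ncard_eq_toFinset_card']
  have hcyc : ∀ u v, ({w | r v w ∧ r w u}.ncard : ℤ) = ∑ w, a v w * a w u := by
    intro u v
    simp [ha, Set.ncard_eq_toFinset_card', ← ite_and, and_comm]
  have hS := two_mul_sum_directed_triangles a hd hz hs hi
  have hcard : (Fintype.card V : ℤ) = 4 * k + 3 := by exact_mod_cast hV
  have hdeg : ∑ v, ∑ w, a v w = (4 * k + 3) * (2 * k + 1) := by
    have h2 : ∑ v, ∑ w, a v w + ∑ v, ∑ w, a w v = (4 * k + 3) * (4 * k + 2) := by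
      simp only [← sum_add_distrib]
      have : ∀ v w, a v w + a w v = 1 - if v = w then 1 else 0 := by
        intro v w
        split_ifs with hvw
        · subst hvw; simp [hd]
        · simp [hs v w hvw]
      simp only [this, sum_sub_distrib]
      simp [hcard]
      ring
    rw [sum_comm (f := fun v w => a w v)] at h2
    linarith
  have hsum : 2 * ∑ u, ∑ v, a u v * ((∑ w, a v w * a w u) - (k + 1)) +
      3 * ∑ v, ((∑ w, a v w) - (2 * k + 1)) ^ 2 = 0 := by
    have h1 : ∑ u, ∑ v, a u v * ((∑ w, a v w * a w u) - (k + 1)) =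
        ∑ u, ∑ v, a u v * (∑ w, a v w * a w u) - (∑ u, ∑ v, a u v) * (k + 1) := by
      simp only [mul_sub, sum_sub_distrib, sum_mul]
    have h2 : ∑ v, ((∑ w, a v w) - (2 * k + 1)) ^ 2 = ∑ v, (∑ w, a v w) ^ 2 -
        2 * (2 * k + 1) * ∑ v, ∑ w, a v w + (4 * k + 3) * (2 * k + 1) ^ 2 := by
      simp only [sub_sq, sum_add_distrib, sum_sub_distrib, mul_sum]
      simp only [← sum_mul, ← mul_sum, sum_const, card_univ, nsmul_eq_mul, hcard]
      ring
    rw [sum_sub_distrib, ← mul_sum, ← mul_sum, hcard] at hS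
    rw [h1, h2]
    rw [hdeg] at hS ⊢
    linear_combination hS
  have hnn : ∀ u v, 0 ≤ a u v * ((∑ w, a v w * a w u) - (k + 1)) := by
    intro u v
    by_cases huv : r u v
    · have : ((k + 1 : ℕ) : ℤ) ≤ _ := Nat.cast_le.mpr (hk u v huv)
      rw [hcyc] at this
      push_cast at this
      have ha1 : a u v = 1 := by simp [ha, huv]
      rw [ha1]
      linarith
    · simp [ha, huv]
  have hnn1 := sum_nonneg fun u (_ : u ∈ univ) => sum_nonneg fun v (_ : v ∈ univ) => hnn u v
  have hnn2 := sum_nonneg fun v (_ : v ∈ univ) => sq_nonneg ((∑ w, a v w) - (2 * k + 1))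
  have hreg : ∀ v, ∑ w, a v w = 2 * k + 1 := by
    intro v
    have h0 : ∑ v, ((∑ w, a v w) - (2 * k + 1)) ^ 2 = 0 := by linarith
    have := (sum_eq_zero_iff_of_nonneg fun v _ => sq_nonneg _).1 h0 v (mem_univ v)
    linarith [pow_eq_zero_iff (two_ne_zero) |>.1 this]
  have hexact : ∀ u v, r u v → ∑ w, a v w * a w u = k + 1 := by
    intro u v huv
    have h0 : ∑ u, ∑ v, a u v * ((∑ w, a v w * a w u) - (k + 1)) = 0 := by linarith
    have h1 := (sum_eq_zero_iff_of_nonneg fun u _ => sum_nonneg fun v _ => hnn u v).1 h0 u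
      (mem_univ u)
    have h2 := (sum_eq_zero_iff_of_nonneg fun v _ => hnn u v).1 h1 v (mem_univ v)
    have ha1 : a u v = 1 := by simp [ha, huv]
    rw [ha1] at h2
    linarith
  have hcommon : ∀ u v, r u v → {w | r u w ∧ r v w}.ncard = k := by
    intro u v huv
    have hsplit : ({w | r u w ∧ r v w}.ncard : ℤ) = ∑ w, a v w - ∑ w, a v w * a w u := by
      have : ({w | r u w ∧ r v w}.ncard : ℤ) = ∑ w, a u w * a v w := by
        simp [ha, Set.ncard_eq_toFinset_card', ← ite_and, and_comm]
      rw [this, ← sum_sub_distrib]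
      refine sum_congr rfl fun w _ => ?_
      rcases eq_or_ne u w with rfl | huw
      · simp [ha, hasymm u v huv]
      · linear_combination a v w * hs u w huw
    rw [hreg, hexact u v huv] at hsplit
    omega
  refine ⟨2 * k + 1, k, fun v => ?_, fun u v huv => ?_⟩
  · have := hout v
    rw [hreg] at this
    exact_mod_cast this
  · rcases hx u v huv with h | h
    · exact hcommon u v h.1
    · simpa only [and_comm] using hcommon v u h.1

end Tournament

theorem edge_with_few_cycles_23 (r : Fin 23 → Fin 23 → Prop)
    (h : IsTournament r) (hnd : ¬ DoublyRegular r) :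
    ∃ u v : Fin 23, u ≠ v ∧ r u v ∧ {w | r v w ∧ r w u}.ncard ≤ 5 := by
  by_contra! hc
  refine hnd (h.doublyRegular_of_le_ncard (k := 5) (by simp) fun u v huv => ?_)
  exact hc u v (by rintro rfl; exact h.1 u huv) huv
end

section
/- Every tournament on 20 vertices contains a transitive subtournament of size 6 or a subtournament isomorphic to H_6, where H_6 is the 6-vertex tournament consisting of a transitive tournament on 3 vertices each of whose vertices beats every vertex of a directed 3-cycle. -/
/-- The tournament `H_6`: a transitive tournament on three vertices dominating
a directed 3-cycle. -/
def H6 : Fin 6 → Fin 6 → Prop := fun i j =>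
  ((i : ℕ), (j : ℕ)) ∈
    [(0, 1), (0, 2), (1, 2),
     (0, 3), (0, 4), (0, 5), (1, 3), (1, 4), (1, 5), (2, 3), (2, 4), (2, 5),
     (3, 4), (4, 5), (5, 3)]

namespace Tournament20

/-! ### Evaluation helpers for kernel computation -/

/-- Apply `f` to `n`, written so that the kernel first evaluates `n` to a numeral. -/
noncomputable def force (n : ℕ) (f : ℕ → Bool) : Bool :=
  Nat.rec false (fun k _ => f k) (Nat.add n 1)

theorem force_eq (n : ℕ) (f : ℕ → Bool) : force n f = f n := rfl

/-- Apply a predicate to a list of numbers after evaluating its entries. -/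
noncomputable def forceList : List ℕ → (List ℕ → Bool) → Bool
  | [], k => k []
  | a :: l, k => force a fun a => forceList l fun l => k (a :: l)

theorem forceList_eq (l : List ℕ) (k : List ℕ → Bool) : forceList l k = k l := by
  induction l generalizing k with
  | nil => rfl
  | cons a l ih => rw [forceList, force_eq, ih]

/-- The `i`-th binary digit of `m`. -/
def bitAt (m i : ℕ) : Bool := Nat.beq (Nat.land (Nat.shiftRight m i) 1) 1

theorem bitAt_eq (m i : ℕ) : bitAt m i = m.testBit i := by
  have h : bitAt m i = Nat.beq ((m >>> i) % 2) 1 :=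
    congrArg (Nat.beq · 1) (Nat.and_one_is_mod _)
  rw [h, Nat.testBit, Nat.and_comm 1, Nat.and_one_is_mod]
  rcases Nat.mod_two_eq_zero_or_one (m >>> i) with h | h <;> rw [h] <;> rfl

/-- Whether `x` has at most two nonzero binary digits. -/
noncomputable def atMostTwo (x : ℕ) : Bool :=
  force (Nat.land x (Nat.sub x 1)) fun y => Nat.beq (Nat.land y (Nat.sub y 1)) 0

theorem exists_testBit_land_pred {x : ℕ} (hx : x ≠ 0) :
    ∃ i, x.testBit i = true ∧
      ∀ j, (x &&& (x - 1)).testBit j = true → x.testBit j = true ∧ j ≠ i := by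
  induction x using Nat.binaryRec' with
  | zero => exact absurd rfl hx
  | bit b n h ih =>
    cases b with
    | true =>
      refine ⟨0, Nat.testBit_bit_zero _ _, fun j hj => ?_⟩
      have e : Nat.bit true n - 1 = Nat.bit false n := by simp [Nat.bit]
      rw [e, Nat.land_bit] at hj
      cases j with
      | zero => exact absurd ((Nat.testBit_bit_zero _ _).symm.trans hj) (by decide)
      | succ j =>
        rw [Nat.testBit_bit_succ, Nat.and_self] at hj
        exact ⟨(Nat.testBit_bit_succ _ _ _).trans hj, j.succ_ne_zero⟩
    | false =>
      have hn : n ≠ 0 := by rintro rfl; simp at h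
      obtain ⟨i, hi, H⟩ := ih hn
      refine ⟨i + 1, (Nat.testBit_bit_succ _ _ _).trans hi, fun j hj => ?_⟩
      have e : Nat.bit false n - 1 = Nat.bit true (n - 1) := by simp [Nat.bit]; omega
      rw [e, Nat.land_bit] at hj
      cases j with
      | zero => exact absurd ((Nat.testBit_bit_zero _ _).symm.trans hj) (by decide)
      | succ j =>
        rw [Nat.testBit_bit_succ] at hj
        exact ⟨(Nat.testBit_bit_succ _ _ _).trans (H j hj).1, by have := (H j hj).2; omega⟩

theorem exists_three_bits {x : ℕ} (hx : atMostTwo x = false) :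
    ∃ i j k, i ≠ j ∧ i ≠ k ∧ j ≠ k ∧
      x.testBit i = true ∧ x.testBit j = true ∧ x.testBit k = true := by
  have hz : (x &&& (x - 1)) &&& ((x &&& (x - 1)) - 1) ≠ 0 := Nat.ne_of_beq_eq_false hx
  have hy : x &&& (x - 1) ≠ 0 := fun h => hz (by simp [h])
  have h0 : x ≠ 0 := fun h => hy (by simp [h])
  obtain ⟨i, hi, Hi⟩ := exists_testBit_land_pred h0
  obtain ⟨j, hj, Hj⟩ := exists_testBit_land_pred hy
  obtain ⟨k, hk⟩ := Nat.exists_testBit_of_ne_zero hz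
  obtain ⟨hk, hkj⟩ := Hj k hk
  exact ⟨i, j, k, (Hi j hj).2.symm, (Hi k hk).2.symm, hkj.symm, hi, (Hi j hj).1, (Hi k hk).1⟩

/-- The number whose binary digits are the values of `p` along `l`. -/
def bits {α : Type*} (p : α → Bool) (l : List α) : ℕ :=
  l.foldr (fun a n => Nat.bit (p a) n) 0

theorem bits_land_bits {α : Type*} {p q : α → Bool} {l : List α}
    (h : ∀ a ∈ l, p a = true → q a = true → False) :
    Nat.beq (Nat.land (bits p l) (bits q l)) 0 = true := by
  suffices h : bits p l &&& bits q l = 0 from (congrArg (Nat.beq · 0) h).trans rfl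
  induction l with
  | nil => exact Nat.zero_and _
  | cons a l ih =>
    have e : (p a && q a) = false := by
      have := h a (by simp)
      cases hp : p a <;> cases hq : q a <;> simp_all
    rw [bits, bits, List.foldr_cons, List.foldr_cons, Nat.land_bit, e]
    have := ih fun a ha => h a (by simp [ha])
    rw [bits, bits] at this
    rw [this]
    rfl

/-! ### Ten-vertex tournaments in which every arc has at most two common out-neighbours -/

/-- The arcs of the Paley tournament on eleven vertices. -/
def paley (i j : ℕ) : Bool := bitAt 570 ((j + 11 - i) % 11)

/-- Add to the out-neighbourhood masks `T` of a tournament a new last vertex with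
out-neighbourhood mask `m`. -/
def extend (T : List ℕ) (m : ℕ) : List ℕ :=
  T.mapIdx (fun i t => bif bitAt m i then t else Nat.lor t (Nat.pow 2 T.length)) ++ [m]

/-- Whether `t` has at most two digits in common with the members of a list at the
positions given by the digits of `s`. -/
noncomputable def goodRow (t : ℕ) : List ℕ → ℕ → Bool
  | [], _ => true
  | u :: us, s => (Nat.beq (Nat.land s 1) 0 || atMostTwo (Nat.land t u)) &&
      goodRow t us (Nat.shiftRight s 1)

/-- Whether every arc has at most two common out-neighbours. -/
noncomputable def good (T : List ℕ) : Bool := T.all fun t => goodRow t T t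

/-- The out-neighbourhood masks on `n` vertices with the prescribed digits. -/
def candidates (n : ℕ) (cs : List (ℕ × Bool)) : List ℕ :=
  (List.range (2 ^ n)).filter fun m => cs.all fun c => bitAt m c.1 == c.2

/-- The positions at which the vertices `0, …, 9` of the Paley tournament are looked for. -/
def paleyPositions (T : List ℕ) (k : ℕ) : List ℕ :=
  let b i := 1 + (i + k) % 5
  let x i := T.findIdx fun t => bitAt t 0 && bitAt t (b (i + 4)) && bitAt t (b (i + 2))
  [0, b 0, x 0, b 4, b 1, b 2, x 4, x 3, x 1, b 3]

/-- Whether `g` maps the vertices `0, …, 9` of the Paley tournament into `T`. -/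
def isPaley (T g : List ℕ) : Bool :=
  (List.range 10).all fun i => Nat.blt (g.getD i 0) 10 && (List.range 10).all fun j =>
    !paley i j || bitAt (T.getD (g.getD i 0) 0) (g.getD j 0)

/-- Whether the tournament `T` is isomorphic to the Paley tournament minus a vertex. -/
noncomputable def containsPaley (T : List ℕ) : Bool :=
  (List.range 5).any fun k => forceList (paleyPositions T k) fun g => isPaley T g

/-- Whether all extensions of `T` by vertices satisfying the given constraints are
isomorphic to the Paley tournament minus a vertex. -/
noncomputable def allPaley : List (List (ℕ × Bool)) → List ℕ → Bool
  | [], T => containsPaley T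
  | c :: cs, T => (candidates T.length c).all fun m =>
    !(T.all fun t => atMostTwo (Nat.land t m)) ||
      forceList (extend T m) fun T => !good T || allPaley cs T

/-- Known arcs to earlier vertices, for a vertex `0` of out-degree five with out-neighbours
`1, …, 5` and in-neighbours `6, …, 9`. -/
def constraints : List (List (ℕ × Bool)) :=
  [[], [(0, false)], [(0, false), (1, false)], [(0, false), (1, false), (2, false)],
    [(0, false), (1, true)], [(0, false), (1, true), (4, false)],
    [(0, true)], [(0, true), (6, false)], [(0, true), (6, false), (7, false)], [(0, true)]]

set_option maxRecDepth 100000 in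
theorem allPaley_constraints : allPaley constraints [] = true := by decide +kernel

/-! ### Out-neighbourhoods in the Paley tournament minus a vertex -/

/-- Increasing triples of vertices. -/
def triples : List (ℕ × ℕ × ℕ) :=
  (List.range 10).flatMap fun k => (List.range k).flatMap fun j =>
    (List.range j).map fun i => (i, j, k)

/-- Vertices with three out-neighbours. -/
def stars : List (ℕ × ℕ × ℕ × ℕ) :=
  (List.range 10).flatMap fun i => (triples.filter fun t =>
    paley i t.1 && paley i t.2.1 && paley i t.2.2).map fun t => (i, t)

/-- Arcs with two common out-neighbours. -/
def arcs : List (ℕ × ℕ × ℕ × ℕ) :=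
  (List.range 10).flatMap fun i => ((List.range 10).filter (paley i)).flatMap fun j =>
    let s := (List.range 10).filter fun k => paley i k && paley j k
    s.flatMap fun k => (s.filter (Nat.blt k)).map fun l => (i, j, k, l)

/-- Transitive triples with a common out-neighbour. -/
def transTriples : List (ℕ × ℕ × ℕ) :=
  (List.range 10).flatMap fun i => ((List.range 10).filter (paley i)).flatMap fun j =>
    ((List.range 10).filter fun k => paley i k && paley j k &&
      (List.range 10).any fun l => paley i l && paley j l && paley k l).map fun k => (i, j, k)

/-- The triples that no two compatible masks may both contain (`true`) or both miss
(`false`). -/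
def tests : List (Bool × ℕ × ℕ × ℕ) :=
  triples.map (fun t => (true, t)) ++ transTriples.map (fun t => (false, t))

/-- The triples contained in `m`, and the triples of `transTriples` disjoint from `m`. -/
def tripleCode (m : ℕ) : ℕ :=
  bits (fun t => bitAt m t.2.1 == t.1 && bitAt m t.2.2.1 == t.1 && bitAt m t.2.2.2 == t.1) tests

/-- The members `(i, j, k, l)` of `arcs` such that a vertex `x` with out-neighbourhood `m`
dominates `k` and `l`, and `i, j, x` span a transitive triple. -/
def arcCode (m : ℕ) : ℕ :=
  bits (fun a => (!bitAt m a.1 || bitAt m a.2.1) && bitAt m a.2.2.1 && bitAt m a.2.2.2) arcs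

/-- The members of `arcs` whose arc is disjoint from `m`. -/
def coarcCode (m : ℕ) : ℕ :=
  bits (fun a => !bitAt m a.1 && !bitAt m a.2.1) arcs

/-- The data needed to compare `m` with other masks. -/
def code (m : ℕ) : ℕ × ℕ × ℕ := (tripleCode m, arcCode m, coarcCode m)

/-- Whether `m` contains no vertex together with three of its out-neighbours. -/
def admissible (m : ℕ) : Bool :=
  stars.all fun s => !(bitAt m s.1 && bitAt m s.2.1 && bitAt m s.2.2.1 && bitAt m s.2.2.2)

/-- Whether two vertices with these codes can both be dominating the same vertex. -/
def compatible (t u : ℕ × ℕ × ℕ) : Bool :=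
  Nat.beq (Nat.land t.1 u.1) 0 &&
    (Nat.beq (Nat.land t.2.1 u.2.2) 0 || Nat.beq (Nat.land u.2.1 t.2.2) 0)

/-- The members of `l` that are compatible with `t`. -/
noncomputable def compatibleWith (t : ℕ × ℕ × ℕ) (l : List (ℕ × ℕ × ℕ)) : List (ℕ × ℕ × ℕ) :=
  List.rec [] (fun u _ ih => bif compatible t u then u :: ih else ih) l

/-- Whether `f` holds for the members compatible with `t` of each suffix following an
element `t` of `l`. -/
noncomputable def noCliqueStep (f : List (ℕ × ℕ × ℕ) → Bool) (l : List (ℕ × ℕ × ℕ)) : Bool :=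
  List.rec true (fun t l ih => f (compatibleWith t l) && ih) l

/-- Whether `l` contains no `k` pairwise compatible codes. -/
noncomputable def noClique : ℕ → List (ℕ × ℕ × ℕ) → Bool
  | 0, _ => false
  | k + 1, l => noCliqueStep (noClique k) l

/-- Apply a predicate to the list of codes of a list of masks after evaluating the codes. -/
noncomputable def forceCodes : List ℕ → (List (ℕ × ℕ × ℕ) → Bool) → Bool
  | [], k => k []
  | m :: l, k => force (tripleCode m) fun s => force (arcCode m) fun e =>
      force (coarcCode m) fun d => forceCodes l fun l => k ((s, e, d) :: l)

theorem forceCodes_eq (l : List ℕ) (k : List (ℕ × ℕ × ℕ) → Bool) :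
    forceCodes l k = k (l.map code) := by
  induction l generalizing k with
  | nil => rfl
  | cons m l ih => rw [forceCodes, force_eq, force_eq, force_eq, ih]; rfl

/-- The admissible masks. -/
def masks : List ℕ := [
  0, 2, 32, 64, 128, 512, 1, 4, 8, 16, 256, 3, 36, 136, 320, 528, 66, 160, 192, 514, 544, 6,
  80, 129, 288, 520, 48, 72, 132, 258, 513, 10, 33, 34, 68, 96, 130, 144, 576, 640, 768, 18,
  40, 65, 384, 516, 12, 17, 20, 164, 200, 257, 264, 322, 515, 560, 194, 224, 546, 578, 672,
  35, 70, 100, 112, 134, 138, 161, 208, 290, 522, 584, 641, 656, 800, 832, 5, 9, 24, 98, 162,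
  260, 272, 592, 608, 131, 642, 352, 648, 704, 38, 50, 104, 386, 577, 644, 67, 168, 448, 530,
  548, 14, 84, 145, 289, 776, 52, 770, 74, 529, 140, 545, 176, 328, 196, 259, 7, 137, 292,
  336, 536, 19, 44, 321, 392, 532, 42, 49, 76, 97, 146, 37, 148, 266, 324, 580, 152, 769, 784,
  896, 11, 82, 193, 262, 416, 88, 518, 304, 521, 552, 133, 166, 624, 643, 354, 712, 116, 142,
  81, 802, 198, 291, 296, 524, 240, 385, 22, 673, 586, 657, 840, 78, 177, 778, 212, 801, 195,
  480, 550, 594, 680, 26, 69, 99, 960, 170, 400, 41, 612, 658, 772, 39, 600, 135, 736, 139,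
  848, 294, 226, 649, 356, 664, 368, 610, 674, 706, 21, 265, 28, 268, 273, 232, 390, 579, 56,
  450, 120, 517, 645, 306, 585, 274, 676, 73, 388, 562, 83, 424, 534, 280, 178, 609, 13, 276,
  449, 556, 261, 25, 708, 46, 106, 147, 332, 53, 298, 464, 149, 554, 588, 113, 777, 210, 293,
  150, 285, 897, 898, 267, 904, 596, 353, 92, 15, 156, 297, 71, 401, 340, 785, 780, 85, 30,
  153, 305, 169, 804, 270, 538, 201, 225, 792, 582, 928, 338, 302, 519, 184, 275, 533, 905,
  452, 60, 738, 269, 369, 604, 151, 281, 396, 329, 549, 540, 277, 568, 75, 420, 337, 29, 300,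
  786, 23, 284, 393, 58, 89, 278, 389, 525, 105, 312, 402, 581, 900, 233, 466, 570, 583, 932]

set_option maxRecDepth 100000 in
theorem mem_masks_of_admissible_aux :
    ((List.range 1024).all fun m => !admissible m || masks.any (Nat.beq m)) = true := by
  decide +kernel

theorem mem_masks_of_admissible {m : ℕ} (hm : m < 1024) (h : admissible m = true) :
    m ∈ masks := by
  have := List.all_eq_true.1 mem_masks_of_admissible_aux m (List.mem_range.2 hm)
  rw [h, Bool.not_true, Bool.false_or, List.any_eq_true] at this
  obtain ⟨x, hx, e⟩ := this
  exact Nat.eq_of_beq_eq_true e ▸ hx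

set_option maxRecDepth 100000 in
theorem noClique_masks_aux :
    forceCodes masks (fun l => l.all (fun t => !compatible t t) && noClique 8 l) = true := by
  decide +kernel

theorem noClique_masks : (∀ m ∈ masks, compatible (code m) (code m) = false) ∧
    noClique 8 (masks.map code) = true := by
  have := noClique_masks_aux
  rw [forceCodes_eq, Bool.and_eq_true] at this
  refine ⟨fun m hm => ?_, this.2⟩
  simpa using List.all_eq_true.1 this.1 (code m) (List.mem_map_of_mem hm)

/-! ### Tournaments without `TT_6` and `H_6` -/

variable {V : Type*} {r : V → V → Prop}

/-- No transitive triple has three common out-neighbours. -/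
def NoTripleJoin (r : V → V → Prop) : Prop :=
  ∀ ⦃a b c⦄, r a b → r a c → r b c → ∀ ⦃x y z⦄, x ≠ y → x ≠ z → y ≠ z →
    r a x ∧ r a y ∧ r a z → r b x ∧ r b y ∧ r b z → r c x ∧ r c y ∧ r c z → False

theorem _root_.IsTournament.ne (h : IsTournament r) {a b : V} (hab : r a b) : a ≠ b := by
  rintro rfl
  exact h.1 _ hab

theorem _root_.IsTournament.asymm_s17 (h : IsTournament r) {a b : V} (hab : r a b) : ¬ r b a := by
  rcases h.2 a b (h.ne hab) with ⟨_, h⟩ | ⟨_, h⟩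
  · exact h
  · exact absurd hab h

theorem _root_.IsTournament.total (h : IsTournament r) {a b : V} (hab : a ≠ b) :
    r a b ∨ r b a := by
  rcases h.2 a b hab with ⟨h, _⟩ | ⟨h, _⟩
  · exact Or.inl h
  · exact Or.inr h

theorem injective_of_total (h : IsTournament r) {n : ℕ} {f : Fin n → V}
    (hf : ∀ i j, i ≠ j → r (f i) (f j) ∨ r (f j) (f i)) : Function.Injective f := by
  intro i j e
  by_contra hij
  rcases hf i j hij with h' | h'
  · exact h.ne h' e
  · exact h.ne h' e.symm

theorem noTripleJoin (h : IsTournament r) (hT : ¬ HasTT r 6)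
    (hH : ¬ ∃ g : Fin 6 → V, Function.Injective g ∧ ∀ i j, H6 i j → r (g i) (g j)) :
    NoTripleJoin r := by
  intro a b c hab hac hbc x y z hxy hxz hyz ha hb hc
  have key : ∀ p q s, r a p ∧ r a q ∧ r a s → r b p ∧ r b q ∧ r b s → r c p ∧ r c q ∧ r c s →
      r p q → r q s → False := by
    rintro p q s ⟨hap, haq, has⟩ ⟨hbp, hbq, hbs⟩ ⟨hcp, hcq, hcs⟩ hpq hqs
    have hps : p ≠ s := by
      rintro rfl
      exact h.asymm_s17 hpq hqs
    rcases h.total hps with hps | hsp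
    · refine hT ⟨![a, b, c, p, q, s], injective_of_total h fun i j hij => ?_, fun i j hij => ?_⟩
      · fin_cases i <;> fin_cases j <;> first | exact absurd rfl hij | simp [*]
      · fin_cases i <;> fin_cases j <;> first | exact absurd hij (by decide) | simp [*]
    · refine hH ⟨![a, b, c, p, q, s], injective_of_total h fun i j hij => ?_, fun i j hij => ?_⟩
      · fin_cases i <;> fin_cases j <;> first | exact absurd rfl hij | simp [*]
      · fin_cases i <;> fin_cases j <;>
          first | (simp [*]; done) | simp [H6] at hij
  obtain ⟨hax, hay, haz⟩ := ha
  obtain ⟨hbx, hby, hbz⟩ := hb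
  obtain ⟨hcx, hcy, hcz⟩ := hc
  rcases h.total hxy with h1 | h1 <;> rcases h.total hyz with h2 | h2 <;>
    rcases h.total hxz with h3 | h3
  · exact key x y z ⟨hax, hay, haz⟩ ⟨hbx, hby, hbz⟩ ⟨hcx, hcy, hcz⟩ h1 h2
  · exact key x y z ⟨hax, hay, haz⟩ ⟨hbx, hby, hbz⟩ ⟨hcx, hcy, hcz⟩ h1 h2
  · exact key x z y ⟨hax, haz, hay⟩ ⟨hbx, hbz, hby⟩ ⟨hcx, hcz, hcy⟩ h3 h2
  · exact key z x y ⟨haz, hax, hay⟩ ⟨hbz, hbx, hby⟩ ⟨hcz, hcx, hcy⟩ h3 h1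
  · exact key y x z ⟨hay, hax, haz⟩ ⟨hby, hbx, hbz⟩ ⟨hcy, hcx, hcz⟩ h1 h3
  · exact key y z x ⟨hay, haz, hax⟩ ⟨hby, hbz, hbx⟩ ⟨hcy, hcz, hcx⟩ h2 h3
  · exact key z y x ⟨haz, hay, hax⟩ ⟨hbz, hby, hbx⟩ ⟨hcz, hcy, hcx⟩ h2 h1
  · exact key z y x ⟨haz, hay, hax⟩ ⟨hbz, hby, hbx⟩ ⟨hcz, hcy, hcx⟩ h2 h1

open Classical in
theorem card_out_add_card_in (h : IsTournament r) {A : Finset V} {a : V} (ha : a ∈ A) :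
    (A.filter (r a)).card + (A.filter (r · a)).card + 1 = A.card := by
  have e : (A.filter fun b => ¬ r a b) = insert a (A.filter (r · a)) := by
    ext b
    simp only [Finset.mem_filter, Finset.mem_insert]
    constructor
    · rintro ⟨hb, hab⟩
      by_cases e : b = a
      · exact Or.inl e
      · exact Or.inr ⟨hb, (h.total e).resolve_right hab⟩
    · rintro (rfl | ⟨hb, hba⟩)
      · exact ⟨ha, h.1 b⟩
      · exact ⟨hb, h.asymm_s17 hba⟩
  rw [← Finset.card_filter_add_card_filter_not (s := A) (r a), e, Finset.card_insert_of_notMem,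
    add_assoc]
  simp [h.1 a]

open Classical in
theorem exists_card_le_two_mul_out (h : IsTournament r) {A : Finset V} (hA : A.Nonempty) :
    ∃ a ∈ A, A.card ≤ 2 * (A.filter (r a)).card + 1 := by
  by_contra! H
  have hs : ∑ a ∈ A, (A.filter (r a)).card = ∑ a ∈ A, (A.filter (r · a)).card :=
    Finset.sum_card_bipartiteAbove_eq_sum_card_bipartiteBelow r
  have h1 : ∑ a ∈ A, ((A.filter (r a)).card + (A.filter (r · a)).card + 1) = ∑ _a ∈ A, A.card :=
    Finset.sum_congr rfl fun a ha => card_out_add_card_in h ha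
  have h2 : ∑ a ∈ A, (2 * (A.filter (r a)).card + 1) < ∑ _a ∈ A, A.card :=
    Finset.sum_lt_sum_of_nonempty hA H
  simp only [Finset.sum_add_distrib, ← Finset.mul_sum] at h1 h2
  omega

open Classical in
theorem card_out_le_two (hK : NoTripleJoin r) {B : Finset V} {v w u : V} (hvw : r v w)
    (hv : ∀ b ∈ B, r v b) (hw : ∀ b ∈ B, r w b) (hu : u ∈ B) : (B.filter (r u)).card ≤ 2 := by
  by_contra! H
  obtain ⟨x, hx, y, hy, z, hz, hxy, hxz, hyz⟩ := Finset.two_lt_card.1 H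
  simp only [Finset.mem_filter] at hx hy hz
  exact hK hvw (hv u hu) (hw u hu) hxy hxz hyz ⟨hv x hx.1, hv y hy.1, hv z hz.1⟩
    ⟨hw x hx.1, hw y hy.1, hw z hz.1⟩ ⟨hx.2, hy.2, hz.2⟩

theorem card_le_five (h : IsTournament r) (hK : NoTripleJoin r) {B : Finset V} {v w : V}
    (hvw : r v w) (hv : ∀ b ∈ B, r v b) (hw : ∀ b ∈ B, r w b) : B.card ≤ 5 := by
  classical
  rcases B.eq_empty_or_nonempty with rfl | hB
  · simp
  · obtain ⟨u, hu, H⟩ := exists_card_le_two_mul_out h hB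
    have := card_out_le_two hK hvw hv hw hu
    omega

open Classical in
theorem exists_ten_le_out (h : IsTournament r) (hK : NoTripleJoin r) [Fintype V]
    (hV : Fintype.card V = 20) :
    ∃ v, 10 ≤ (Finset.univ.filter (r v)).card ∧ 8 ≤ (Finset.univ.filter (r · v)).card := by
  have hne : (Finset.univ : Finset V).Nonempty := by
    rw [← Finset.card_pos, Finset.card_univ, hV]
    norm_num
  obtain ⟨v, hv, H⟩ := exists_card_le_two_mul_out h hne
  have hio := card_out_add_card_in h hv
  rw [Finset.card_univ, hV] at H hio
  have hA : (Finset.univ.filter (r v)).Nonempty := by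
    rw [← Finset.card_pos]
    omega
  obtain ⟨w, hw, H'⟩ := exists_card_le_two_mul_out h hA
  have := card_le_five h hK (v := v) (w := w) (B := (Finset.univ.filter (r v)).filter (r w))
    (by simpa using hw) (by simp +contextual) (by simp)
  exact ⟨v, by omega, by omega⟩

open Classical in
theorem exists_transitive_triple (h : IsTournament r) {X : Finset V} (hX : X.card = 4) :
    ∃ a ∈ X, ∃ b ∈ X, ∃ c ∈ X, ∃ d ∈ X, r a b ∧ r a c ∧ r b c ∧ d ≠ a ∧ d ≠ b ∧ d ≠ c := by
  obtain ⟨a, ha, H⟩ := exists_card_le_two_mul_out h (Finset.card_pos.1 (by omega : 0 < X.card))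
  have : 1 < (X.filter (r a)).card := by omega
  obtain ⟨b, c, hb, hc, hbc⟩ := Finset.one_lt_card_iff.1 this
  simp only [Finset.mem_filter] at hb hc
  obtain ⟨d, hd, hd'⟩ := Finset.exists_mem_notMem_of_card_lt_card
    (s := {a, b, c}) (t := X) (Finset.card_le_three.trans_lt (by omega))
  simp only [Finset.mem_insert, Finset.mem_singleton, not_or] at hd'
  rcases h.total hbc with e | e
  · exact ⟨a, ha, b, hb.1, c, hc.1, d, hd, hb.2, hc.2, e, hd'⟩
  · exact ⟨a, ha, c, hc.1, b, hb.1, d, hd, hc.2, hb.2, e, hd'.1, hd'.2.2, hd'.2.1⟩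

theorem exists_eq_pair (h : IsTournament r) {X : Finset V} (hX : X.card = 2) :
    ∃ a ∈ X, ∃ b ∈ X, r a b := by
  obtain ⟨a, b, ha, hb, hab⟩ := Finset.one_lt_card_iff.1 (by omega : 1 < X.card)
  rcases h.total hab with e | e
  · exact ⟨a, ha, b, hb, e⟩
  · exact ⟨b, hb, a, ha, e⟩

/-! ### Soundness of the search for Paley tournaments -/

open Classical in
/-- The out-neighbourhood of `a` among `f 0, …, f (n - 1)` as a binary number. -/
noncomputable def mask (r : V → V → Prop) (f : ℕ → V) (n : ℕ) (a : V) : ℕ :=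
  Nat.ofBits fun j : Fin n => decide (r a (f j))

theorem testBit_mask {f : ℕ → V} {n : ℕ} {a : V} {j : ℕ} :
    (mask r f n a).testBit j = true ↔ j < n ∧ r a (f j) := by
  classical
  by_cases hj : j < n
  · rw [mask, Nat.testBit_ofBits_lt _ _ hj]
    simp [hj]
  · rw [mask, Nat.testBit_ofBits_ge _ _ (not_lt.1 hj)]
    simp [hj]

/-- The out-neighbourhood masks of the subtournament on `f 0, …, f (n - 1)`. -/
noncomputable def rows (r : V → V → Prop) (f : ℕ → V) (n : ℕ) : List ℕ :=
  (List.range n).map fun i => mask r f n (f i)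

theorem length_rows (f : ℕ → V) (n : ℕ) : (rows r f n).length = n := by simp [rows]

theorem extend_rows (h : IsTournament r) {f : ℕ → V} {n : ℕ} (hf : ∀ i < n, f i ≠ f n) :
    extend (rows r f n) (mask r f n (f n)) = rows r f (n + 1) := by
  have last : mask r f n (f n) = mask r f (n + 1) (f n) := by
    refine Nat.eq_of_testBit_eq fun j => Bool.eq_iff_iff.2 ?_
    rw [testBit_mask, testBit_mask]
    constructor
    · rintro ⟨hj, hr⟩
      exact ⟨by omega, hr⟩
    · rintro ⟨hj, hr⟩
      refine ⟨?_, hr⟩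
      by_contra hn
      obtain rfl : j = n := by omega
      exact h.1 _ hr
  have e : rows r f (n + 1) =
      (List.range n).map (fun i => mask r f (n + 1) (f i)) ++ [mask r f (n + 1) (f n)] := by
    simp [rows, List.range_succ]
  rw [e, extend, ← last, length_rows]
  congr 1
  refine List.ext_getElem (by simp [rows]) fun i hi _ => ?_
  have hin : i < n := by simpa [rows] using hi
  simp only [List.getElem_mapIdx, rows, List.getElem_map, List.getElem_range, bitAt_eq]
  refine Nat.eq_of_testBit_eq fun j => Bool.eq_iff_iff.2 ?_
  rw [testBit_mask]
  by_cases hb : (mask r f n (f n)).testBit i = true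
  · rw [hb, cond_true, testBit_mask]
    have := (testBit_mask.1 hb).2
    constructor
    · rintro ⟨hj, hr⟩
      exact ⟨by omega, hr⟩
    · rintro ⟨hj, hr⟩
      refine ⟨?_, hr⟩
      by_contra hn
      obtain rfl : j = n := by omega
      exact h.asymm_s17 this hr
  · have hni : ¬ r (f n) (f i) := fun hr => hb (testBit_mask.2 ⟨hin, hr⟩)
    have hr := (h.total (hf i hin)).resolve_right hni
    rw [Bool.not_eq_true] at hb
    rw [hb, cond_false]
    change ((mask r f n (f i)) ||| 2 ^ n).testBit j = true ↔ _
    rw [Nat.testBit_lor, Bool.or_eq_true, testBit_mask, Nat.testBit_two_pow, decide_eq_true_iff]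
    constructor
    · rintro (⟨hj, hrj⟩ | rfl)
      · exact ⟨by omega, hrj⟩
      · exact ⟨by omega, hr⟩
    · rintro ⟨hj, hrj⟩
      by_cases e : n = j
      · exact Or.inr e
      · exact Or.inl ⟨by omega, hrj⟩

/-- No two of `f 0, …, f (n - 1)` have three common out-neighbours among these. -/
def FewCommon (r : V → V → Prop) (f : ℕ → V) (n : ℕ) : Prop :=
  ∀ i < n, ∀ j < n, i ≠ j → ∀ a < n, ∀ b < n, ∀ c < n, a ≠ b → a ≠ c → b ≠ c →
    r (f i) (f a) ∧ r (f i) (f b) ∧ r (f i) (f c) →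
    r (f j) (f a) ∧ r (f j) (f b) ∧ r (f j) (f c) → False

theorem atMostTwo_land_mask {f : ℕ → V} {n N : ℕ} (hP : FewCommon r f N) (hn : n ≤ N) {i j : ℕ}
    (hi : i < N) (hj : j < N) (hij : i ≠ j) :
    atMostTwo (Nat.land (mask r f n (f i)) (mask r f n (f j))) = true := by
  by_contra H
  obtain ⟨a, b, c, hab, hac, hbc, ha, hb, hc⟩ := exists_three_bits (Bool.not_eq_true _ ▸ H)
  have key : ∀ a, (Nat.land (mask r f n (f i)) (mask r f n (f j))).testBit a = true →
      a < n ∧ r (f i) (f a) ∧ r (f j) (f a) := fun a ha => by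
    have := (Nat.testBit_land (mask r f n (f i)) (mask r f n (f j)) a).symm.trans ha
    rw [Bool.and_eq_true, testBit_mask, testBit_mask] at this
    exact ⟨this.1.1, this.1.2, this.2.2⟩
  obtain ⟨la, ia, ja⟩ := key a ha
  obtain ⟨lb, ib, jb⟩ := key b hb
  obtain ⟨lc, ic, jc⟩ := key c hc
  exact hP i hi j hj hij a (by omega) b (by omega) c (by omega) hab hac hbc ⟨ia, ib, ic⟩
    ⟨ja, jb, jc⟩

theorem goodRow_of_forall {t s : ℕ} {l : List ℕ}
    (h : ∀ i (hi : i < l.length), s.testBit i = true → atMostTwo (Nat.land t l[i]) = true) :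
    goodRow t l s = true := by
  induction l generalizing s with
  | nil => rfl
  | cons u us ih =>
    rw [goodRow, Bool.and_eq_true, Bool.or_eq_true]
    constructor
    · by_cases h0 : s.testBit 0 = true
      · exact Or.inr (h 0 (Nat.succ_pos _) h0)
      · refine Or.inl ?_
        have e : s &&& 1 = 0 := by
          rw [Nat.and_one_is_mod]
          simpa [Nat.testBit_zero] using h0
        exact (congrArg (Nat.beq · 0) e).trans rfl
    · refine ih fun i hi hs => h (i + 1) (Nat.succ_lt_succ hi) ?_
      rw [add_comm, ← Nat.testBit_shiftRight]
      exact hs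

theorem good_rows (h : IsTournament r) {f : ℕ → V} {n N : ℕ} (hP : FewCommon r f N)
    (hn : n ≤ N) : good (rows r f n) = true := by
  refine List.all_eq_true.2 fun t ht => goodRow_of_forall fun j hj hs => ?_
  obtain ⟨i, hi, rfl⟩ := List.mem_map.1 ht
  rw [List.mem_range] at hi
  rw [length_rows] at hj
  have hij : i ≠ j := by
    rintro rfl
    exact h.1 _ (testBit_mask.1 hs).2
  simp only [rows, List.getElem_map, List.getElem_range]
  exact atMostTwo_land_mask hP hn (by omega) (by omega) hij

/-- The vertices `f n, f (n + 1), …` satisfy the given constraints. -/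
def Satisfies (r : V → V → Prop) (f : ℕ → V) : ℕ → List (List (ℕ × Bool)) → Prop
  | _, [] => True
  | n, c :: cs => (∀ p ∈ c, p.1 < n ∧ (p.2 = true ↔ r (f n) (f p.1))) ∧ Satisfies r f (n + 1) cs

theorem containsPaley_rows {f : ℕ → V} {n : ℕ} (h : containsPaley (rows r f n) = true) :
    ∃ g : ℕ → ℕ, (∀ i < 10, g i < 10) ∧
      ∀ i < 10, ∀ j < 10, paley i j = true → r (f (g i)) (f (g j)) := by
  obtain ⟨k, -, hk⟩ := List.any_eq_true.1 h
  rw [forceList_eq] at hk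
  have H : ∀ i < 10, (paleyPositions (rows r f n) k).getD i 0 < 10 ∧ ∀ j < 10, paley i j = true →
      r (f ((paleyPositions (rows r f n) k).getD i 0))
        (f ((paleyPositions (rows r f n) k).getD j 0)) := by
    generalize paleyPositions (rows r f n) k = g at hk
    intro i hi
    have := List.all_eq_true.1 hk i (List.mem_range.2 hi)
    rw [Bool.and_eq_true] at this
    refine ⟨by simpa using this.1, fun j hj hp => ?_⟩
    have := List.all_eq_true.1 this.2 j (List.mem_range.2 hj)
    rw [hp, Bool.not_true, Bool.false_or, bitAt_eq] at this
    by_cases hn : g.getD i 0 < n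
    · rw [List.getD_eq_getElem _ _ (by rwa [length_rows])] at this
      simp only [rows, List.getElem_map, List.getElem_range] at this
      exact (testBit_mask.1 this).2
    · rw [List.getD_eq_default _ _ (by rw [length_rows]; omega), Nat.zero_testBit] at this
      exact absurd this (by decide)
  exact ⟨_, fun i hi => (H i hi).1, fun i hi => (H i hi).2⟩

theorem exists_paley_of_allPaley (h : IsTournament r) {f : ℕ → V} {N : ℕ}
    (hf : ∀ i < N, ∀ j < N, i ≠ j → f i ≠ f j) (hP : FewCommon r f N)
    {cs : List (List (ℕ × Bool))} {n : ℕ} (hn : n + cs.length = N) (hs : Satisfies r f n cs)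
    (H : allPaley cs (rows r f n) = true) :
    ∃ g : ℕ → ℕ, (∀ i < 10, g i < 10) ∧
      ∀ i < 10, ∀ j < 10, paley i j = true → r (f (g i)) (f (g j)) := by
  induction cs generalizing n with
  | nil => exact containsPaley_rows H
  | cons c cs ih =>
    rw [List.length_cons] at hn
    have hm : mask r f n (f n) ∈ candidates (rows r f n).length c := by
      rw [length_rows]
      refine List.mem_filter.2 ⟨List.mem_range.2 (Nat.ofBits_lt_two_pow _), ?_⟩
      refine List.all_eq_true.2 fun p hp => ?_
      obtain ⟨hpn, hp⟩ := hs.1 p hp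
      rw [beq_iff_eq, bitAt_eq, Bool.eq_iff_iff, testBit_mask, hp]
      simp [hpn]
    have := List.all_eq_true.1 H _ hm
    rw [forceList_eq, extend_rows h fun i hi => hf i (by omega) n (by omega) (by omega),
      good_rows h hP (by omega), Bool.not_true, Bool.false_or] at this
    have hpre : ((rows r f n).all fun t => atMostTwo (Nat.land t (mask r f n (f n)))) = true := by
      refine List.all_eq_true.2 fun t ht => ?_
      obtain ⟨i, hi, rfl⟩ := List.mem_map.1 ht
      rw [List.mem_range] at hi
      exact atMostTwo_land_mask hP (by omega) (by omega) (by omega) (by omega)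
    rw [hpre, Bool.not_true, Bool.false_or] at this
    exact ih (by omega) hs.2 this

open Classical in
theorem exists_paley_of_card_eq_ten (h : IsTournament r) {D : Finset V} (hD : D.card = 10)
    (hQ : ∀ a ∈ D, ∀ b ∈ D, r a b → ((D.filter (r a)).filter (r b)).card ≤ 2) :
    ∃ f : ℕ → V, (∀ i < 10, f i ∈ D) ∧
      ∀ i < 10, ∀ j < 10, paley i j = true → r (f i) (f j) := by
  obtain ⟨w, hw, Hw⟩ := exists_card_le_two_mul_out h (Finset.card_pos.1 (by omega : 0 < D.card))
  have hio := card_out_add_card_in h hw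
  obtain ⟨b0, hb0, Hb⟩ := exists_card_le_two_mul_out h
    (Finset.card_pos.1 (by omega : 0 < (D.filter (r w)).card))
  have hio' := card_out_add_card_in h hb0
  have hb0' := Finset.mem_filter.1 hb0
  have := hQ w hw b0 hb0'.1 hb0'.2
  obtain ⟨b1, hb1, b2, hb2, h12⟩ := exists_eq_pair h
    (by omega : ((D.filter (r w)).filter (r b0)).card = 2)
  obtain ⟨b3, hb3, b4, hb4, h34⟩ := exists_eq_pair h
    (by omega : ((D.filter (r w)).filter (r · b0)).card = 2)
  obtain ⟨x0, hx0, x1, hx1, x2, hx2, x3, hx3, h01, h02, hx12, n0, n1, n2⟩ :=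
    exists_transitive_triple h (by omega : (D.filter (r · w)).card = 4)
  simp only [Finset.mem_filter] at hb0 hb1 hb2 hb3 hb4 hx0 hx1 hx2 hx3
  let f : ℕ → V := fun i => [w, b0, b1, b2, b3, b4, x0, x1, x2, x3].getD i w
  have hfD : ∀ i < 10, f i ∈ D := by
    intro i hi
    interval_cases i <;> simp [f, hw, hb0, hb1, hb2, hb3, hb4, hx0, hx1, hx2, hx3]
  have hne : ∀ {a b : V}, r a w → r w b → a ≠ b := by
    rintro a b ha hb rfl
    exact h.asymm_s17 ha hb
  have hne' : ∀ {a b : V}, r a b0 → r b0 b → b ≠ a := by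
    rintro a b ha hb rfl
    exact h.asymm_s17 ha hb
  have hnodup : [w, b0, b1, b2, b3, b4, x0, x1, x2, x3].Nodup := by
    simp only [List.nodup_cons, List.mem_cons, List.not_mem_nil, not_or, or_false,
      not_false_eq_true, List.nodup_nil, and_true, ← ne_eq]
    exact ⟨⟨h.ne hb0.2, h.ne hb1.1.2, h.ne hb2.1.2, h.ne hb3.1.2, h.ne hb4.1.2, (h.ne hx0.2).symm,
        (h.ne hx1.2).symm, (h.ne hx2.2).symm, (h.ne hx3.2).symm⟩,
      ⟨h.ne hb1.2, h.ne hb2.2, (h.ne hb3.2).symm, (h.ne hb4.2).symm, (hne hx0.2 hb0.2).symm,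
        (hne hx1.2 hb0.2).symm, (hne hx2.2 hb0.2).symm, (hne hx3.2 hb0.2).symm⟩,
      ⟨h.ne h12, hne' hb3.2 hb1.2, hne' hb4.2 hb1.2, (hne hx0.2 hb1.1.2).symm,
        (hne hx1.2 hb1.1.2).symm, (hne hx2.2 hb1.1.2).symm, (hne hx3.2 hb1.1.2).symm⟩,
      ⟨hne' hb3.2 hb2.2, hne' hb4.2 hb2.2, (hne hx0.2 hb2.1.2).symm,
        (hne hx1.2 hb2.1.2).symm, (hne hx2.2 hb2.1.2).symm, (hne hx3.2 hb2.1.2).symm⟩,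
      ⟨h.ne h34, (hne hx0.2 hb3.1.2).symm, (hne hx1.2 hb3.1.2).symm, (hne hx2.2 hb3.1.2).symm,
        (hne hx3.2 hb3.1.2).symm⟩,
      ⟨(hne hx0.2 hb4.1.2).symm, (hne hx1.2 hb4.1.2).symm, (hne hx2.2 hb4.1.2).symm,
        (hne hx3.2 hb4.1.2).symm⟩,
      ⟨h.ne h01, h.ne h02, n0.symm⟩, ⟨h.ne hx12, n1.symm⟩, n2.symm⟩
  have hinj : ∀ i < 10, ∀ j < 10, i ≠ j → f i ≠ f j := by
    intro i hi j hj hij e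
    simp only [f] at e
    rw [List.getD_eq_getElem _ _ (by simpa using hi),
      List.getD_eq_getElem _ _ (by simpa using hj)] at e
    exact hij ((hnodup.getElem_inj_iff).1 e)
  have hP : FewCommon r f 10 := by
    have key : ∀ i < 10, ∀ j < 10, r (f i) (f j) → ∀ a < 10, ∀ b < 10, ∀ c < 10,
        a ≠ b → a ≠ c → b ≠ c → r (f i) (f a) ∧ r (f i) (f b) ∧ r (f i) (f c) →
        r (f j) (f a) ∧ r (f j) (f b) ∧ r (f j) (f c) → False := by
      rintro i hi j hj hr a ha b hb c hc hab hac hbc ⟨ia, ib, ic⟩ ⟨ja, jb, jc⟩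
      refine (hQ _ (hfD i hi) _ (hfD j hj) hr).not_gt (Finset.two_lt_card.2
        ⟨f a, ?_, f b, ?_, f c, ?_, hinj a ha b hb hab, hinj a ha c hc hac, hinj b hb c hc hbc⟩)
      · simp [hfD a ha, ia, ja]
      · simp [hfD b hb, ib, jb]
      · simp [hfD c hc, ic, jc]
    intro i hi j hj hij a ha b hb c hc hab hac hbc hia hja
    rcases h.total (hinj i hi j hj hij) with hr | hr
    · exact key i hi j hj hr a ha b hb c hc hab hac hbc hia hja
    · exact key j hj i hi hr a ha b hb c hc hab hac hbc hja hia
  have hs : Satisfies r f 0 constraints := by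
    simp [Satisfies, constraints, f, h.asymm_s17 hb0.2, h.asymm_s17 hb1.1.2, h.asymm_s17 hb2.1.2,
      h.asymm_s17 hb3.1.2, h.asymm_s17 hb4.1.2, h.asymm_s17 hb1.2, h.asymm_s17 hb2.2, h.asymm_s17 h12, hb3.2, hb4.2,
      h.asymm_s17 h34, hx0.2, hx1.2, hx2.2, hx3.2, h.asymm_s17 h01, h.asymm_s17 h02, h.asymm_s17 hx12]
  obtain ⟨g, hg, H⟩ := exists_paley_of_allPaley h hinj hP rfl hs allPaley_constraints
  exact ⟨f ∘ g, fun i hi => hfD _ (hg i hi), H⟩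

/-! ### Soundness of the clique search -/

theorem mem_compatibleWith {t u : ℕ × ℕ × ℕ} {l : List (ℕ × ℕ × ℕ)} (hu : u ∈ l)
    (h : compatible t u = true) : u ∈ compatibleWith t l := by
  induction l with
  | nil => exact hu
  | cons a l ih =>
    change u ∈ bif compatible t a then a :: compatibleWith t l else compatibleWith t l
    rcases List.mem_cons.1 hu with rfl | hu
    · rw [h]
      exact List.mem_cons_self
    · cases compatible t a
      · exact ih hu
      · exact List.mem_cons_of_mem _ (ih hu)

theorem card_lt_of_noClique {ι : Type*} {c : ι → ℕ × ℕ × ℕ} {k : ℕ} {l : List (ℕ × ℕ × ℕ)}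
    {S : Finset ι} (h : noClique k l = true) (hS : ∀ x ∈ S, c x ∈ l)
    (hc : ∀ x ∈ S, ∀ y ∈ S, x ≠ y → compatible (c x) (c y) = true)
    (hself : ∀ x ∈ S, compatible (c x) (c x) = false) : S.card < k := by
  classical
  induction k generalizing l S with
  | zero => exact absurd h Bool.false_ne_true
  | succ k ihk =>
    induction l with
    | nil =>
      rw [Finset.eq_empty_of_forall_notMem fun x hx => List.not_mem_nil (hS x hx)]
      exact Nat.succ_pos k
    | cons t l ih =>
      change (noClique k (compatibleWith t l) && noClique (k + 1) l) = true at h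
      rw [Bool.and_eq_true] at h
      by_cases ht : ∃ x ∈ S, c x = t
      · obtain ⟨x, hx, rfl⟩ := ht
        have : (S.erase x).card < k := by
          refine ihk h.1 (fun y hy => ?_)
            (fun y hy z hz => hc y (Finset.mem_of_mem_erase hy) z (Finset.mem_of_mem_erase hz))
            fun y hy => hself y (Finset.mem_of_mem_erase hy)
          obtain ⟨hyx, hy⟩ := Finset.mem_erase.1 hy
          have hxy := hc x hx y hy hyx.symm
          refine mem_compatibleWith ((List.mem_cons.1 (hS y hy)).resolve_left fun e => ?_) hxy
          rw [e, hself x hx] at hxy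
          exact absurd hxy (by decide)
        rw [Finset.card_erase_of_mem hx] at this
        omega
      · exact ih h.2 fun x hx => (List.mem_cons.1 (hS x hx)).resolve_left fun e => ht ⟨x, hx, e⟩

/-! ### Compatibility of the in-neighbours of a vertex -/

theorem paley_total : ∀ i < 10, ∀ j < 10, i ≠ j → paley i j = true ∨ paley j i = true := by
  decide

theorem bitAt_mask {f : ℕ → V} {n : ℕ} {a : V} {j : ℕ} :
    bitAt (mask r f n a) j = true ↔ j < n ∧ r a (f j) := by
  rw [bitAt_eq, testBit_mask]

theorem mem_triples {i j k : ℕ} (h : (i, j, k) ∈ triples) : i < j ∧ j < k ∧ k < 10 := by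
  simp only [triples, List.mem_flatMap, List.mem_map, List.mem_range, Prod.mk.injEq] at h
  obtain ⟨_, hk, _, hj, _, hi, rfl, rfl, rfl⟩ := h
  exact ⟨hi, hj, hk⟩

/-- The vertex `v` dominates a copy `f 0, …, f 9` of the Paley tournament minus a vertex. -/
structure DominatesPaley (r : V → V → Prop) (v : V) (f : ℕ → V) : Prop where
  dominates : ∀ i < 10, r v (f i)
  arc : ∀ i < 10, ∀ j < 10, paley i j = true → r (f i) (f j)

namespace DominatesPaley

variable {v x y : V} {f : ℕ → V}

theorem ne (hf : DominatesPaley r v f) (h : IsTournament r) {i j : ℕ} (hi : i < 10) (hj : j < 10)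
    (hij : i ≠ j) : f i ≠ f j := by
  rcases paley_total i hi j hj hij with e | e
  · exact h.ne (hf.arc i hi j hj e)
  · exact (h.ne (hf.arc j hj i hi e)).symm

theorem ne_of_inNeighbor (hf : DominatesPaley r v f) (h : IsTournament r) (hx : r x v) {i : ℕ}
    (hi : i < 10) : f i ≠ x := by
  rintro rfl
  exact h.asymm_s17 hx (hf.dominates i hi)

theorem arc_of_not_bitAt (hf : DominatesPaley r v f) (h : IsTournament r) (hx : r x v) {i : ℕ}
    (hi : i < 10) (hb : bitAt (mask r f 10 x) i = false) : r (f i) x := by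
  refine (h.total (hf.ne_of_inNeighbor h hx hi)).resolve_right fun hr => ?_
  rw [bitAt_mask.2 ⟨hi, hr⟩] at hb
  exact absurd hb (by decide)

theorem admissible_mask (hf : DominatesPaley r v f) (h : IsTournament r) (hK : NoTripleJoin r)
    (hx : r x v) : admissible (mask r f 10 x) = true := by
  refine List.all_eq_true.2 ?_
  rintro ⟨i, j, k, l⟩ hs
  simp only [stars, List.mem_flatMap, List.mem_map, List.mem_range, Prod.mk.injEq,
    List.mem_filter, Bool.and_eq_true] at hs
  obtain ⟨_, hi, ⟨_, _, _⟩, ⟨ht, ⟨pj, pk⟩, pl⟩, rfl, rfl, rfl, rfl⟩ := hs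
  obtain ⟨hjk, hkl, hl⟩ := mem_triples ht
  rw [Bool.not_eq_true', ← Bool.not_eq_true]
  simp only [Bool.and_eq_true, bitAt_mask]
  rintro ⟨⟨⟨xi, xj⟩, xk⟩, xl⟩
  exact hK hx xi.2 (hf.dominates _ hi)
    (hf.ne h xj.1 xk.1 (by omega)) (hf.ne h xj.1 xl.1 (by omega)) (hf.ne h xk.1 xl.1 (by omega))
    ⟨xj.2, xk.2, xl.2⟩ ⟨hf.dominates _ xj.1, hf.dominates _ xk.1, hf.dominates _ xl.1⟩
    ⟨hf.arc _ hi _ xj.1 pj, hf.arc _ hi _ xk.1 pk, hf.arc _ hi _ xl.1 pl⟩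

theorem tripleCode_land (hf : DominatesPaley r v f) (h : IsTournament r) (hK : NoTripleJoin r)
    (hx : r x v) (hy : r y v) (hxy : x ≠ y) :
    Nat.beq (Nat.land (tripleCode (mask r f 10 x)) (tripleCode (mask r f 10 y))) 0 = true := by
  refine bits_land_bits ?_
  rintro ⟨b, i, j, k⟩ hmem hp hq
  simp only [Bool.and_eq_true, beq_iff_eq] at hp hq
  obtain ⟨⟨xi, xj⟩, xk⟩ := hp
  obtain ⟨⟨yi, yj⟩, yk⟩ := hq
  simp only [tests, List.mem_append, List.mem_map, Prod.mk.injEq] at hmem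
  rcases hmem with ⟨⟨_, _, _⟩, ht, rfl, rfl, rfl, rfl⟩ | ⟨⟨_, _, _⟩, ht, rfl, rfl, rfl, rfl⟩
  · obtain ⟨hij, hjk, hk⟩ := mem_triples ht
    rw [bitAt_mask] at xi xj xk yi yj yk
    have h1 := hf.ne h xi.1 xj.1 (by omega)
    have h2 := hf.ne h xi.1 xk.1 (by omega)
    have h3 := hf.ne h xj.1 xk.1 (by omega)
    rcases h.total hxy with e | e
    · exact hK e hx hy h1 h2 h3 ⟨xi.2, xj.2, xk.2⟩ ⟨yi.2, yj.2, yk.2⟩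
        ⟨hf.dominates _ xi.1, hf.dominates _ xj.1, hf.dominates _ xk.1⟩
    · exact hK e hy hx h1 h2 h3 ⟨yi.2, yj.2, yk.2⟩ ⟨xi.2, xj.2, xk.2⟩
        ⟨hf.dominates _ xi.1, hf.dominates _ xj.1, hf.dominates _ xk.1⟩
  · simp only [transTriples, List.mem_flatMap, List.mem_map, List.mem_range, Prod.mk.injEq,
      List.mem_filter, Bool.and_eq_true, List.any_eq_true] at ht
    obtain ⟨_, hi, _, ⟨hj, pij⟩, _, ⟨hk, ⟨pik, pjk⟩, l, hl, ⟨pil, pjl⟩, pkl⟩, rfl, rfl, rfl⟩ := ht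
    exact hK (hf.arc _ hi _ hj pij) (hf.arc _ hi _ hk pik) (hf.arc _ hj _ hk pjk)
      (hf.ne_of_inNeighbor h hx hl) (hf.ne_of_inNeighbor h hy hl) hxy
      ⟨hf.arc _ hi _ hl pil, hf.arc_of_not_bitAt h hx hi xi, hf.arc_of_not_bitAt h hy hi yi⟩
      ⟨hf.arc _ hj _ hl pjl, hf.arc_of_not_bitAt h hx hj xj, hf.arc_of_not_bitAt h hy hj yj⟩
      ⟨hf.arc _ hk _ hl pkl, hf.arc_of_not_bitAt h hx hk xk, hf.arc_of_not_bitAt h hy hk yk⟩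

theorem arcCode_land (hf : DominatesPaley r v f) (h : IsTournament r) (hK : NoTripleJoin r)
    (hx : r x v) (hy : r y v) (hxy : r x y) :
    Nat.beq (Nat.land (arcCode (mask r f 10 x)) (coarcCode (mask r f 10 y))) 0 = true := by
  refine bits_land_bits ?_
  rintro ⟨i, j, k, l⟩ hmem hp hq
  simp only [arcs, List.mem_flatMap, List.mem_map, List.mem_range, Prod.mk.injEq,
    List.mem_filter, Bool.and_eq_true] at hmem
  obtain ⟨_, hi, _, ⟨hj, pij⟩, _, ⟨hk, pik, pjk⟩, _, ⟨⟨hl, pil, pjl⟩, hkl⟩, rfl, rfl, rfl, rfl⟩ :=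
    hmem
  have hkl := Nat.blt_eq.mp hkl
  simp only [Bool.and_eq_true, Bool.or_eq_true, Bool.not_eq_true'] at hp hq
  obtain ⟨⟨hij, xk⟩, xl⟩ := hp
  obtain ⟨yi, yj⟩ := hq
  replace yi := hf.arc_of_not_bitAt h hy hi yi
  replace yj := hf.arc_of_not_bitAt h hy hj yj
  rw [bitAt_mask] at xk xl
  have nkl := hf.ne h hk hl (by omega)
  have nk := hf.ne_of_inNeighbor h hy hk
  have nl := hf.ne_of_inNeighbor h hy hl
  have rij := hf.arc _ hi _ hj pij
  have ci := And.intro (hf.arc _ hi _ hk pik) (And.intro (hf.arc _ hi _ hl pil) yi)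
  have cj := And.intro (hf.arc _ hj _ hk pjk) (And.intro (hf.arc _ hj _ hl pjl) yj)
  have cx := And.intro xk.2 (And.intro xl.2 hxy)
  rcases h.total (hf.ne_of_inNeighbor h hx hi) with ix | xi
  · rcases h.total (hf.ne_of_inNeighbor h hx hj) with jx | xj
    · exact hK rij ix jx nkl nk nl ci cj cx
    · exact hK ix rij xj nkl nk nl ci cx cj
  · rcases hij with xi' | xj
    · exact h.asymm_s17 xi (hf.arc_of_not_bitAt h hx hi xi')
    · rw [bitAt_mask] at xj
      exact hK xi xj.2 rij nkl nk nl cx ci cj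

theorem compatible_code_mask (hf : DominatesPaley r v f) (h : IsTournament r)
    (hK : NoTripleJoin r) (hx : r x v) (hy : r y v) (hxy : x ≠ y) :
    compatible (code (mask r f 10 x)) (code (mask r f 10 y)) = true := by
  rw [compatible, Bool.and_eq_true, Bool.or_eq_true]
  refine ⟨hf.tripleCode_land h hK hx hy hxy, ?_⟩
  rcases h.total hxy with e | e
  · exact Or.inl (hf.arcCode_land h hK hx hy e)
  · exact Or.inr (hf.arcCode_land h hK hy hx e)

theorem card_lt_eight (hf : DominatesPaley r v f) (h : IsTournament r) (hK : NoTripleJoin r)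
    {X : Finset V} (hX : ∀ x ∈ X, r x v) : X.card < 8 := by
  have hmem : ∀ x ∈ X, mask r f 10 x ∈ masks := fun x hx =>
    mem_masks_of_admissible (Nat.ofBits_lt_two_pow _) (hf.admissible_mask h hK (hX x hx))
  exact card_lt_of_noClique (c := fun x => code (mask r f 10 x)) noClique_masks.2
    (fun x hx => List.mem_map_of_mem (hmem x hx))
    (fun x hx y hy hxy => hf.compatible_code_mask h hK (hX x hx) (hX y hy) hxy)
    fun x hx => noClique_masks.1 _ (hmem x hx)

end DominatesPaley

theorem not_noTripleJoin (h : IsTournament r) [Fintype V] (hV : Fintype.card V = 20) :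
    ¬ NoTripleJoin r := by
  classical
  intro hK
  obtain ⟨v, hout, hin⟩ := exists_ten_le_out h hK hV
  obtain ⟨D, hDv, hD⟩ := Finset.exists_subset_card_eq hout
  have hv : ∀ a ∈ D, r v a := fun a ha => by simpa using hDv ha
  obtain ⟨f, hfD, hf⟩ := exists_paley_of_card_eq_ten h hD fun a ha b hb hab =>
    card_out_le_two hK (hv a ha) (B := D.filter (r a))
      (fun c hc => hv c (Finset.mem_filter.1 hc).1) (fun c hc => (Finset.mem_filter.1 hc).2)
      (Finset.mem_filter.2 ⟨hb, hab⟩)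
  have hP : DominatesPaley r v f := ⟨fun i hi => hv _ (hfD i hi), hf⟩
  exact (hP.card_lt_eight h hK (X := Finset.univ.filter (r · v)) (by simp)).not_ge hin

end Tournament20

theorem tournament_20_TT6_or_H6 (r : Fin 20 → Fin 20 → Prop)
    (h : IsTournament r) :
    HasTT r 6 ∨
      ∃ g : Fin 6 → Fin 20, Function.Injective g ∧
        ∀ i j : Fin 6, H6 i j → r (g i) (g j) := by
  by_contra! H
  refine Tournament20.not_noTripleJoin h (Fintype.card_fin 20)
    (Tournament20.noTripleJoin h H.1 ?_)
  rintro ⟨g, hg, hg'⟩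
  obtain ⟨i, j, hij, hr⟩ := H.2 g hg
  exact hr (hg' i j hij)
end
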